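/- Let 0 < α ≤ 1/2, let f ∈ 𝒜_α be an outer function with f ≢ 0 and ‖f‖_{𝒜_α} ≤ 1, let N ≥ 1 be an integer and ρ > 1. Then for every union Γ of component arcs of 𝕋\E_f, the function f^ρ · f_Γ^N belongs to 𝒜_α, and sup_Γ ‖f^ρ f_Γ^N‖_{𝒜_α} ≤ C_{N,ρ}, where C_{N,ρ} > 0 depends only on N, ρ and α (not on Γ). -/

import Mathlib

open Complex MeasureTheory Set Metric Filter
open scoped ENNReal Classical

noncomputable section

/-- The open unit disc in `ℂ`. -/
def uDisc : Set ℂ := Metric.ball 0 1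

/-- The unit circle in `ℂ`. -/
def uCircle : Set ℂ := Metric.sphere (0 : ℂ) 1

/-- `f` is analytic on the open unit disc and continuous on the closed unit disc. -/
def IsDiscReg (f : ℂ → ℂ) : Prop :=
  DifferentiableOn ℂ f uDisc ∧ ContinuousOn f (Metric.closedBall 0 1)

/-- The little-o Lipschitz condition of order `α` on the closed unit disc:
`|f z - f w| = o(|z-w|^α)` as `|z - w| → 0`. -/
def LittleLip (α : ℝ) (f : ℂ → ℂ) : Prop :=
  ∀ ε > 0, ∃ δ > 0, ∀ z ∈ Metric.closedBall (0 : ℂ) 1, ∀ w ∈ Metric.closedBall (0 : ℂ) 1,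
    ‖z - w‖ < δ → ‖f z - f w‖ ≤ ε * ‖z - w‖ ^ α

/-- Membership in `lip_α`. -/
def MemLip (α : ℝ) (f : ℂ → ℂ) : Prop := IsDiscReg f ∧ LittleLip α f

/-- The Dirichlet integral `D(f) = ∫_𝔻 |f'|² dA` with respect to the normalized
area measure `dA = (1/π)·(Lebesgue)`. -/
def dirInt (f : ℂ → ℂ) : ℝ := (1 / Real.pi) * ∫ z in uDisc, ‖deriv f z‖ ^ 2

/-- Membership in the Dirichlet space `𝒟`. -/
def MemDir (f : ℂ → ℂ) : Prop :=
  DifferentiableOn ℂ f uDisc ∧ IntegrableOn (fun z => ‖deriv f z‖ ^ 2) uDisc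

/-- Sup norm over the unit disc. -/
def supNorm (f : ℂ → ℂ) : ℝ := sSup ((fun z => ‖f z‖) '' uDisc)

/-- The `lip_α` norm `‖f‖_α = ‖f‖_∞ + sup_{z∈𝔻} (1-|z|)^{1-α}|f'(z)|`. -/
def lipNorm (α : ℝ) (f : ℂ → ℂ) : ℝ :=
  supNorm f + sSup ((fun z => (1 - ‖z‖) ^ (1 - α) * ‖deriv f z‖) '' uDisc)

/-- The `𝒜_α` norm `‖f‖_{𝒜_α} = ‖f‖_α + D(f)^{1/2}`. -/
def ANorm (α : ℝ) (f : ℂ → ℂ) : ℝ := lipNorm α f + Real.sqrt (dirInt f)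

/-- Membership in `𝒜_α = 𝒟 ∩ lip_α`. -/
def MemA (α : ℝ) (f : ℂ → ℂ) : Prop := MemDir f ∧ MemLip α f

/-- A closed ideal of the Banach algebra `𝒜_α`, encoded as a set of functions `ℂ → ℂ`
(two functions agreeing on the closed disc represent the same element of `𝒜_α`). -/
structure IsClosedIdeal (α : ℝ) (J : Set (ℂ → ℂ)) : Prop where
  mem_A : ∀ f ∈ J, MemA α f
  zero_mem : (0 : ℂ → ℂ) ∈ J
  add_mem : ∀ f ∈ J, ∀ g ∈ J, f + g ∈ J
  smul_mem : ∀ (c : ℂ), ∀ f ∈ J, c • f ∈ J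
  mul_mem : ∀ f ∈ J, ∀ g : ℂ → ℂ, MemA α g → f * g ∈ J
  ext_mem : ∀ f ∈ J, ∀ g : ℂ → ℂ, MemA α g →
    (∀ z ∈ Metric.closedBall (0 : ℂ) 1, g z = f z) → g ∈ J
  closed : ∀ (F : ℕ → ℂ → ℂ) (f : ℂ → ℂ), (∀ n, F n ∈ J) → MemA α f →
    Tendsto (fun n => ANorm α (F n - f)) atTop (nhds 0) → f ∈ J

/-- The boundary zero set `E_f = {ξ ∈ 𝕋 : f ξ = 0}`. -/
def bZeros (f : ℂ → ℂ) : Set ℂ := {ξ | ξ ∈ uCircle ∧ f ξ = 0}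

/-- An inner function: bounded analytic on `𝔻` with radial limits of modulus `1`
at almost every point of `𝕋`. -/
def IsInner (U : ℂ → ℂ) : Prop :=
  DifferentiableOn ℂ U uDisc ∧ (∀ z ∈ uDisc, ‖U z‖ ≤ 1) ∧
    ∀ᵐ θ : ℝ, Tendsto (fun r : ℝ => ‖U ((r : ℂ) * Complex.exp ((θ : ℂ) * Complex.I))‖)
      (nhdsWithin 1 (Set.Iio 1)) (nhds 1)

/-- The Schwarz/Herglotz kernel `(e^{iθ}+z)/(e^{iθ}-z)`. -/
def circleKernel (z : ℂ) (θ : ℝ) : ℂ :=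
  (Complex.exp ((θ : ℂ) * Complex.I) + z) / (Complex.exp ((θ : ℂ) * Complex.I) - z)

/-- `f` is an outer function. -/
def IsOuter (f : ℂ → ℂ) : Prop :=
  IsDiscReg f ∧ (∃ z ∈ uDisc, f z ≠ 0) ∧
    ∀ z ∈ uDisc, f z = Complex.exp ((1 / (2 * (Real.pi : ℂ))) *
      ∫ θ in (0:ℝ)..(2 * Real.pi),
        circleKernel z θ * (Real.log ‖f (Complex.exp ((θ : ℂ) * Complex.I))‖ : ℂ))

/-- The outer power `f^ρ`, the outer function with boundary modulus `|f|^ρ`. -/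
def outerPow (f : ℂ → ℂ) (ρ : ℝ) (z : ℂ) : ℂ :=
  Complex.exp (((ρ : ℂ) / (2 * (Real.pi : ℂ))) *
    ∫ θ in (0:ℝ)..(2 * Real.pi),
      circleKernel z θ * (Real.log ‖f (Complex.exp ((θ : ℂ) * Complex.I))‖ : ℂ))

/-- The set of angles in `[0, 2π)` whose corresponding point of the circle lies in `A`. -/
def angSet (A : Set ℂ) : Set ℝ :=
  {θ | θ ∈ Set.Ico (0 : ℝ) (2 * Real.pi) ∧ Complex.exp ((θ : ℂ) * Complex.I) ∈ A}

/-- The outer factor `f_Γ` associated with a boundary set `Γ ⊆ 𝕋`. -/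
def outerPart (f : ℂ → ℂ) (Γ : Set ℂ) (z : ℂ) : ℂ :=
  Complex.exp ((1 / (2 * (Real.pi : ℂ))) *
    ∫ θ in angSet Γ, circleKernel z θ * (Real.log ‖f (Complex.exp ((θ : ℂ) * Complex.I))‖ : ℂ))

/-- `𝕋 \ E_f`, the set of boundary points where `f` does not vanish. -/
def offZeros (f : ℂ → ℂ) : Set ℂ := {ξ | ξ ∈ uCircle ∧ f ξ ≠ 0}

/-- `γ` is a component arc (connected component) of `𝕋 \ E_f`. -/
def IsCompArc (f : ℂ → ℂ) (γ : Set ℂ) : Prop :=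
  ∃ x ∈ offZeros f, γ = connectedComponentIn (offZeros f) x

/-- `Γ` is a union of component arcs of `𝕋 \ E_f`. -/
def IsArcUnion (f : ℂ → ℂ) (Γ : Set ℂ) : Prop :=
  Γ ⊆ offZeros f ∧ ∀ x ∈ Γ, connectedComponentIn (offZeros f) x ⊆ Γ

/-- The sector `Δ_γ = {z ∈ 𝔻 : z/|z| ∈ γ}`. -/
def discSector (γ : Set ℂ) : Set ℂ := {z | z ∈ uDisc ∧ ((‖z‖ : ℂ))⁻¹ * z ∈ γ}

/-- Lower integral of `g` over `S` with respect to the normalized area measure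
`dA = (1/π)·(Lebesgue)`. -/
def nlint (S : Set ℂ) (g : ℂ → ℝ) : ℝ≥0∞ :=
  ENNReal.ofReal (1 / Real.pi) * ∫⁻ z in S, ENNReal.ofReal (g z)

/-- `d(z) = min(|z-a|, |z-b|)`, distance to the endpoints of the arc `γ = (a,b)`. -/
def dd (a b z : ℂ) : ℝ := min ‖z - a‖ ‖z - b‖

/-- `Λ_γ`: equals `Γ` if `γ ⊄ Γ`, and `𝕋 \ Γ` if `γ ⊆ Γ`. -/
def lamSet (Γ γ : Set ℂ) : Set ℂ := if γ ⊆ Γ then uCircle \ Γ else Γ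

/-- The function `a_γ(z) = (1/2π)∫_{Λ_γ} (−log|f(e^{iθ})|)/|e^{iθ}−z|² dθ`. -/
def aFun (f : ℂ → ℂ) (Γ γ : Set ℂ) (z : ℂ) : ℝ :=
  (1 / (2 * Real.pi)) * ∫ θ in angSet (lamSet Γ γ),
    (-(Real.log ‖f (Complex.exp ((θ : ℂ) * Complex.I))‖)) /
      ‖Complex.exp ((θ : ℂ) * Complex.I) - z‖ ^ 2

/-- `Δ_γ¹ = {z ∈ Δ_γ : d(z) < 2(1−|z|)}`. -/
def sector1 (a b : ℂ) (γ : Set ℂ) : Set ℂ :=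
  {z | z ∈ discSector γ ∧ dd a b z < 2 * (1 - ‖z‖)}

/-- `Δ_γ² = {z ∈ Δ_γ : d(z) ≥ 2(1−|z|)}`. -/
def sector2 (a b : ℂ) (γ : Set ℂ) : Set ℂ :=
  {z | z ∈ discSector γ ∧ 2 * (1 - ‖z‖) ≤ dd a b z}

/-- `Δ_γ²¹ = {z ∈ Δ_γ² : a_γ(z) ≤ 8|log d(z)|/d(z)}`. -/
def sector21 (f : ℂ → ℂ) (Γ γ : Set ℂ) (a b : ℂ) : Set ℂ :=
  {z | z ∈ sector2 a b γ ∧ aFun f Γ γ z ≤ 8 * |Real.log (dd a b z)| / dd a b z}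

/-- `Δ_γ²² = {z ∈ Δ_γ² : 8|log d(z)|/d(z) < a_γ(z) < 8|log d(z)|/(1−|z|)}`. -/
def sector22 (f : ℂ → ℂ) (Γ γ : Set ℂ) (a b : ℂ) : Set ℂ :=
  {z | z ∈ sector2 a b γ ∧ 8 * |Real.log (dd a b z)| / dd a b z < aFun f Γ γ z ∧
    aFun f Γ γ z < 8 * |Real.log (dd a b z)| / (1 - ‖z‖)}

/-- `Δ_γ²³ = {z ∈ Δ_γ² : a_γ(z) ≥ 8|log d(z)|/(1−|z|)}`. -/
def sector23 (f : ℂ → ℂ) (Γ γ : Set ℂ) (a b : ℂ) : Set ℂ :=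
  {z | z ∈ sector2 a b γ ∧ 8 * |Real.log (dd a b z)| / (1 - ‖z‖) ≤ aFun f Γ γ z}

/-- `μ_z = 1 − 8|log d(z)|/a_γ(z)`. -/
def muOf (f : ℂ → ℂ) (Γ γ : Set ℂ) (a b : ℂ) (z : ℂ) : ℝ :=
  1 - 8 * |Real.log (dd a b z)| / aFun f Γ γ z

/-- The tail union `Γ_m = ⋃_{p ≥ m} γ_p`. -/
def tailUnion (γ : ℕ → Set ℂ) (m : ℕ) : Set ℂ := ⋃ p ∈ Set.Ici m, γ p

end

/-- The radial part of the Hardy–Littlewood estimate. -/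
lemma norm_sub_radial_le {h : ℂ → ℂ} {α ε B : ℝ} (hh : DifferentiableOn ℂ h uDisc)
    (hα0 : 0 < α) (hα1 : α ≤ 1) (hε : 0 ≤ ε)
    (hd : ∀ z ∈ uDisc, ‖deriv h z‖ ≤ ε * (1 - ‖z‖) ^ (α - 1) + B)
    {z : ℂ} (hz : z ∈ uDisc) {δ : ℝ} (hδ0 : 0 ≤ δ) (hδ1 : δ ≤ 1) :
    ‖h z - h ((1 - δ : ℝ) * z)‖ ≤ ε * (δ ^ α / α) + B * δ := by
  have hz1 : ‖z‖ < 1 := by simpa [uDisc] using hz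
  have hopen : IsOpen uDisc := Metric.isOpen_ball
  have hmem : ∀ t ∈ Icc (0 : ℝ) δ, ((1 - t : ℝ) : ℂ) * z ∈ uDisc := by
    intro t ht
    have : ‖((1 - t : ℝ) : ℂ) * z‖ = (1 - t) * ‖z‖ := by
      rw [norm_mul, Complex.norm_real, Real.norm_eq_abs, abs_of_nonneg (by linarith [ht.2])]
    simp only [uDisc, mem_ball_zero_iff, this]
    nlinarith [ht.1, ht.2, norm_nonneg z]
  have hderiv : ∀ t ∈ Icc (0 : ℝ) δ, HasDerivAt (fun t : ℝ => h (((1 - t : ℝ) : ℂ) * z))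
      (deriv h (((1 - t : ℝ) : ℂ) * z) * (-z)) t := by
    intro t ht
    have h1 : HasDerivAt h (deriv h (((1 - t : ℝ) : ℂ) * z)) (((1 - t : ℝ) : ℂ) * z) :=
      (hh.differentiableAt (hopen.mem_nhds (hmem t ht))).hasDerivAt
    have h2 : HasDerivAt (fun t : ℝ => (((1 - t : ℝ) : ℂ) * z)) (-z) t := by
      have : HasDerivAt (fun t : ℝ => (((1 - t : ℝ) : ℂ))) (-1) t := by
        have := ((hasDerivAt_id t).const_sub 1).ofReal_comp
        simpa using this
      simpa using this.mul_const z
    exact h1.comp t h2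
  have hcont : ContinuousOn (fun t : ℝ => deriv h (((1 - t : ℝ) : ℂ) * z) * (-z)) (Icc 0 δ) := by
    have : ContinuousOn (deriv h) uDisc := (hh.deriv hopen).continuousOn
    refine ContinuousOn.mul (this.comp (by fun_prop) hmem) continuousOn_const
  have hint : IntervalIntegrable (fun t : ℝ => deriv h (((1 - t : ℝ) : ℂ) * z) * (-z))
      volume 0 δ := by
    apply ContinuousOn.intervalIntegrable
    rwa [uIcc_of_le hδ0]
  have hftc := intervalIntegral.integral_eq_sub_of_hasDerivAt (a := 0) (b := δ)
    (fun t ht => hderiv t (by rwa [uIcc_of_le hδ0] at ht)) hint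
  have hr : IntervalIntegrable (fun t : ℝ => t ^ (α - 1)) volume 0 δ :=
    intervalIntegral.intervalIntegrable_rpow' (by linarith)
  have key : ‖∫ t in (0 : ℝ)..δ, deriv h (((1 - t : ℝ) : ℂ) * z) * (-z)‖ ≤
      ∫ t in (0 : ℝ)..δ, (ε * t ^ (α - 1) + B) := by
    apply intervalIntegral.norm_integral_le_of_norm_le hδ0
    · refine Filter.Eventually.of_forall fun t ht => ?_
      have htm := hmem t ⟨ht.1.le, ht.2⟩
      have h1 := hd _ htm
      have hn : ‖((1 - t : ℝ) : ℂ) * z‖ = (1 - t) * ‖z‖ := by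
        rw [norm_mul, Complex.norm_real, Real.norm_eq_abs, abs_of_nonneg (by linarith [ht.2])]
      have h2 : t ≤ 1 - ‖((1 - t : ℝ) : ℂ) * z‖ := by
        rw [hn]; nlinarith [ht.1, ht.2, norm_nonneg z]
      have h3 : (1 - ‖((1 - t : ℝ) : ℂ) * z‖) ^ (α - 1) ≤ t ^ (α - 1) :=
        Real.rpow_le_rpow_of_nonpos ht.1 h2 (by linarith)
      rw [norm_mul, norm_neg]
      calc _ ≤ ‖deriv h (((1 - t : ℝ) : ℂ) * z)‖ * 1 := by gcongr
        _ ≤ _ := by rw [mul_one]; exact h1.trans (by gcongr)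
    · exact (hr.const_mul ε).add intervalIntegrable_const
  rw [hftc] at key
  have e2 : ∫ t in (0 : ℝ)..δ, (ε * t ^ (α - 1) + B) = ε * (δ ^ α / α) + B * δ := by
    rw [intervalIntegral.integral_add (hr.const_mul ε) intervalIntegrable_const,
      intervalIntegral.integral_const_mul, integral_rpow (Or.inl (by linarith))]
    simp [Real.zero_rpow hα0.ne', mul_comm]
  rw [e2] at key
  rw [← norm_neg]
  simpa using key

/-- The Hardy–Littlewood estimate: a growth bound on the derivative gives a modulus of
continuity. -/
lemma norm_sub_le_of_deriv_growth {h : ℂ → ℂ} {α ε B : ℝ} (hh : DifferentiableOn ℂ h uDisc)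
    (hα0 : 0 < α) (hα1 : α ≤ 1) (hε : 0 ≤ ε) (hB : 0 ≤ B)
    (hd : ∀ z ∈ uDisc, ‖deriv h z‖ ≤ ε * (1 - ‖z‖) ^ (α - 1) + B)
    {z w : ℂ} (hz : z ∈ uDisc) (hw : w ∈ uDisc) :
    ‖h z - h w‖ ≤ ε * (2 / α + 1) * ‖z - w‖ ^ α + 3 * B * ‖z - w‖ := by
  set D := ‖z - w‖ with hD
  have hD0 : 0 ≤ D := norm_nonneg _
  set δ := min D 1 with hδ
  have hδ0 : 0 ≤ δ := le_min hD0 zero_le_one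
  have hδ1 : δ ≤ 1 := min_le_right _ _
  have hδD : δ ≤ D := min_le_left _ _
  have r1 := norm_sub_radial_le hh hα0 hα1 hε hd hz hδ0 hδ1
  have r2 := norm_sub_radial_le hh hα0 hα1 hε hd hw hδ0 hδ1
  have hpow : δ ^ α ≤ D ^ α := Real.rpow_le_rpow hδ0 hδD hα0.le
  have mid : ‖h ((1 - δ : ℝ) * z) - h ((1 - δ : ℝ) * w)‖ ≤ ε * D ^ α + B * D := by
    have hDa : 0 ≤ D ^ α := Real.rpow_nonneg hD0 _
    rcases hδ1.eq_or_lt with h1 | h1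
    · rw [h1]; simp only [sub_self, ofReal_zero, zero_mul, norm_zero]; positivity
    rcases hδ0.eq_or_lt with h0 | h0
    · have : D = 0 := by
        rcases min_choice D 1 with hh | hh
        · rw [← hh, ← hδ, ← h0]
        · rw [← hδ] at hh; linarith
      have : z = w := by rw [hD, norm_eq_zero, sub_eq_zero] at this; exact this
      rw [this]; simp only [sub_self, norm_zero]; positivity
    have hδe : δ = D := by
      rcases min_choice D 1 with hh | hh
      · exact hh
      · rw [← hδ] at hh; linarith
    have hz1 : ‖z‖ < 1 := by simpa [uDisc] using hz
    have hw1 : ‖w‖ < 1 := by simpa [uDisc] using hw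
    have hsub : closedBall (0 : ℂ) (1 - δ) ⊆ uDisc :=
      closedBall_subset_ball (by linarith)
    have hn : ∀ x : ℂ, ‖x‖ < 1 → ((1 - δ : ℝ) : ℂ) * x ∈ closedBall (0 : ℂ) (1 - δ) := by
      intro x hx
      rw [mem_closedBall_zero_iff, norm_mul, Complex.norm_real, Real.norm_eq_abs,
        abs_of_nonneg (by linarith)]
      nlinarith [norm_nonneg x]
    have := (convex_closedBall (0 : ℂ) (1 - δ)).norm_image_sub_le_of_norm_deriv_le
      (f := h) (C := ε * δ ^ (α - 1) + B)
      (fun x hx => hh.differentiableAt (Metric.isOpen_ball.mem_nhds (hsub hx)))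
      (fun x hx => by
        refine (hd x (hsub hx)).trans ?_
        rw [mem_closedBall_zero_iff] at hx
        have : (1 - ‖x‖) ^ (α - 1) ≤ δ ^ (α - 1) :=
          Real.rpow_le_rpow_of_nonpos h0 (by linarith) (by linarith)
        gcongr) (hn w hw1) (hn z hz1)
    refine this.trans ?_
    rw [← mul_sub, norm_mul, Complex.norm_real, Real.norm_eq_abs, abs_of_nonneg (by linarith),
      ← hD, hδe]
    have hDp : 0 < D := hδe ▸ h0
    have e1 : D ^ α = D ^ (α - 1) * D := by
      rw [← Real.rpow_add_one hDp.ne']; ring_nf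
    have : 0 ≤ D ^ (α - 1) := Real.rpow_nonneg hD0 _
    rw [e1]
    have : (ε * D ^ (α - 1) + B) * ((1 - D) * D) ≤ (ε * D ^ (α - 1) + B) * D := by
      gcongr; nlinarith
    linarith
  have tri : ‖h z - h w‖ ≤ ‖h z - h ((1 - δ : ℝ) * z)‖ +
      ‖h ((1 - δ : ℝ) * z) - h ((1 - δ : ℝ) * w)‖ + ‖h w - h ((1 - δ : ℝ) * w)‖ := by
    rw [norm_sub_rev (h w)]
    have := norm_add₃_le (a := h z - h ((1 - δ : ℝ) * z))
      (b := h ((1 - δ : ℝ) * z) - h ((1 - δ : ℝ) * w)) (c := h ((1 - δ : ℝ) * w) - h w)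
    simpa using this
  have e1 : ε * (δ ^ α / α) ≤ ε * (D ^ α / α) := by gcongr
  have e2 : B * δ ≤ B * D := by gcongr
  calc _ ≤ (ε * (D ^ α / α) + B * D) + (ε * D ^ α + B * D) + (ε * (D ^ α / α) + B * D) := by
        linarith
    _ = _ := by ring

/-- The unit disc is dense in the closed unit ball. -/
lemma closure_uDisc : closure uDisc = closedBall (0 : ℂ) 1 :=
  closure_ball _ one_ne_zero

/-- The Hardy–Littlewood estimate on the closed disc. -/
lemma norm_sub_le_of_deriv_growth_closed {h : ℂ → ℂ} {α ε B : ℝ} (hh : IsDiscReg h)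
    (hα0 : 0 < α) (hα1 : α ≤ 1) (hε : 0 ≤ ε) (hB : 0 ≤ B)
    (hd : ∀ z ∈ uDisc, ‖deriv h z‖ ≤ ε * (1 - ‖z‖) ^ (α - 1) + B)
    {z w : ℂ} (hz : z ∈ closedBall (0 : ℂ) 1) (hw : w ∈ closedBall (0 : ℂ) 1) :
    ‖h z - h w‖ ≤ ε * (2 / α + 1) * ‖z - w‖ ^ α + 3 * B * ‖z - w‖ := by
  have hcl : (z, w) ∈ closure (uDisc ×ˢ uDisc) := by
    rw [closure_prod_eq, closure_uDisc]; exact ⟨hz, hw⟩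
  have hcont : ContinuousOn (fun p : ℂ × ℂ =>
      ε * (2 / α + 1) * ‖p.1 - p.2‖ ^ α + 3 * B * ‖p.1 - p.2‖ - ‖h p.1 - h p.2‖)
      (closedBall (0 : ℂ) 1 ×ˢ closedBall (0 : ℂ) 1) := by
    have h1 : ContinuousOn (fun p : ℂ × ℂ => h p.1)
      (closedBall (0 : ℂ) 1 ×ˢ closedBall (0 : ℂ) 1) :=
      hh.2.comp continuousOn_fst (fun p hp => hp.1)
    have h2 : ContinuousOn (fun p : ℂ × ℂ => h p.2)
      (closedBall (0 : ℂ) 1 ×ˢ closedBall (0 : ℂ) 1) :=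
      hh.2.comp continuousOn_snd (fun p hp => hp.2)
    have h3 : Continuous (fun p : ℂ × ℂ =>
        ε * (2 / α + 1) * ‖p.1 - p.2‖ ^ α + 3 * B * ‖p.1 - p.2‖) := by
      have : Continuous (fun p : ℂ × ℂ => ‖p.1 - p.2‖ ^ α) :=
        (continuous_fst.sub continuous_snd).norm.rpow_const (fun _ => Or.inr hα0.le)
      fun_prop
    exact h3.continuousOn.sub (h1.sub h2).norm
  have hsub : uDisc ⊆ closedBall (0 : ℂ) 1 := ball_subset_closedBall
  have hcw := (hcont (z, w) ⟨hz, hw⟩).mono (prod_mono hsub hsub)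
  have hmaps : MapsTo (fun p : ℂ × ℂ =>
      ε * (2 / α + 1) * ‖p.1 - p.2‖ ^ α + 3 * B * ‖p.1 - p.2‖ - ‖h p.1 - h p.2‖)
      (uDisc ×ˢ uDisc) (Ici 0) := fun p hp =>
    sub_nonneg.2 (norm_sub_le_of_deriv_growth hh.1 hα0 hα1 hε hB hd hp.1 hp.2)
  have := hcw.mem_closure hcl hmaps
  rw [isClosed_Ici.closure_eq] at this
  exact sub_nonneg.1 this

/-- An analytic function on the disc whose derivative is `O((1-|z|)^{α-1})` with a little-o bound
extends to the closed disc as a member of `lip_α`. -/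
lemma exists_memLip_extension {h : ℂ → ℂ} {α : ℝ} (hh : DifferentiableOn ℂ h uDisc)
    (hα0 : 0 < α) (hα1 : α ≤ 1 / 2)
    (hd : ∀ ε > 0, ∃ B, 0 ≤ B ∧ ∀ z ∈ uDisc, ‖deriv h z‖ ≤ ε * (1 - ‖z‖) ^ (α - 1) + B) :
    ∃ g : ℂ → ℂ, (∀ z ∈ uDisc, g z = h z) ∧ MemLip α g := by
  have hlim : ∀ x ∈ closedBall (0 : ℂ) 1, ∃ y, Tendsto h (nhdsWithin x uDisc) (nhds y) := by
    intro x hx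
    rw [← closure_uDisc] at hx
    have hne : (nhdsWithin x uDisc).NeBot := mem_closure_iff_nhdsWithin_neBot.1 hx
    have hc : Cauchy (map h (nhdsWithin x uDisc)) := by
      obtain ⟨B, hB, hb⟩ := hd 1 one_pos
      rw [Metric.cauchy_iff]
      refine ⟨inferInstance, fun e he => ?_⟩
      have ht : Tendsto (fun r : ℝ => 1 * (2 / α + 1) * r ^ α + 3 * B * r) (nhds 0) (nhds 0) := by
        have : ContinuousAt (fun r : ℝ => 1 * (2 / α + 1) * r ^ α + 3 * B * r) 0 := by
          have : ContinuousAt (fun r : ℝ => r ^ α) 0 :=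
            Real.continuousAt_rpow_const 0 α (Or.inr hα0.le)
          fun_prop
        simpa [ContinuousAt, Real.zero_rpow hα0.ne'] using this
      obtain ⟨δ, hδ, hδ'⟩ := Metric.eventually_nhds_iff.1 (ht.eventually (gt_mem_nhds he))
      refine ⟨h '' (uDisc ∩ ball x (δ / 2)), ?_, ?_⟩
      · apply image_mem_map
        exact inter_mem self_mem_nhdsWithin (mem_nhdsWithin_of_mem_nhds (ball_mem_nhds _ (by linarith)))
      · rintro _ ⟨a, ⟨ha, ha'⟩, rfl⟩ _ ⟨b, ⟨hb', hb''⟩, rfl⟩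
        rw [dist_eq_norm]
        refine (norm_sub_le_of_deriv_growth hh hα0 (by linarith) zero_le_one hB hb ha hb').trans_lt ?_
        apply hδ'
        rw [dist_zero_right, norm_norm, ← dist_eq_norm]
        have := dist_triangle_right a b x
        rw [mem_ball] at ha' hb''
        linarith
    exact (CompleteSpace.complete hc)
  have hgc : ContinuousOn (extendFrom uDisc h) (closedBall 0 1) :=
    continuousOn_extendFrom (by rw [closure_uDisc]) hlim
  have heq : ∀ z ∈ uDisc, extendFrom uDisc h z = h z := fun z hz =>
    extendFrom_eq (subset_closure hz) (hh.continuousOn z hz)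
  have hreg : IsDiscReg (extendFrom uDisc h) := ⟨hh.congr heq, hgc⟩
  have hderiv : ∀ z ∈ uDisc, deriv (extendFrom uDisc h) z = deriv h z := fun z hz =>
    Filter.EventuallyEq.deriv_eq (Filter.eventuallyEq_of_mem (Metric.isOpen_ball.mem_nhds hz) heq)
  refine ⟨extendFrom uDisc h, heq, hreg, ?_⟩
  intro ε hε
  obtain ⟨B, hB, hb⟩ := hd (ε / (2 * (2 / α + 1))) (by positivity)
  have hα2 : 0 < 1 - α := by linarith
  refine ⟨(ε / (2 * (3 * B + 1))) ^ (1 / (1 - α)), by positivity, fun z hz w hw hzw => ?_⟩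
  refine (norm_sub_le_of_deriv_growth_closed hreg hα0 (by linarith) (by positivity) hB
    (fun z hz => hderiv z hz ▸ hb z hz) hz hw).trans ?_
  have h1 : ε / (2 * (2 / α + 1)) * (2 / α + 1) = ε / 2 := by
    have : 2 / α + 1 ≠ 0 := by positivity
    field_simp
  rw [h1]
  rcases (norm_nonneg (z - w)).eq_or_lt with h0 | h0
  · rw [← h0]; simp [Real.zero_rpow hα0.ne']
  have h2 : ‖z - w‖ = ‖z - w‖ ^ α * ‖z - w‖ ^ (1 - α) := by
    rw [← Real.rpow_add h0]; simp
  have h3 : ‖z - w‖ ^ (1 - α) ≤ ε / (2 * (3 * B + 1)) := by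
    have := Real.rpow_le_rpow h0.le hzw.le hα2.le
    rwa [← Real.rpow_mul (by positivity), one_div, inv_mul_cancel₀ hα2.ne', Real.rpow_one] at this
  have h4 : 3 * B * ‖z - w‖ ≤ ε / 2 * ‖z - w‖ ^ α := by
    have h5 : 0 ≤ ‖z - w‖ ^ α := by positivity
    calc 3 * B * ‖z - w‖ = 3 * B * ‖z - w‖ ^ (1 - α) * ‖z - w‖ ^ α := by
          conv_lhs => rw [h2]
          ring
      _ ≤ (3 * B * (ε / (2 * (3 * B + 1)))) * ‖z - w‖ ^ α := by gcongr
      _ ≤ _ := by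
          gcongr
          rw [mul_div_assoc', div_le_div_iff₀ (by positivity) (by positivity)]
          nlinarith
  linarith

/-- Cauchy estimate: functions in `lip_α` satisfy `|h'| = o((1-|z|)^{α-1})`. -/
lemma deriv_growth_of_memLip {h : ℂ → ℂ} {α : ℝ} (hh : MemLip α h) (hα0 : 0 < α)
    {ε : ℝ} (hε : 0 < ε) :
    ∃ B, 0 ≤ B ∧ ∀ z ∈ uDisc, ‖deriv h z‖ ≤ ε * (1 - ‖z‖) ^ (α - 1) + B := by
  obtain ⟨δ, hδ, hl⟩ := hh.2 (ε / 2) (by positivity)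
  refine ⟨ε / 2 * (δ / 2) ^ (α - 1), by positivity, fun z hz => ?_⟩
  have hz1 : ‖z‖ < 1 := by simpa [uDisc] using hz
  have hs : 0 < 1 - ‖z‖ := by linarith
  set r := min ((1 - ‖z‖) / 2) (δ / 2) with hr
  have hr0 : 0 < r := lt_min (by positivity) (by positivity)
  have hrs : r ≤ (1 - ‖z‖) / 2 := min_le_left _ _
  have hrδ : r ≤ δ / 2 := min_le_right _ _
  have hsub : closedBall z r ⊆ uDisc := by
    intro w hw
    rw [mem_closedBall, dist_eq_norm] at hw
    have := norm_le_norm_add_norm_sub' w z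
    simp only [uDisc, mem_ball_zero_iff]
    linarith
  have hdiff : DiffContOnCl ℂ (fun w => h w - h z) (ball z r) := by
    have : DifferentiableOn ℂ (fun w => h w - h z) (closedBall z r) :=
      (hh.1.1.mono hsub).sub_const _
    rw [← closure_ball z hr0.ne'] at this
    exact this.diffContOnCl
  have hc := Complex.norm_deriv_le_of_forall_mem_sphere_norm_le (C := ε / 2 * r ^ α) hr0 hdiff
    (fun w hw => by
      have hwz : ‖w - z‖ = r := by rwa [mem_sphere, dist_eq_norm] at hw
      rw [← hwz]
      exact hl w (ball_subset_closedBall (hsub (sphere_subset_closedBall hw))) z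
        (ball_subset_closedBall hz) (by linarith))
  rw [deriv_sub_const, mul_div_assoc, ← Real.rpow_sub_one hr0.ne'] at hc
  have p1 : 0 ≤ (1 - ‖z‖) ^ (α - 1) := by positivity
  have p2 : 0 ≤ (δ / 2) ^ (α - 1) := by positivity
  rcases min_choice ((1 - ‖z‖) / 2) (δ / 2) with h1 | h1
  · rw [← hr] at h1
    have : ((1 - ‖z‖) / 2) ^ (α - 1) ≤ 2 * (1 - ‖z‖) ^ (α - 1) := by
      rw [Real.div_rpow hs.le (by norm_num), div_le_iff₀ (by positivity)]
      have : (1 : ℝ) ≤ 2 * 2 ^ (α - 1) := by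
        have : (2 : ℝ) * 2 ^ (α - 1) = 2 ^ α := by
          rw [Real.rpow_sub_one (by norm_num)]; ring
        rw [this]
        exact Real.one_le_rpow (by norm_num) hα0.le
      nlinarith
    rw [h1] at hc
    nlinarith
  · rw [← hr] at h1
    rw [h1] at hc
    nlinarith

/-- The components of the bound `‖f‖_{𝒜_α} ≤ 1`. -/
lemma bounds_of_ANorm_le_one {f : ℂ → ℂ} {α : ℝ} (hα0 : 0 < α) (hα1 : α ≤ 1) (hf : MemA α f)
    (hn : ANorm α f ≤ 1) :
    (∀ z ∈ closedBall (0 : ℂ) 1, ‖f z‖ ≤ 1) ∧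
    (∀ z ∈ uDisc, ‖deriv f z‖ ≤ 1 * (1 - ‖z‖) ^ (α - 1)) ∧
    ∫⁻ z in uDisc, ‖deriv f z‖ₑ ^ 2 ≤ ENNReal.ofReal Real.pi := by
  have hpos : ∀ z ∈ uDisc, 0 < 1 - ‖z‖ := fun z hz => by
    have : ‖z‖ < 1 := by simpa [uDisc] using hz
    linarith
  have hb1 : BddAbove ((fun z => ‖f z‖) '' uDisc) :=
    ((isCompact_closedBall (0 : ℂ) 1).bddAbove_image hf.2.1.2.norm).mono
      (image_mono ball_subset_closedBall)
  have hb2 : BddAbove ((fun z => (1 - ‖z‖) ^ (1 - α) * ‖deriv f z‖) '' uDisc) := by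
    obtain ⟨B, hB, hb⟩ := deriv_growth_of_memLip hf.2 hα0 one_pos
    refine ⟨1 + B, ?_⟩
    rintro _ ⟨z, hz, rfl⟩
    have hs := hpos z hz
    have h1 : (1 - ‖z‖) ^ (1 - α) ≤ 1 :=
      Real.rpow_le_one hs.le (by linarith [norm_nonneg z]) (by linarith)
    have h2 : (1 - ‖z‖) ^ (1 - α) * (1 - ‖z‖) ^ (α - 1) = 1 := by
      rw [← Real.rpow_add hs]; simp
    have h3 : 0 ≤ (1 - ‖z‖) ^ (1 - α) := by positivity
    calc (1 - ‖z‖) ^ (1 - α) * ‖deriv f z‖ ≤ (1 - ‖z‖) ^ (1 - α) * (1 * (1 - ‖z‖) ^ (α - 1) + B) := by gcongr; exact hb z hz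
      _ = 1 + (1 - ‖z‖) ^ (1 - α) * B := by rw [one_mul, mul_add, h2]
      _ ≤ _ := by nlinarith
  have n1 : 0 ≤ supNorm f := Real.sSup_nonneg (by rintro _ ⟨z, -, rfl⟩; positivity)
  have n2 : 0 ≤ sSup ((fun z => (1 - ‖z‖) ^ (1 - α) * ‖deriv f z‖) '' uDisc) :=
    Real.sSup_nonneg (by
      rintro _ ⟨z, hz, rfl⟩
      have := hpos z hz
      positivity)
  have n3 : 0 ≤ √(dirInt f) := Real.sqrt_nonneg _
  unfold ANorm lipNorm at hn
  refine ⟨?_, ?_, ?_⟩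
  · have hd : ∀ z ∈ uDisc, ‖f z‖ ≤ 1 := fun z hz =>
      (le_csSup hb1 (mem_image_of_mem (fun z => ‖f z‖) hz)).trans
        (show supNorm f ≤ 1 by linarith)
    intro z hz
    rw [← closure_uDisc] at hz
    have hcl : closure uDisc ⊆ closedBall (0 : ℂ) 1 := closure_uDisc.le
    have hc : ContinuousOn (fun z => ‖f z‖) (closure uDisc) := hf.2.1.2.norm.mono hcl
    have hmaps : MapsTo (fun z => ‖f z‖) uDisc (Iic 1) := hd
    have := ((hc z hz).mono subset_closure).mem_closure hz hmaps
    rwa [isClosed_Iic.closure_eq] at this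
  · intro z hz
    have hs := hpos z hz
    have h1 : (1 - ‖z‖) ^ (1 - α) * ‖deriv f z‖ ≤ 1 :=
      (le_csSup hb2 (mem_image_of_mem
        (fun z => (1 - ‖z‖) ^ (1 - α) * ‖deriv f z‖) hz)).trans (by linarith)
    have h2 : (1 - ‖z‖) ^ (α - 1) * (1 - ‖z‖) ^ (1 - α) = 1 := by
      rw [← Real.rpow_add hs]; simp
    calc ‖deriv f z‖ = (1 - ‖z‖) ^ (α - 1) * ((1 - ‖z‖) ^ (1 - α) * ‖deriv f z‖) := by
          rw [← mul_assoc, h2, one_mul]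
      _ ≤ (1 - ‖z‖) ^ (α - 1) * 1 := by gcongr
      _ = _ := by ring
  · have h1 : dirInt f ≤ 1 := by
      have : √(dirInt f) ≤ 1 := by linarith
      by_contra h
      push Not at h
      have := (Real.lt_sqrt zero_le_one).2 (by simpa using h)
      linarith
    have h2 : ∫ z in uDisc, ‖deriv f z‖ ^ 2 ≤ Real.pi := by
      unfold dirInt at h1
      rw [one_div, inv_mul_le_iff₀ Real.pi_pos] at h1
      linarith
    have h3 := ofReal_integral_eq_lintegral_ofReal hf.1.2
      (Filter.Eventually.of_forall fun z => by positivity)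
    have h4 : ∀ z, ENNReal.ofReal (‖deriv f z‖ ^ 2) = ‖deriv f z‖ₑ ^ 2 := fun z => by
      rw [ENNReal.ofReal_pow (norm_nonneg _), ofReal_norm]
    simp only [h4] at h3
    rw [← h3]
    exact ENNReal.ofReal_le_ofReal h2

/-- Bounds on the pieces of the norm give membership in the Dirichlet space and a norm bound. -/
lemma memDir_and_ANorm_le {g : ℂ → ℂ} {α K Q : ℝ} (hg : DifferentiableOn ℂ g uDisc)
    (hQ : 0 ≤ Q) (h1 : ∀ z ∈ uDisc, ‖g z‖ ≤ 1)
    (h2 : ∀ z ∈ uDisc, ‖deriv g z‖ ≤ K * (1 - ‖z‖) ^ (α - 1))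
    (h3 : ∫⁻ z in uDisc, ‖deriv g z‖ₑ ^ 2 ≤ ENNReal.ofReal Q) :
    MemDir g ∧ ANorm α g ≤ 1 + K + √Q := by
  have hne : uDisc.Nonempty := ⟨0, by simp [uDisc]⟩
  have h4 : ∀ z, ENNReal.ofReal (‖deriv g z‖ ^ 2) = ‖deriv g z‖ₑ ^ 2 := fun z => by
    rw [ENNReal.ofReal_pow (norm_nonneg _), ofReal_norm]
  have hmeas : Measurable (fun z => ‖deriv g z‖ ^ 2) := (measurable_deriv g).norm.pow_const 2
  have hint : IntegrableOn (fun z => ‖deriv g z‖ ^ 2) uDisc := by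
    refine ⟨hmeas.aestronglyMeasurable, ?_⟩
    rw [hasFiniteIntegral_iff_ofReal (Filter.Eventually.of_forall fun z => by positivity)]
    simp only [h4]
    exact h3.trans_lt ENNReal.ofReal_lt_top
  refine ⟨⟨hg, hint⟩, ?_⟩
  have e1 : supNorm g ≤ 1 := csSup_le (hne.image _) (by rintro _ ⟨z, hz, rfl⟩; exact h1 z hz)
  have e2 : sSup ((fun z => (1 - ‖z‖) ^ (1 - α) * ‖deriv g z‖) '' uDisc) ≤ K := by
    refine csSup_le (hne.image _) ?_
    rintro _ ⟨z, hz, rfl⟩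
    have hs : 0 < 1 - ‖z‖ := by
      have : ‖z‖ < 1 := by simpa [uDisc] using hz
      linarith
    have h5 : (1 - ‖z‖) ^ (1 - α) * (1 - ‖z‖) ^ (α - 1) = 1 := by
      rw [← Real.rpow_add hs]; simp
    calc (1 - ‖z‖) ^ (1 - α) * ‖deriv g z‖ ≤ (1 - ‖z‖) ^ (1 - α) * (K * (1 - ‖z‖) ^ (α - 1)) := by gcongr; exact h2 z hz
      _ = K * ((1 - ‖z‖) ^ (1 - α) * (1 - ‖z‖) ^ (α - 1)) := by ring
      _ = K := by rw [h5, mul_one]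
  have e3 : dirInt g ≤ Q := by
    have h5 := integral_eq_lintegral_of_nonneg_ae (μ := volume.restrict uDisc)
      (f := fun z => ‖deriv g z‖ ^ 2)
      (Filter.Eventually.of_forall fun z => by positivity) hmeas.aestronglyMeasurable
    simp only [h4] at h5
    have h6 : ∫ z in uDisc, ‖deriv g z‖ ^ 2 ≤ Q := by
      rw [h5]
      exact ENNReal.toReal_le_of_le_ofReal hQ h3
    have h7 : 0 ≤ ∫ z in uDisc, ‖deriv g z‖ ^ 2 := integral_nonneg fun z => by positivity
    unfold dirInt
    have : 1 / Real.pi ≤ 1 := by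
      rw [div_le_one Real.pi_pos]; linarith [Real.pi_gt_three]
    nlinarith [Real.pi_pos]
  unfold ANorm lipNorm
  have := Real.sqrt_le_sqrt e3
  linarith

/-- Boundary logarithm of `f` in the angular variable. -/
noncomputable def bdryLog (f : ℂ → ℂ) (t : ℝ) : ℝ :=
  Real.log ‖f (Complex.exp ((t : ℂ) * Complex.I))‖

/-- The integral `∫_S (-log|f(e^{it})|) / |e^{it}-z|² dt`. -/
noncomputable def logPotential (f : ℂ → ℂ) (S : Set ℝ) (z : ℂ) : ℝ :=
  ∫ t in S, (-bdryLog f t) / ‖Complex.exp ((t : ℂ) * Complex.I) - z‖ ^ 2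

/-- The Herglotz integral of `log|f|` over `S`. -/
noncomputable def herglotz (f : ℂ → ℂ) (S : Set ℝ) (z : ℂ) : ℂ :=
  ∫ t in S, circleKernel z t * (bdryLog f t : ℂ)

lemma norm_circle (t : ℝ) : ‖Complex.exp ((t : ℂ) * Complex.I)‖ = 1 :=
  Complex.norm_exp_ofReal_mul_I t

lemma one_sub_norm_le_norm_circle_sub (z : ℂ) (t : ℝ) :
    1 - ‖z‖ ≤ ‖Complex.exp ((t : ℂ) * Complex.I) - z‖ := by
  rw [← norm_circle t]; exact norm_sub_norm_le _ _

lemma circle_sub_ne_zero {z : ℂ} (hz : z ∈ uDisc) (t : ℝ) :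
    Complex.exp ((t : ℂ) * Complex.I) - z ≠ 0 := by
  have h1 : ‖z‖ < 1 := by simpa [uDisc] using hz
  have := one_sub_norm_le_norm_circle_sub z t
  intro h
  rw [h, norm_zero] at this
  linarith

lemma circle_mem_closedBall (t : ℝ) :
    Complex.exp ((t : ℂ) * Complex.I) ∈ closedBall (0 : ℂ) 1 := by
  rw [mem_closedBall_zero_iff, norm_circle]

lemma continuous_circle : Continuous (fun t : ℝ => Complex.exp ((t : ℂ) * Complex.I)) := by
  fun_prop

lemma continuous_comp_circle {f : ℂ → ℂ} (hf : ContinuousOn f (closedBall 0 1)) :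
    Continuous (fun t : ℝ => f (Complex.exp ((t : ℂ) * Complex.I))) :=
  hf.comp_continuous continuous_circle circle_mem_closedBall

lemma measurable_bdryLog {f : ℂ → ℂ} (hf : ContinuousOn f (closedBall 0 1)) :
    Measurable (bdryLog f) :=
  Real.measurable_log.comp (continuous_comp_circle hf).norm.measurable

lemma continuous_circleKernel {z : ℂ} (hz : z ∈ uDisc) : Continuous (circleKernel z) := by
  unfold circleKernel
  exact (continuous_circle.add continuous_const).div (continuous_circle.sub continuous_const)
    (circle_sub_ne_zero hz)

/-- The boundary logarithm of an outer function is integrable. -/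
lemma integrableOn_bdryLog {f : ℂ → ℂ} (hf : IsOuter f) :
    IntegrableOn (bdryLog f) (Ico 0 (2 * Real.pi)) := by
  by_contra hni
  have hni' : ¬ IntegrableOn (bdryLog f) (Ioc 0 (2 * Real.pi)) := by
    rwa [← integrableOn_Icc_iff_integrableOn_Ioc, integrableOn_Icc_iff_integrableOn_Ico]
  have h1 : ∀ z ∈ uDisc, f z = 1 := by
    intro z hz
    have hne : ∀ t : ℝ, Complex.exp ((t : ℂ) * Complex.I) + z ≠ 0 := by
      have : -z ∈ uDisc := by simpa [uDisc] using hz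
      intro t
      simpa using circle_sub_ne_zero this t
    have hk : Continuous (fun t => (circleKernel z t)⁻¹) := by
      have : Continuous (fun t : ℝ => (Complex.exp ((t : ℂ) * Complex.I) - z) /
          (Complex.exp ((t : ℂ) * Complex.I) + z)) :=
        (continuous_circle.sub continuous_const).div (continuous_circle.add continuous_const) hne
      simpa [circleKernel, inv_div] using this
    have hk0 : ∀ t, circleKernel z t ≠ 0 := fun t =>
      div_ne_zero (hne t) (circle_sub_ne_zero hz t)
    have hnik : ¬ IntegrableOn (fun t => circleKernel z t * (bdryLog f t : ℂ))
        (Ioc 0 (2 * Real.pi)) := by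
      intro h
      apply hni'
      obtain ⟨C, hC⟩ := (isCompact_Icc (a := (0 : ℝ)) (b := 2 * Real.pi)).exists_bound_of_continuousOn
        hk.continuousOn
      have h2 : IntegrableOn (fun t => (circleKernel z t)⁻¹ *
          (circleKernel z t * (bdryLog f t : ℂ))) (Ioc 0 (2 * Real.pi)) := by
        refine Integrable.bdd_mul (c := C) h hk.aestronglyMeasurable ?_
        refine (ae_restrict_iff' measurableSet_Ioc).2 (Filter.Eventually.of_forall fun t ht => ?_)
        exact hC t ⟨ht.1.le, ht.2⟩
      have h3 : IntegrableOn (fun t => (bdryLog f t : ℂ)) (Ioc 0 (2 * Real.pi)) := by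
        refine h2.congr (Filter.Eventually.of_forall fun t => ?_)
        simp only
        rw [inv_mul_cancel_left₀ (hk0 t)]
      exact h3.re
    rw [hf.2.2 z hz, intervalIntegral.integral_of_le Real.two_pi_pos.le]
    have h0 := integral_undef hnik
    unfold bdryLog at h0
    rw [h0]
    simp
  have h2 : ∀ z ∈ closedBall (0 : ℂ) 1, f z = 1 := by
    intro z hz
    have hz' := hz
    rw [← closure_uDisc] at hz'
    have hsub : uDisc ⊆ closedBall (0 : ℂ) 1 := ball_subset_closedBall
    have hmaps : MapsTo f uDisc {1} := h1
    have := ((hf.1.2 z hz).mono hsub).mem_closure hz' hmaps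
    simpa using this
  apply hni
  have : bdryLog f = fun _ => 0 := by
    ext t
    simp [bdryLog, h2 _ (circle_mem_closedBall t)]
  rw [this]
  exact integrableOn_zero

/-- Differentiation of the Herglotz integral. -/
lemma hasDerivAt_herglotz {f : ℂ → ℂ} {S : Set ℝ} (hS : IntegrableOn (bdryLog f) S)
    {z : ℂ} (hz : z ∈ uDisc) :
    HasDerivAt (herglotz f S) (∫ t in S, 2 * Complex.exp ((t : ℂ) * Complex.I) /
      (Complex.exp ((t : ℂ) * Complex.I) - z) ^ 2 * (bdryLog f t : ℂ)) z := by
  have hz1 : ‖z‖ < 1 := by simpa [uDisc] using hz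
  set r := (1 - ‖z‖) / 2 with hr
  have hr0 : 0 < r := by rw [hr]; linarith
  have hball : ∀ w ∈ ball z r, w ∈ uDisc ∧ r ≤ 1 - ‖w‖ := by
    intro w hw
    rw [mem_ball, dist_eq_norm] at hw
    have := norm_le_norm_add_norm_sub' w z
    have h2 : r ≤ 1 - ‖w‖ := by rw [hr] at hw ⊢; linarith
    refine ⟨?_, h2⟩
    simp only [uDisc, mem_ball_zero_iff]; linarith
  have hLc : IntegrableOn (fun t => (bdryLog f t : ℂ)) S := hS.ofReal
  have key := hasDerivAt_integral_of_dominated_loc_of_deriv_le (𝕜 := ℂ)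
    (μ := volume.restrict S) (s := ball z r) (x₀ := z)
    (F := fun w t => circleKernel w t * (bdryLog f t : ℂ))
    (F' := fun w t => 2 * Complex.exp ((t : ℂ) * Complex.I) /
      (Complex.exp ((t : ℂ) * Complex.I) - w) ^ 2 * (bdryLog f t : ℂ))
    (bound := fun t => 2 / r ^ 2 * ‖(bdryLog f t : ℂ)‖)
    (ball_mem_nhds z hr0) ?_ ?_ ?_ ?_ ?_ ?_
  · exact key.2
  · filter_upwards [ball_mem_nhds z hr0] with w hw
    exact (continuous_circleKernel (hball w hw).1).aestronglyMeasurable.mul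
      hLc.aestronglyMeasurable
  · refine Integrable.bdd_mul (c := 2 / (1 - ‖z‖)) hLc
      (continuous_circleKernel hz).aestronglyMeasurable (Filter.Eventually.of_forall fun t => ?_)
    unfold circleKernel
    rw [norm_div]
    have h1 := one_sub_norm_le_norm_circle_sub z t
    have h2 := norm_add_le (Complex.exp ((t : ℂ) * Complex.I)) z
    rw [norm_circle] at h2
    have h3 : 0 < 1 - ‖z‖ := by linarith
    gcongr
    linarith
  · have : Continuous (fun t : ℝ => 2 * Complex.exp ((t : ℂ) * Complex.I) /
      (Complex.exp ((t : ℂ) * Complex.I) - z) ^ 2) :=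
      (continuous_const.mul continuous_circle).div
        ((continuous_circle.sub continuous_const).pow 2)
        (fun t => pow_ne_zero 2 (circle_sub_ne_zero hz t))
    exact this.aestronglyMeasurable.mul hLc.aestronglyMeasurable
  · refine Filter.Eventually.of_forall fun t w hw => ?_
    rw [norm_mul, norm_div, norm_mul, norm_pow, norm_circle]
    have h1 := one_sub_norm_le_norm_circle_sub w t
    have h2 := (hball w hw).2
    simp only [Complex.norm_ofNat, mul_one]
    gcongr
    linarith
  · exact hLc.norm.const_mul _
  · refine Filter.Eventually.of_forall fun t w hw => ?_
    have hne := circle_sub_ne_zero (hball w hw).1 t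
    have h1 : HasDerivAt (fun w => Complex.exp ((t : ℂ) * Complex.I) + w) 1 w :=
      (hasDerivAt_id w).const_add _
    have h2 : HasDerivAt (fun w => Complex.exp ((t : ℂ) * Complex.I) - w) (-1) w :=
      (hasDerivAt_id w).const_sub _
    have h3 := (h1.div h2 hne).mul_const (bdryLog f t : ℂ)
    refine HasDerivAt.congr_deriv h3 ?_
    ring

lemma integrableOn_logPotential {f : ℂ → ℂ} {S : Set ℝ} (hS : IntegrableOn (bdryLog f) S)
    {z : ℂ} (hz : z ∈ uDisc) :
    IntegrableOn (fun t => (-bdryLog f t) / ‖Complex.exp ((t : ℂ) * Complex.I) - z‖ ^ 2) S := by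
  have hz1 : ‖z‖ < 1 := by simpa [uDisc] using hz
  have hc : Continuous (fun t : ℝ => (‖Complex.exp ((t : ℂ) * Complex.I) - z‖ ^ 2)⁻¹) :=
    ((continuous_circle.sub continuous_const).norm.pow 2).inv₀
      (fun t => pow_ne_zero 2 (norm_ne_zero_iff.2 (circle_sub_ne_zero hz t)))
  have := Integrable.bdd_mul (c := ((1 - ‖z‖) ^ 2)⁻¹) hS.neg
      hc.aestronglyMeasurable (Filter.Eventually.of_forall fun t => by
        rw [Real.norm_of_nonneg (by positivity)]
        have h3 : 0 < 1 - ‖z‖ := by linarith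
        have h1 := one_sub_norm_le_norm_circle_sub z t
        gcongr)
  refine this.congr (Filter.Eventually.of_forall fun t => ?_)
  simp [div_eq_mul_inv, mul_comm]

lemma integrableOn_herglotz {f : ℂ → ℂ} {S : Set ℝ} (hS : IntegrableOn (bdryLog f) S)
    {z : ℂ} (hz : z ∈ uDisc) :
    IntegrableOn (fun t => circleKernel z t * (bdryLog f t : ℂ)) S := by
  have hz1 : ‖z‖ < 1 := by simpa [uDisc] using hz
  refine Integrable.bdd_mul (c := 2 / (1 - ‖z‖)) hS.ofReal
      (continuous_circleKernel hz).aestronglyMeasurable (Filter.Eventually.of_forall fun t => ?_)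
  unfold circleKernel
  rw [norm_div]
  have h1 := one_sub_norm_le_norm_circle_sub z t
  have h2 := norm_add_le (Complex.exp ((t : ℂ) * Complex.I)) z
  rw [norm_circle] at h2
  have h3 : 0 < 1 - ‖z‖ := by linarith
  gcongr
  linarith

lemma re_circleKernel {z : ℂ} (hz : z ∈ uDisc) (t : ℝ) :
    (circleKernel z t).re =
      (1 - ‖z‖ ^ 2) / ‖Complex.exp ((t : ℂ) * Complex.I) - z‖ ^ 2 := by
  have hne := circle_sub_ne_zero hz t
  have h1 := norm_circle t
  set e := Complex.exp ((t : ℂ) * Complex.I)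
  have h2 : e.re ^ 2 + e.im ^ 2 = 1 := by
    have := Complex.sq_norm e
    rw [h1, Complex.normSq_apply] at this
    nlinarith
  unfold circleKernel
  rw [Complex.div_re, ← add_div, Complex.sq_norm, Complex.sq_norm]
  congr 1
  simp only [Complex.add_re, Complex.sub_re, Complex.add_im, Complex.sub_im,
    Complex.normSq_apply]
  nlinarith

lemma re_herglotz {f : ℂ → ℂ} {S : Set ℝ} (hS : IntegrableOn (bdryLog f) S)
    {z : ℂ} (hz : z ∈ uDisc) :
    (herglotz f S z).re = -((1 - ‖z‖ ^ 2) * logPotential f S z) := by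
  unfold herglotz logPotential
  have := integral_re (𝕜 := ℂ) (integrableOn_herglotz hS hz)
  rw [show (∫ t in S, circleKernel z t * (bdryLog f t : ℂ)).re =
    RCLike.re (∫ t in S, circleKernel z t * (bdryLog f t : ℂ)) from rfl, ← this,
    ← integral_const_mul, ← integral_neg]
  congr 1
  ext t
  simp only [RCLike.re_eq_complex_re, Complex.re_mul_ofReal, re_circleKernel hz]
  ring

lemma norm_deriv_herglotz_le {f : ℂ → ℂ} {S : Set ℝ} (hS : IntegrableOn (bdryLog f) S)
    (hneg : ∀ t, bdryLog f t ≤ 0) {z : ℂ} (hz : z ∈ uDisc) :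
    ‖deriv (herglotz f S) z‖ ≤ 2 * logPotential f S z := by
  rw [(hasDerivAt_herglotz hS hz).deriv, logPotential, ← integral_const_mul]
  refine norm_integral_le_of_norm_le ((integrableOn_logPotential hS hz).const_mul 2)
    (Filter.Eventually.of_forall fun t => ?_)
  rw [norm_mul, norm_div, norm_mul, norm_pow, norm_circle, Complex.norm_real, Real.norm_eq_abs,
    abs_of_nonpos (hneg t)]
  simp only [Complex.norm_ofNat, mul_one]
  apply le_of_eq
  ring

lemma outerPow_eq (f : ℂ → ℂ) (ρ : ℝ) (z : ℂ) :
    outerPow f ρ z =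
      Complex.exp (((ρ / (2 * Real.pi) : ℝ) : ℂ) * herglotz f (Ico 0 (2 * Real.pi)) z) := by
  unfold outerPow herglotz bdryLog
  rw [intervalIntegral.integral_of_le Real.two_pi_pos.le, ← integral_Icc_eq_integral_Ioc,
    integral_Icc_eq_integral_Ico]
  push_cast
  rfl

lemma outerPart_eq (f : ℂ → ℂ) (Γ : Set ℂ) (z : ℂ) :
    outerPart f Γ z =
      Complex.exp (((1 / (2 * Real.pi) : ℝ) : ℂ) * herglotz f (angSet Γ) z) := by
  unfold outerPart herglotz bdryLog
  push_cast
  rfl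

lemma IsOuter.eq_exp_herglotz {f : ℂ → ℂ} (hf : IsOuter f) {z : ℂ} (hz : z ∈ uDisc) :
    f z = Complex.exp (((1 / (2 * Real.pi) : ℝ) : ℂ) * herglotz f (Ico 0 (2 * Real.pi)) z) := by
  rw [hf.2.2 z hz, ← outerPow_eq]
  simp [outerPow]

lemma bdryLog_nonpos {f : ℂ → ℂ} (h1 : ∀ z ∈ closedBall (0 : ℂ) 1, ‖f z‖ ≤ 1) (t : ℝ) :
    bdryLog f t ≤ 0 :=
  Real.log_nonpos (norm_nonneg _) (h1 _ (circle_mem_closedBall t))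

lemma logPotential_nonneg {f : ℂ → ℂ} (hneg : ∀ t, bdryLog f t ≤ 0) (S : Set ℝ) (z : ℂ) :
    0 ≤ logPotential f S z :=
  integral_nonneg fun t => div_nonneg (by simpa using hneg t) (by positivity)

lemma logPotential_mono {f : ℂ → ℂ} (hneg : ∀ t, bdryLog f t ≤ 0) {S T : Set ℝ} (hST : S ⊆ T)
    (hT : IntegrableOn (bdryLog f) T) {z : ℂ} (hz : z ∈ uDisc) :
    logPotential f S z ≤ logPotential f T z :=
  setIntegral_mono_set (integrableOn_logPotential hT hz)
    (Filter.Eventually.of_forall fun t => div_nonneg (by simpa using hneg t) (by positivity))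
    (Filter.Eventually.of_forall hST)

lemma IsOuter.norm_le_exp_logPotential {f : ℂ → ℂ} (hf : IsOuter f)
    (h1 : ∀ z ∈ closedBall (0 : ℂ) 1, ‖f z‖ ≤ 1) {S : Set ℝ} (hS : S ⊆ Ico 0 (2 * Real.pi))
    {z : ℂ} (hz : z ∈ uDisc) :
    ‖f z‖ ≤ Real.exp (-((1 - ‖z‖) / (2 * Real.pi) * logPotential f S z)) := by
  have hz1 : ‖z‖ < 1 := by simpa [uDisc] using hz
  have hneg := bdryLog_nonpos h1
  have hI := integrableOn_bdryLog hf
  rw [hf.eq_exp_herglotz hz, Complex.norm_exp, Complex.re_ofReal_mul, re_herglotz hI hz]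
  apply Real.exp_le_exp.2
  have h2 := logPotential_mono hneg hS hI hz
  have h3 := logPotential_nonneg hneg S z
  have h4 : (1 - ‖z‖) * logPotential f S z ≤
      (1 - ‖z‖ ^ 2) * logPotential f (Ico 0 (2 * Real.pi)) z := by
    have : 1 - ‖z‖ ≤ 1 - ‖z‖ ^ 2 := by nlinarith [norm_nonneg z]
    exact mul_le_mul this h2 h3 (by nlinarith [norm_nonneg z])
  rw [mul_neg, neg_le_neg_iff, one_div, div_eq_inv_mul, mul_assoc]
  gcongr

lemma IsOuter.ne_zero {f : ℂ → ℂ} (hf : IsOuter f) {z : ℂ} (hz : z ∈ uDisc) : f z ≠ 0 := by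
  rw [hf.eq_exp_herglotz hz]; exact Complex.exp_ne_zero _

lemma herglotz_eq_add {f : ℂ → ℂ} {S T : Set ℝ} (hS : MeasurableSet S)
    (hTm : MeasurableSet T) (hST : S ⊆ T)
    (hT : IntegrableOn (bdryLog f) T) {z : ℂ} (hz : z ∈ uDisc) :
    herglotz f T z = herglotz f S z + herglotz f (T \ S) z := by
  unfold herglotz
  have h := integrableOn_herglotz hT hz
  rw [← setIntegral_union disjoint_sdiff_right (hTm.diff hS) (h.mono_set hST) (h.mono_set sdiff_subset),
    union_sdiff_cancel hST]

/-- Pointwise bounds for `f^ρ f_Γ^N` and its derivative. -/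
lemma outer_product_bounds {f : ℂ → ℂ} (hf : IsOuter f)
    (h1 : ∀ z ∈ closedBall (0 : ℂ) 1, ‖f z‖ ≤ 1) {Γ : Set ℂ} (hΓ : MeasurableSet (angSet Γ))
    {ρ : ℝ} (hρ : 1 ≤ ρ) (N : ℕ) {z : ℂ} (hz : z ∈ uDisc) :
    DifferentiableAt ℂ (fun z => outerPow f ρ z * (outerPart f Γ z) ^ N) z ∧
    ‖outerPow f ρ z * (outerPart f Γ z) ^ N‖ ≤ ‖f z‖ ^ ρ ∧
    ∀ S, S = angSet Γ ∨ S = Ico 0 (2 * Real.pi) \ angSet Γ →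
      ‖deriv (fun z => outerPow f ρ z * (outerPart f Γ z) ^ N) z‖ ≤
        (ρ + N) * ‖deriv f z‖ + N * ‖f z‖ ^ ρ * logPotential f S z := by
  have hz1 : ‖z‖ < 1 := by simpa [uDisc] using hz
  have hneg := bdryLog_nonpos h1
  have hI := integrableOn_bdryLog hf
  have hsub : angSet Γ ⊆ Ico 0 (2 * Real.pi) := fun t ht => ht.1
  set T := Ico 0 (2 * Real.pi) with hT
  have hIΓ : IntegrableOn (bdryLog f) (angSet Γ) := hI.mono_set hsub
  set c : ℝ := 1 / (2 * Real.pi) with hc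
  have hc0 : 0 < c := by positivity
  have hc1 : 2 * c ≤ 1 := by
    rw [hc]
    have := Real.pi_gt_three
    field_simp
    linarith
  have hfun : (fun z => outerPow f ρ z * (outerPart f Γ z) ^ N) = fun z =>
      Complex.exp (((ρ * c : ℝ) : ℂ) * herglotz f T z + ((N * c : ℝ) : ℂ) * herglotz f (angSet Γ) z) := by
    ext z
    rw [outerPow_eq, outerPart_eq, ← Complex.exp_nat_mul, ← Complex.exp_add, ← hc, ← hT]
    congr 2
    · rw [hc]; push_cast; ring
    · push_cast; ring
  have hval := congrFun hfun z
  have dT := (hasDerivAt_herglotz hI hz).differentiableAt.hasDerivAt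
  have dΓ := (hasDerivAt_herglotz hIΓ hz).differentiableAt.hasDerivAt
  have dg := ((dT.const_mul ((ρ * c : ℝ) : ℂ)).add (dΓ.const_mul ((N * c : ℝ) : ℂ))).cexp
  have hfz : (fun w => f w) =ᶠ[nhds z] fun w => Complex.exp ((c : ℂ) * herglotz f T w) :=
    Filter.eventuallyEq_of_mem (Metric.isOpen_ball.mem_nhds hz) fun w hw =>
      hf.eq_exp_herglotz hw
  have df : deriv f z = f z * ((c : ℂ) * deriv (herglotz f T) z) := by
    rw [hfz.deriv_eq, (dT.const_mul (c : ℂ)).cexp.deriv, hf.eq_exp_herglotz hz]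
  have hnorm : ‖outerPow f ρ z * (outerPart f Γ z) ^ N‖ ≤ ‖f z‖ ^ ρ := by
    rw [hval, hf.eq_exp_herglotz hz, Complex.norm_exp, Complex.norm_exp, ← Real.exp_mul,
      Complex.add_re, Complex.re_ofReal_mul, Complex.re_ofReal_mul, Complex.re_ofReal_mul]
    apply Real.exp_le_exp.2
    have h2 : (herglotz f (angSet Γ) z).re ≤ 0 := by
      rw [re_herglotz hIΓ hz, neg_nonpos]
      exact mul_nonneg (by nlinarith [norm_nonneg z]) (logPotential_nonneg hneg _ _)
    have h3 : N * c * (herglotz f (angSet Γ) z).re ≤ 0 :=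
      mul_nonpos_of_nonneg_of_nonpos (by positivity) h2
    rw [← hc, ← hT]
    nlinarith
  have hfz1 : ‖f z‖ ≤ 1 := h1 z (ball_subset_closedBall hz)
  have hnorm' : ‖outerPow f ρ z * (outerPart f Γ z) ^ N‖ ≤ ‖f z‖ := by
    refine hnorm.trans ?_
    calc ‖f z‖ ^ ρ ≤ ‖f z‖ ^ (1 : ℝ) :=
          Real.rpow_le_rpow_of_exponent_ge (norm_pos_iff.2 (hf.ne_zero hz)) hfz1 hρ
      _ = _ := Real.rpow_one _
  refine ⟨by rw [hfun]; exact dg.differentiableAt, hnorm, ?_⟩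
  intro S hS
  have hderiv : deriv (fun z => outerPow f ρ z * (outerPart f Γ z) ^ N) z =
      (outerPow f ρ z * (outerPart f Γ z) ^ N) * (((ρ * c : ℝ) : ℂ) * deriv (herglotz f T) z +
        ((N * c : ℝ) : ℂ) * deriv (herglotz f (angSet Γ)) z) := by
    rw [hval, hfun]
    exact dg.deriv
  set g := outerPow f ρ z * (outerPart f Γ z) ^ N with hg
  obtain ⟨X, Y, hXY, hX, hY⟩ : ∃ X Y : ℂ, (((ρ * c : ℝ) : ℂ) * deriv (herglotz f T) z +
        ((N * c : ℝ) : ℂ) * deriv (herglotz f (angSet Γ)) z) = X + Y ∧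
        ‖X‖ ≤ (ρ + N) * (c * ‖deriv (herglotz f T) z‖) ∧ ‖Y‖ ≤ N * logPotential f S z := by
    have aux : ∀ R ⊆ T, ‖deriv (herglotz f R) z‖ * (N * c) ≤ N * logPotential f R z := by
      intro R hR
      have h3 := norm_deriv_herglotz_le (hI.mono_set hR) hneg hz
      have h4 := logPotential_nonneg hneg R z
      calc _ ≤ (2 * logPotential f R z) * (N * c) := by gcongr
        _ = N * logPotential f R z * (2 * c) := by ring
        _ ≤ N * logPotential f R z * 1 := by gcongr
        _ = _ := by ring
    have hn0 := norm_nonneg (deriv (herglotz f T) z)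
    rcases hS with rfl | rfl
    · refine ⟨_, _, rfl, ?_, ?_⟩
      · rw [norm_mul, Complex.norm_real, Real.norm_of_nonneg (by positivity)]
        have : 0 ≤ N * (c * ‖deriv (herglotz f T) z‖) := by positivity
        linarith
      · rw [norm_mul, Complex.norm_real, Real.norm_of_nonneg (by positivity), mul_comm]
        exact aux _ hsub
    · have hdec : deriv (herglotz f T) z = deriv (herglotz f (angSet Γ)) z +
          deriv (herglotz f (T \ angSet Γ)) z := by
        have dC := (hasDerivAt_herglotz (hI.mono_set sdiff_subset) hz :
          HasDerivAt (herglotz f (T \ angSet Γ)) _ z).differentiableAt.hasDerivAt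
        have he : herglotz f T =ᶠ[nhds z] fun w => herglotz f (angSet Γ) w +
            herglotz f (T \ angSet Γ) w :=
          Filter.eventuallyEq_of_mem (Metric.isOpen_ball.mem_nhds hz) fun w hw =>
            herglotz_eq_add hΓ measurableSet_Ico hsub hI hw
        rw [he.deriv_eq]
        exact (dΓ.add dC).deriv
      refine ⟨(((ρ + N) * c : ℝ) : ℂ) * deriv (herglotz f T) z,
        -(((N * c : ℝ) : ℂ) * deriv (herglotz f (T \ angSet Γ)) z), ?_, ?_, ?_⟩
      · have : deriv (herglotz f (angSet Γ)) z = deriv (herglotz f T) z -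
            deriv (herglotz f (T \ angSet Γ)) z := by rw [hdec]; ring
        rw [this]
        push_cast
        ring
      · rw [norm_mul, Complex.norm_real, Real.norm_of_nonneg (by positivity), mul_assoc]
      · rw [norm_neg, norm_mul, Complex.norm_real, Real.norm_of_nonneg (by positivity), mul_comm]
        exact aux _ sdiff_subset
  rw [hderiv, hXY, df]
  have hp := logPotential_nonneg hneg S z
  calc ‖g * (X + Y)‖ ≤ ‖g‖ * ‖X‖ + ‖g‖ * ‖Y‖ := by
        rw [norm_mul, ← mul_add]; gcongr; exact norm_add_le _ _
    _ ≤ ‖f z‖ * ((ρ + N) * (c * ‖deriv (herglotz f T) z‖)) +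
        ‖f z‖ ^ ρ * (N * logPotential f S z) := by gcongr
    _ = _ := by
        rw [norm_mul, norm_mul, Complex.norm_real, Real.norm_of_nonneg hc0.le]
        ring

/-- Angles at which `f` vanishes on the unit circle. -/
def zeroAngles (f : ℂ → ℂ) : Set ℝ := {t | f (Complex.exp ((t : ℂ) * Complex.I)) = 0}

/-- Distance from an angle to the zero angles of `f`. -/
noncomputable def gap (f : ℂ → ℂ) (θ : ℝ) : ℝ := infDist θ (zeroAngles f)

/-- The point of the disc at angle `θ` and distance `s` from the unit circle. -/
noncomputable def radialPt (θ s : ℝ) : ℂ := ((1 - s : ℝ) : ℂ) * Complex.exp ((θ : ℂ) * Complex.I)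

lemma norm_radialPt (θ : ℝ) {s : ℝ} (hs : s ≤ 1) : ‖radialPt θ s‖ = 1 - s := by
  rw [radialPt, norm_mul, norm_circle, mul_one, Complex.norm_real,
    Real.norm_of_nonneg (by linarith)]

lemma radialPt_mem_uDisc (θ : ℝ) {s : ℝ} (hs0 : 0 < s) (hs : s ≤ 1) : radialPt θ s ∈ uDisc := by
  rw [uDisc, mem_ball_zero_iff, norm_radialPt θ hs]; linarith

lemma radialPt_mem_closedBall (θ : ℝ) {s : ℝ} (hs0 : 0 ≤ s) (hs : s ≤ 1) :
    radialPt θ s ∈ closedBall (0 : ℂ) 1 := by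
  rw [mem_closedBall_zero_iff, norm_radialPt θ hs]; linarith

lemma radialPt_zero (θ : ℝ) : radialPt θ 0 = Complex.exp ((θ : ℂ) * Complex.I) := by
  simp [radialPt]

lemma radialPt_sub_same (θ s t : ℝ) : ‖radialPt θ s - radialPt θ t‖ = |s - t| := by
  rw [radialPt, radialPt, ← sub_mul, norm_mul, norm_circle, mul_one, ← Complex.ofReal_sub,
    Complex.norm_real, Real.norm_eq_abs, abs_sub_comm]
  congr 1; ring

lemma circle_add_int_mul (t : ℝ) (k : ℤ) :
    Complex.exp (((t + k * (2 * Real.pi) : ℝ) : ℂ) * Complex.I) =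
      Complex.exp ((t : ℂ) * Complex.I) := by
  rw [Complex.exp_eq_exp_iff_exists_int]
  exact ⟨k, by push_cast; ring⟩

lemma norm_circle_sub_circle (s t : ℝ) :
    ‖Complex.exp ((s : ℂ) * Complex.I) - Complex.exp ((t : ℂ) * Complex.I)‖ =
      2 * |Real.sin ((s - t) / 2)| := by
  have h : Complex.exp ((s : ℂ) * Complex.I) - Complex.exp ((t : ℂ) * Complex.I) =
      Complex.exp ((t : ℂ) * Complex.I) * (Complex.exp (Complex.I * ((s - t : ℝ) : ℂ)) - 1) := by
    rw [mul_sub, mul_one, ← Complex.exp_add]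
    congr 2
    push_cast
    ring
  rw [h, norm_mul, norm_circle, one_mul, Complex.norm_exp_I_mul_ofReal_sub_one, norm_mul,
    Real.norm_eq_abs, Real.norm_eq_abs, abs_two]

lemma norm_circle_sub_circle_le (s t : ℝ) :
    ‖Complex.exp ((s : ℂ) * Complex.I) - Complex.exp ((t : ℂ) * Complex.I)‖ ≤ |s - t| := by
  rw [norm_circle_sub_circle]
  have := @Real.abs_sin_le_abs ((s - t) / 2)
  rw [abs_div, abs_two] at this
  linarith

lemma isClosed_zeroAngles {f : ℂ → ℂ} (hf : ContinuousOn f (closedBall 0 1)) :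
    IsClosed (zeroAngles f) :=
  isClosed_singleton.preimage (continuous_comp_circle hf)

lemma gap_nonneg (f : ℂ → ℂ) (θ : ℝ) : 0 ≤ gap f θ := infDist_nonneg

lemma gap_le (f : ℂ → ℂ) {p : ℝ} (hp : p ∈ zeroAngles f) (θ : ℝ) : gap f θ ≤ |θ - p| := by
  rw [← Real.dist_eq]; exact infDist_le_dist_of_mem hp

lemma gap_le_add (f : ℂ → ℂ) (θ t : ℝ) : gap f θ ≤ gap f t + |θ - t| := by
  rw [← Real.dist_eq]; exact infDist_le_infDist_add_dist

lemma continuous_gap (f : ℂ → ℂ) : Continuous (gap f) := continuous_infDist_pt _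

lemma mem_arc_of_segment {f : ℂ → ℂ} {θ t : ℝ} (h : ∀ s ∈ uIcc θ t, s ∉ zeroAngles f) :
    Complex.exp ((t : ℂ) * Complex.I) ∈
      connectedComponentIn (offZeros f) (Complex.exp ((θ : ℂ) * Complex.I)) := by
  have h1 : IsPreconnected ((fun t : ℝ => Complex.exp ((t : ℂ) * Complex.I)) '' uIcc θ t) :=
    isPreconnected_uIcc.image _ continuous_circle.continuousOn
  refine h1.subset_connectedComponentIn (mem_image_of_mem _ left_mem_uIcc) ?_
    (mem_image_of_mem _ right_mem_uIcc)
  rintro _ ⟨s, hs, rfl⟩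
  exact ⟨by simp only [uCircle, mem_sphere_zero_iff_norm, norm_circle], h s hs⟩

lemma IsArcUnion.mem_of_segment {f : ℂ → ℂ} {Γ : Set ℂ} (hΓ : IsArcUnion f Γ) {θ t : ℝ}
    (h : ∀ s ∈ uIcc θ t, s ∉ zeroAngles f) (hθ : Complex.exp ((θ : ℂ) * Complex.I) ∈ Γ) :
    Complex.exp ((t : ℂ) * Complex.I) ∈ Γ :=
  hΓ.2 _ hθ (mem_arc_of_segment h)

lemma not_mem_zeroAngles_of_lt_gap {f : ℂ → ℂ} {θ t : ℝ} (h : |t - θ| < gap f θ) :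
    ∀ s ∈ uIcc θ t, s ∉ zeroAngles f := by
  intro s hs hs0
  have h1 := gap_le f hs0 θ
  have h2 := abs_sub_left_of_mem_uIcc hs
  rw [abs_sub_comm] at h1
  linarith

lemma IsArcUnion.mem_iff_of_lt_gap {f : ℂ → ℂ} {Γ : Set ℂ} (hΓ : IsArcUnion f Γ) {θ t : ℝ}
    (h : |t - θ| < gap f θ) :
    Complex.exp ((t : ℂ) * Complex.I) ∈ Γ ↔ Complex.exp ((θ : ℂ) * Complex.I) ∈ Γ := by
  have h1 := not_mem_zeroAngles_of_lt_gap h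
  exact ⟨hΓ.mem_of_segment (by rwa [uIcc_comm]), hΓ.mem_of_segment h1⟩

lemma exists_zeroAngle_near {f : ℂ → ℂ}
    (harc : ∀ γ, IsCompArc f γ → volume (angSet γ) < ENNReal.ofReal (1/2)) (θ : ℝ) :
    ∃ p ∈ zeroAngles f, |p - θ| ≤ 1 / 2 := by
  by_contra! hcon
  obtain ⟨k, hk, -⟩ := existsUnique_add_zsmul_mem_Ico Real.two_pi_pos θ 0
  simp only [zsmul_eq_mul, zero_add] at hk
  set θ' := θ + k * (2 * Real.pi) with hθ'
  have hcon' : ∀ s, |s - θ'| ≤ 1 / 2 → s ∉ zeroAngles f := by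
    intro s hs hs0
    have h1 : s + ((-k : ℤ) : ℝ) * (2 * Real.pi) ∈ zeroAngles f := by
      rw [zeroAngles, mem_ofPred_eq, circle_add_int_mul]; exact hs0
    have h2 := hcon _ h1
    have h3 : s + ((-k : ℤ) : ℝ) * (2 * Real.pi) - θ = s - θ' := by
      rw [hθ']; push_cast; ring
    rw [h3] at h2
    linarith
  have hx : Complex.exp ((θ' : ℂ) * Complex.I) ∈ offZeros f :=
    ⟨by simp only [uCircle, mem_sphere_zero_iff_norm, norm_circle], hcon' θ' (by simp)⟩
  have hv := harc _ ⟨_, hx, rfl⟩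
  have key : ∀ t ∈ Ico (0 : ℝ) (2 * Real.pi), |t - θ'| ≤ 1 / 2 →
      t ∈ angSet (connectedComponentIn (offZeros f) (Complex.exp ((θ' : ℂ) * Complex.I))) := by
    intro t ht htθ
    refine ⟨ht, mem_arc_of_segment fun s hs => hcon' s ?_⟩
    have := abs_sub_left_of_mem_uIcc hs
    linarith
  have hpi := Real.pi_gt_three
  rcases le_total θ' Real.pi with h | h
  · have hsub : Ico θ' (θ' + 1 / 2) ⊆ angSet (connectedComponentIn (offZeros f)
        (Complex.exp ((θ' : ℂ) * Complex.I))) := fun t ht =>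
      key t ⟨hk.1.trans ht.1, by linarith [ht.2]⟩ (by rw [abs_le]; constructor <;> linarith [ht.1, ht.2])
    have := measure_mono (μ := volume) hsub
    rw [Real.volume_Ico, add_sub_cancel_left] at this
    exact absurd hv (not_lt.2 this)
  · have hsub : Ico (θ' - 1 / 2) θ' ⊆ angSet (connectedComponentIn (offZeros f)
        (Complex.exp ((θ' : ℂ) * Complex.I))) := fun t ht =>
      key t ⟨by linarith [ht.1], ht.2.trans hk.2⟩
        (by rw [abs_le]; constructor <;> linarith [ht.1, ht.2])
    have := measure_mono (μ := volume) hsub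
    rw [Real.volume_Ico, sub_sub_cancel] at this
    exact absurd hv (not_lt.2 this)

lemma exists_gap_eq {f : ℂ → ℂ} (hf : ContinuousOn f (closedBall 0 1))
    (hne : (zeroAngles f).Nonempty) (θ : ℝ) : ∃ p ∈ zeroAngles f, gap f θ = |θ - p| := by
  obtain ⟨p, hp, h⟩ := (isClosed_zeroAngles hf).exists_infDist_eq_dist hne θ
  exact ⟨p, hp, by rw [gap, h, Real.dist_eq]⟩

lemma gap_pos {f : ℂ → ℂ} (hf : ContinuousOn f (closedBall 0 1))
    (hne : (zeroAngles f).Nonempty) {θ : ℝ} (hθ : θ ∉ zeroAngles f) : 0 < gap f θ := by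
  rw [gap, ← (isClosed_zeroAngles hf).notMem_iff_infDist_pos hne]; exact hθ

lemma IsArcUnion.measurableSet_angSet {f : ℂ → ℂ} (hf : ContinuousOn f (closedBall 0 1))
    (hne : (zeroAngles f).Nonempty) {Γ : Set ℂ} (hΓ : IsArcUnion f Γ) :
    MeasurableSet (angSet Γ) := by
  have : IsOpen {t : ℝ | Complex.exp ((t : ℂ) * Complex.I) ∈ Γ} := by
    rw [Metric.isOpen_iff]
    intro θ hθ
    have hg : 0 < gap f θ := gap_pos hf hne (hΓ.1 hθ).2
    refine ⟨_, hg, fun t ht => ?_⟩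
    rw [mem_ball, Real.dist_eq] at ht
    exact (hΓ.mem_iff_of_lt_gap ht).2 hθ
  exact measurableSet_Ico.inter this.measurableSet

lemma gap_le_norm_circle_sub {f : ℂ → ℂ} {Γ : Set ℂ} (hΓ : IsArcUnion f Γ) {θ t : ℝ}
    (h : ¬ (Complex.exp ((t : ℂ) * Complex.I) ∈ Γ ↔ Complex.exp ((θ : ℂ) * Complex.I) ∈ Γ)) :
    gap f θ ≤ 2 * ‖Complex.exp ((t : ℂ) * Complex.I) - Complex.exp ((θ : ℂ) * Complex.I)‖ := by
  obtain ⟨k, hk, -⟩ := existsUnique_add_zsmul_mem_Ico Real.two_pi_pos t (θ - Real.pi)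
  simp only [zsmul_eq_mul] at hk
  set t' := t + k * (2 * Real.pi) with ht'
  have he : Complex.exp ((t' : ℂ) * Complex.I) = Complex.exp ((t : ℂ) * Complex.I) :=
    circle_add_int_mul t k
  rw [← he] at h ⊢
  have h1 : gap f θ ≤ |t' - θ| := by
    by_contra! hlt
    exact h (hΓ.mem_iff_of_lt_gap hlt)
  rw [norm_circle_sub_circle]
  have h2 : |(t' - θ) / 2| ≤ Real.pi / 2 := by
    rw [abs_le]; constructor <;> linarith [hk.1, hk.2]
  have h3 := Real.mul_abs_le_abs_sin h2
  rw [abs_div, abs_two] at h3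
  have h4 : |t' - θ| ≤ 2 * (2 * (2 / Real.pi * (|t' - θ| / 2))) := by
    have h5 : (1 : ℝ) ≤ 4 / Real.pi := by
      rw [le_div_iff₀ Real.pi_pos]; linarith [Real.pi_le_four]
    calc |t' - θ| = 1 * |t' - θ| := by ring
      _ ≤ 4 / Real.pi * |t' - θ| := by gcongr
      _ = _ := by ring
  linarith

/-- On a radius at angle `θ`, the logarithmic potential of the part of the circle separated from
`θ` is essentially constant up to distance `gap f θ` from the circle. -/
lemma logPotential_compare {f : ℂ → ℂ} (hf : IsOuter f)
    (h1 : ∀ z ∈ closedBall (0 : ℂ) 1, ‖f z‖ ≤ 1) {Γ : Set ℂ} (hΓ : IsArcUnion f Γ)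
    {θ : ℝ} {S : Set ℝ} (hS : S ⊆ Ico 0 (2 * Real.pi)) (hSm : MeasurableSet S)
    (hsep : ∀ t ∈ S, ¬ (Complex.exp ((t : ℂ) * Complex.I) ∈ Γ ↔
      Complex.exp ((θ : ℂ) * Complex.I) ∈ Γ)) {s : ℝ} (hs0 : 0 < s) (hs1 : s ≤ 1)
    (hs : s ≤ gap f θ) :
    logPotential f S (radialPt θ s) ≤ 4 * logPotential f S (Complex.exp ((θ : ℂ) * Complex.I)) ∧
    logPotential f S (Complex.exp ((θ : ℂ) * Complex.I)) ≤
      9 * logPotential f S (radialPt θ s) := by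
  have hneg := bdryLog_nonpos h1
  have hI := (integrableOn_bdryLog hf).mono_set hS
  have hz := radialPt_mem_uDisc θ hs0 hs1
  have hIz := integrableOn_logPotential hI hz
  have hg : 0 < gap f θ := hs0.trans_le hs
  set w := Complex.exp ((θ : ℂ) * Complex.I) with hw
  have hzw : ‖radialPt θ s - w‖ = s := by
    rw [hw, ← radialPt_zero, radialPt_sub_same, sub_zero, abs_of_pos hs0]
  have hcmp : ∀ t ∈ S, 0 < ‖Complex.exp ((t : ℂ) * Complex.I) - w‖ ∧
      ‖Complex.exp ((t : ℂ) * Complex.I) - w‖ ≤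
        2 * ‖Complex.exp ((t : ℂ) * Complex.I) - radialPt θ s‖ ∧
      ‖Complex.exp ((t : ℂ) * Complex.I) - radialPt θ s‖ ≤
        3 * ‖Complex.exp ((t : ℂ) * Complex.I) - w‖ := by
    intro t ht
    have h2 := gap_le_norm_circle_sub hΓ (hsep t ht)
    rw [← hw] at h2
    have h3 := one_sub_norm_le_norm_circle_sub (radialPt θ s) t
    rw [norm_radialPt θ hs1] at h3
    have h4 := norm_sub_le_norm_sub_add_norm_sub (Complex.exp ((t : ℂ) * Complex.I)) (radialPt θ s) w
    have h5 := norm_sub_le_norm_sub_add_norm_sub (Complex.exp ((t : ℂ) * Complex.I)) w (radialPt θ s)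
    rw [norm_sub_rev w, hzw] at h5
    rw [hzw] at h4
    refine ⟨by linarith, by linarith, by linarith⟩
  have hb : ∀ t ∈ S, (-bdryLog f t) / ‖Complex.exp ((t : ℂ) * Complex.I) - w‖ ^ 2 ≤
      9 * ((-bdryLog f t) / ‖Complex.exp ((t : ℂ) * Complex.I) - radialPt θ s‖ ^ 2) := by
    intro t ht
    obtain ⟨h2, h3, h4⟩ := hcmp t ht
    have h6 : 0 ≤ -bdryLog f t := by simpa using hneg t
    have h8 : 0 < ‖Complex.exp ((t : ℂ) * Complex.I) - radialPt θ s‖ := by linarith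
    rw [← mul_div_assoc, div_le_div_iff₀ (by positivity) (by positivity)]
    have h7 : ‖Complex.exp ((t : ℂ) * Complex.I) - radialPt θ s‖ ^ 2 ≤
        (3 * ‖Complex.exp ((t : ℂ) * Complex.I) - w‖) ^ 2 := by gcongr
    nlinarith
  have ha : ∀ t ∈ S, (-bdryLog f t) / ‖Complex.exp ((t : ℂ) * Complex.I) - radialPt θ s‖ ^ 2 ≤
      4 * ((-bdryLog f t) / ‖Complex.exp ((t : ℂ) * Complex.I) - w‖ ^ 2) := by
    intro t ht
    obtain ⟨h2, h3, h4⟩ := hcmp t ht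
    have h6 : 0 ≤ -bdryLog f t := by simpa using hneg t
    have h8 : 0 < ‖Complex.exp ((t : ℂ) * Complex.I) - radialPt θ s‖ := by linarith
    rw [← mul_div_assoc, div_le_div_iff₀ (by positivity) (by positivity)]
    have h7 : ‖Complex.exp ((t : ℂ) * Complex.I) - w‖ ^ 2 ≤
        (2 * ‖Complex.exp ((t : ℂ) * Complex.I) - radialPt θ s‖) ^ 2 := by gcongr
    nlinarith
  have hIw : IntegrableOn (fun t => (-bdryLog f t) /
      ‖Complex.exp ((t : ℂ) * Complex.I) - w‖ ^ 2) S := by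
    refine Integrable.mono' (hIz.const_mul 9) ?_ ?_
    · refine Measurable.aestronglyMeasurable ?_
      exact (measurable_bdryLog hf.1.2).neg.div
        ((continuous_circle.sub continuous_const).norm.pow 2).measurable
    · refine (ae_restrict_iff' hSm).2 (Filter.Eventually.of_forall fun t ht => ?_)
      rw [Real.norm_of_nonneg (div_nonneg (by simpa using hneg t) (by positivity))]
      exact hb t ht
  constructor
  · rw [logPotential, logPotential, ← integral_const_mul]
    exact setIntegral_mono_on hIz (hIw.const_mul 4) hSm ha
  · rw [logPotential, logPotential, ← integral_const_mul]
    exact setIntegral_mono_on hIw (hIz.const_mul 9) hSm hb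

/-- Radial estimates for the logarithmic potential and the derivative of `f^ρ f_Γ^N`. -/
lemma radial_estimates {f : ℂ → ℂ} (hf : IsOuter f)
    (h1 : ∀ z ∈ closedBall (0 : ℂ) 1, ‖f z‖ ≤ 1) (hne : (zeroAngles f).Nonempty)
    {Γ : Set ℂ} (hΓ : IsArcUnion f Γ) {ρ : ℝ} (hρ : 1 ≤ ρ) (N : ℕ) (θ : ℝ) :
    ∃ (A : ℝ) (a : ℝ → ℝ), 0 ≤ A ∧ (∀ s, 0 < s → s ≤ 1 → 0 ≤ a s ∧
      ‖f (radialPt θ s)‖ ≤ Real.exp (-(s / (2 * Real.pi) * a s)) ∧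
      ‖deriv (fun z => outerPow f ρ z * (outerPart f Γ z) ^ N) (radialPt θ s)‖ ≤
        (ρ + N) * ‖deriv f (radialPt θ s)‖ + N * ‖f (radialPt θ s)‖ ^ ρ * a s) ∧
      ∀ s, 0 < s → s ≤ 1 → s ≤ gap f θ → a s ≤ 4 * A ∧
        ‖f (radialPt θ s)‖ ≤ Real.exp (-(s / (18 * Real.pi) * A)) := by
  have hm := hΓ.measurableSet_angSet hf.1.2 hne
  obtain ⟨S, hSsub, hSm, hS, hsep⟩ : ∃ S : Set ℝ, S ⊆ Ico 0 (2 * Real.pi) ∧ MeasurableSet S ∧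
      (S = angSet Γ ∨ S = Ico 0 (2 * Real.pi) \ angSet Γ) ∧
      ∀ t ∈ S, ¬ (Complex.exp ((t : ℂ) * Complex.I) ∈ Γ ↔
        Complex.exp ((θ : ℂ) * Complex.I) ∈ Γ) := by
    by_cases h : Complex.exp ((θ : ℂ) * Complex.I) ∈ Γ
    · refine ⟨_, sdiff_subset, measurableSet_Ico.diff hm, Or.inr rfl, fun t ht hiff => ?_⟩
      exact ht.2 ⟨ht.1, hiff.2 h⟩
    · exact ⟨_, fun t ht => ht.1, hm, Or.inl rfl, fun t ht hiff => h (hiff.1 ht.2)⟩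
  have hneg := bdryLog_nonpos h1
  refine ⟨logPotential f S (Complex.exp ((θ : ℂ) * Complex.I)),
    fun s => logPotential f S (radialPt θ s), logPotential_nonneg hneg _ _, ?_, ?_⟩
  · intro s hs0 hs1
    have hz := radialPt_mem_uDisc θ hs0 hs1
    refine ⟨logPotential_nonneg hneg _ _, ?_, (outer_product_bounds hf h1 hm hρ N hz).2.2 S hS⟩
    have := hf.norm_le_exp_logPotential h1 hSsub hz
    rwa [norm_radialPt θ hs1, sub_sub_cancel] at this
  · intro s hs0 hs1 hs
    have hz := radialPt_mem_uDisc θ hs0 hs1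
    obtain ⟨h2, h3⟩ := logPotential_compare hf h1 hΓ hSsub hSm hsep hs0 hs1 hs
    refine ⟨h2, (hf.norm_le_exp_logPotential h1 hSsub hz).trans (Real.exp_le_exp.2 ?_)⟩
    rw [norm_radialPt θ hs1, sub_sub_cancel, neg_le_neg_iff]
    have h4 : s / (18 * Real.pi) = s / (2 * Real.pi) / 9 := by
      field_simp; norm_num
    have h5 : 0 ≤ s / (2 * Real.pi) := by positivity
    rw [h4]
    calc _ = s / (2 * Real.pi) * (logPotential f S (Complex.exp ((θ : ℂ) * Complex.I)) / 9) := by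
          ring
      _ ≤ _ := by gcongr; linarith

lemma rpow_mul_log_two_div_le {x η : ℝ} (hx : 0 < x) (hη0 : 0 < η) (hη1 : η ≤ 1) :
    x ^ η * Real.log (2 / x) ≤ 2 / η := by
  have h1 : Real.log (2 / x) ≤ (2 / x) ^ η / η := Real.log_le_rpow_div (by positivity) hη0
  have h2 : x ^ η * (2 / x) ^ η = 2 ^ η := by
    rw [← Real.mul_rpow hx.le (by positivity)]
    congr 1
    field_simp
  have h3 : (2 : ℝ) ^ η ≤ 2 := by
    calc (2 : ℝ) ^ η ≤ 2 ^ (1 : ℝ) := Real.rpow_le_rpow_of_exponent_le (by norm_num) hη1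
      _ = 2 := Real.rpow_one 2
  calc x ^ η * Real.log (2 / x) ≤ x ^ η * ((2 / x) ^ η / η) := by gcongr
    _ = 2 ^ η / η := by rw [← mul_div_assoc, h2]
    _ ≤ 2 / η := by gcongr

lemma exp_neg_rpow_mul_le {x k η a : ℝ} (hx : 0 ≤ x) (hk : 0 < k) (hη : 0 < η) (ha : 0 ≤ a)
    (h : x ≤ Real.exp (-(k * a))) : x ^ η * a ≤ 1 / (η * k) := by
  have h1 : x ^ η ≤ Real.exp (-(η * k * a)) := by
    calc x ^ η ≤ Real.exp (-(k * a)) ^ η := by gcongr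
      _ = _ := by rw [← Real.exp_mul]; ring_nf
  have h2 : η * k * a ≤ Real.exp (η * k * a) := by
    linarith [Real.add_one_le_exp (η * k * a)]
  rw [le_div_iff₀ (by positivity)]
  calc x ^ η * a * (η * k) = x ^ η * (η * k * a) := by ring
    _ ≤ Real.exp (-(η * k * a)) * Real.exp (η * k * a) := by gcongr
    _ = 1 := by rw [← Real.exp_add]; simp

lemma rpow_le_mul_rpow {x ρ η : ℝ} (hx : 0 < x) (hx1 : x ≤ 1) (hρ : 1 + η ≤ ρ) :
    x ^ ρ ≤ x * x ^ η := by
  calc x ^ ρ ≤ x ^ (1 + η) := Real.rpow_le_rpow_of_exponent_ge hx hx1 hρ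
    _ = _ := by rw [Real.rpow_add hx, Real.rpow_one]

/-- Each point of a radius has a companion point at distance comparable with `T`, at which `f`
is much smaller, where `T` also controls the weighted logarithmic potential. -/
lemma exists_comparison_point {f : ℂ → ℂ} (hf : IsOuter f)
    (h1 : ∀ z ∈ closedBall (0 : ℂ) 1, ‖f z‖ ≤ 1) {θ p A : ℝ} {a : ℝ → ℝ}
    (hp : p ∈ zeroAngles f) (hd : gap f θ = |θ - p|) (hd2 : gap f θ ≤ 1 / 2)
    (ha1 : ∀ s, 0 < s → s ≤ 1 → 0 ≤ a s ∧
      ‖f (radialPt θ s)‖ ≤ Real.exp (-(s / (2 * Real.pi) * a s)))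
    (ha2 : ∀ s, 0 < s → s ≤ 1 → s ≤ gap f θ → a s ≤ 4 * A ∧
        ‖f (radialPt θ s)‖ ≤ Real.exp (-(s / (18 * Real.pi) * A)))
    {ρ η : ℝ} (hη0 : 0 < η) (hη1 : η ≤ 1) (hρ : 1 + η ≤ ρ) {s : ℝ} (hs0 : 0 < s)
    (hs : s ≤ 1 / 2) :
    ∃ T, s ≤ T ∧ ∃ w ∈ closedBall (0 : ℂ) 1, ‖radialPt θ s - w‖ ≤ 2 * T ∧
      ‖f (radialPt θ s)‖ ≤ 2 * ‖f (radialPt θ s) - f w‖ ∧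
      ‖f (radialPt θ s)‖ ^ ρ * a s ≤ 144 * Real.pi / η * (‖f (radialPt θ s)‖ / T) := by
  have hpi := Real.pi_pos
  have hs1 : s ≤ 1 := by linarith
  have hz := radialPt_mem_uDisc θ hs0 hs1
  set M := ‖f (radialPt θ s)‖ with hM
  have hM0 : 0 < M := norm_pos_iff.2 (hf.ne_zero hz)
  have hM1 : M ≤ 1 := h1 _ (radialPt_mem_closedBall θ hs0.le hs1)
  obtain ⟨ha0, haF⟩ := ha1 s hs0 hs1
  have hρM := rpow_le_mul_rpow hM0 hM1 hρ
  have hw0 : f (Complex.exp ((p : ℂ) * Complex.I)) = 0 := hp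
  have hdist : ‖radialPt θ s - Complex.exp ((p : ℂ) * Complex.I)‖ ≤ s + gap f θ := by
    refine (norm_sub_le_norm_sub_add_norm_sub _ (radialPt θ 0) _).trans ?_
    rw [radialPt_sub_same, sub_zero, abs_of_pos hs0, radialPt_zero, hd]
    gcongr
    exact norm_circle_sub_circle_le _ _
  have hlog := rpow_mul_log_two_div_le hM0 hη0 hη1
  rcases le_or_gt (gap f θ) s with h | h
  · refine ⟨s, le_rfl, _, circle_mem_closedBall p, by linarith, by rw [hw0, sub_zero]; linarith, ?_⟩
    have h2 := exp_neg_rpow_mul_le hM0.le (k := s / (2 * Real.pi)) (by positivity) hη0 ha0 haF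
    calc M ^ ρ * a s ≤ M * M ^ η * a s := by gcongr
      _ = M * (M ^ η * a s) := by ring
      _ ≤ M * (1 / (η * (s / (2 * Real.pi)))) := by gcongr
      _ = 2 * Real.pi / η * (M / s) := by field_simp
      _ ≤ _ := by gcongr; linarith
  · obtain ⟨ha4, hFA⟩ := ha2 s hs0 hs1 h.le
    have hd0 : 0 < gap f θ := hs0.trans h
    have hmain : ∀ T, 0 < T → A * T ≤ Real.log (2 / M) * (18 * Real.pi) →
        M ^ ρ * a s ≤ 144 * Real.pi / η * (M / T) := by
      intro T hT hAT
      calc M ^ ρ * a s ≤ M * M ^ η * (4 * A) := by gcongr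
        _ ≤ M * M ^ η * (4 * (Real.log (2 / M) * (18 * Real.pi) / T)) := by
            gcongr; rwa [le_div_iff₀ hT]
        _ = 72 * Real.pi * (M ^ η * Real.log (2 / M)) * (M / T) := by ring
        _ ≤ 72 * Real.pi * (2 / η) * (M / T) := by gcongr
        _ = _ := by ring
    rcases le_or_gt (gap f θ / (18 * Real.pi) * A) (Real.log (2 / M)) with h3 | h3
    · refine ⟨gap f θ, h.le, _, circle_mem_closedBall p, by linarith,
        by rw [hw0, sub_zero]; linarith, hmain _ hd0 ?_⟩
      calc A * gap f θ = gap f θ / (18 * Real.pi) * A * (18 * Real.pi) := by field_simp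
        _ ≤ _ := by gcongr
    · have hL : Real.log (2 / M) = Real.log 2 - Real.log M := Real.log_div two_ne_zero hM0.ne'
      have hlogM : s / (18 * Real.pi) * A ≤ -Real.log M := by
        have := Real.log_le_log hM0 hFA
        rw [Real.log_exp] at this
        linarith
      have hlog2 : 0 < Real.log 2 := Real.log_pos (by norm_num)
      have hlog0 : 0 < Real.log (2 / M) := Real.log_pos (by rw [lt_div_iff₀ hM0]; linarith)
      have hA : 0 < A := by
        by_contra! hA
        have : gap f θ / (18 * Real.pi) * A ≤ 0 :=
          mul_nonpos_of_nonneg_of_nonpos (by positivity) hA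
        linarith
      set ℓ := Real.log (2 / M) * (18 * Real.pi) / A with hℓ
      have e1 : ℓ / (18 * Real.pi) * A = Real.log (2 / M) := by rw [hℓ]; field_simp
      have hℓ0 : 0 < ℓ := by positivity
      have hsl : s ≤ ℓ := by
        rw [hℓ, le_div_iff₀ hA]
        calc s * A = s / (18 * Real.pi) * A * (18 * Real.pi) := by field_simp
          _ ≤ _ := by gcongr; linarith
      have hld : ℓ ≤ gap f θ := by
        rw [hℓ, div_le_iff₀ hA]
        calc _ ≤ gap f θ / (18 * Real.pi) * A * (18 * Real.pi) := by gcongr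
          _ = _ := by field_simp
      have hl1 : ℓ ≤ 1 := by linarith
      refine ⟨ℓ, hsl, radialPt θ ℓ, radialPt_mem_closedBall θ hℓ0.le hl1, ?_, ?_, hmain ℓ hℓ0 ?_⟩
      · rw [radialPt_sub_same, abs_le]; constructor <;> linarith
      · have h4 := (ha2 ℓ hℓ0 hl1 hld).2
        rw [e1, Real.exp_neg, Real.exp_log (by positivity), inv_div] at h4
        have h5 := norm_sub_norm_le (f (radialPt θ s)) (f (radialPt θ ℓ))
        rw [← hM] at h5
        linarith
      · rw [hℓ]; exact (mul_div_cancel₀ _ hA.ne').le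

lemma exists_eq_radialPt (z : ℂ) : ∃ θ ∈ Ioc (-Real.pi) Real.pi, z = radialPt θ (1 - ‖z‖) := by
  refine ⟨Complex.arg z, ⟨Complex.neg_pi_lt_arg z, Complex.arg_le_pi z⟩, ?_⟩
  rw [radialPt, sub_sub_cancel, Complex.norm_mul_exp_arg_mul_I]

lemma norm_deriv_le_of_norm_le_half {g : ℂ → ℂ} (hg : DifferentiableOn ℂ g uDisc)
    (h1 : ∀ z ∈ uDisc, ‖g z‖ ≤ 1) {z : ℂ} (hz : ‖z‖ ≤ 1 / 2) : ‖deriv g z‖ ≤ 4 := by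
  have hsub : closedBall z (1 / 4) ⊆ uDisc := by
    intro w hw
    rw [mem_closedBall, dist_eq_norm] at hw
    rw [uDisc, mem_ball_zero_iff]
    have := norm_le_norm_add_norm_sub' w z
    linarith
  have h2 := Complex.norm_deriv_le_of_forall_mem_sphere_norm_le (R := 1 / 4) (C := 1) (c := z)
    (f := g) (by norm_num) ((hg.mono (by
      rw [closure_ball _ (by norm_num)]; exact hsub)).diffContOnCl) (fun w hw =>
        h1 w (hsub (sphere_subset_closedBall hw)))
  norm_num at h2
  exact h2

/-- Growth estimates for the derivative of `f^ρ f_Γ^N`. -/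
lemma product_deriv_growth {α ρ η : ℝ} {N : ℕ} (hα0 : 0 < α) (hα1 : α ≤ 1 / 2) (hη0 : 0 < η)
    (hη1 : η ≤ 1) (hρ : 1 + η ≤ ρ) {f g : ℂ → ℂ} (hfA : MemA α f) (hf : IsOuter f)
    (hn : ANorm α f ≤ 1) (hgap : ∀ θ, ∃ p ∈ zeroAngles f, |p - θ| ≤ 1 / 2)
    {Γ : Set ℂ} (hΓ : IsArcUnion f Γ)
    (hgdef : g = fun z => outerPow f ρ z * (outerPart f Γ z) ^ N) :
    DifferentiableOn ℂ g uDisc ∧ (∀ z ∈ uDisc, ‖g z‖ ≤ 1) ∧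
    (∀ z ∈ uDisc, ‖deriv g z‖ ≤
      (ρ + N + N * (288 * Real.pi / η) * (2 * (2 / α + 1)) + 4) * (1 - ‖z‖) ^ (α - 1)) ∧
    ∀ ε > 0, ∃ B, 0 ≤ B ∧ ∀ z ∈ uDisc, ‖deriv g z‖ ≤ ε * (1 - ‖z‖) ^ (α - 1) + B := by
  obtain ⟨h1, h2, -⟩ := bounds_of_ANorm_le_one hα0 (by linarith) hfA hn
  obtain ⟨p0, hp0, -⟩ := hgap 0
  have hne : (zeroAngles f).Nonempty := ⟨p0, hp0⟩
  have hm := hΓ.measurableSet_angSet hf.1.2 hne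
  have hρ1 : 1 ≤ ρ := by linarith
  have hpi := Real.pi_pos
  have hdiff : DifferentiableOn ℂ g uDisc := fun z hz => by
    rw [hgdef]
    exact (outer_product_bounds hf h1 hm hρ1 N hz).1.differentiableWithinAt
  have hg1 : ∀ z ∈ uDisc, ‖g z‖ ≤ 1 := fun z hz => by
    rw [hgdef]
    exact (outer_product_bounds hf h1 hm hρ1 N hz).2.1.trans
      (Real.rpow_le_one (norm_nonneg _) (h1 z (ball_subset_closedBall hz)) (by linarith))
  set X := N * (288 * Real.pi / η) with hX
  have hX0 : 0 ≤ X := by positivity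
  have key : ∀ z ∈ uDisc, 1 - ‖z‖ ≤ 1 / 2 → ∃ T, 1 - ‖z‖ ≤ T ∧ ∃ w ∈ closedBall (0 : ℂ) 1,
      ‖z - w‖ ≤ 2 * T ∧ ‖deriv g z‖ ≤ (ρ + N) * ‖deriv f z‖ + X * (‖f z - f w‖ / T) := by
    intro z hz hzs
    obtain ⟨θ, -, hθ⟩ := exists_eq_radialPt z
    have hs0 : 0 < 1 - ‖z‖ := by
      rw [uDisc, mem_ball_zero_iff] at hz; linarith
    set s := 1 - ‖z‖ with hs
    obtain ⟨A, a, -, ha1, ha2⟩ := radial_estimates hf h1 hne hΓ hρ1 N θ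
    obtain ⟨p, hp, hd⟩ := exists_gap_eq hf.1.2 hne θ
    obtain ⟨q, hq, hq2⟩ := hgap θ
    have hd2 : gap f θ ≤ 1 / 2 := (gap_le f hq θ).trans (by rwa [abs_sub_comm])
    obtain ⟨T, hsT, w, hw, hzw, hfw, hT⟩ := exists_comparison_point hf h1 hp hd hd2
      (fun s h3 h4 => ⟨(ha1 s h3 h4).1, (ha1 s h3 h4).2.1⟩) ha2 hη0 hη1 hρ hs0 hzs
    have hT0 : 0 < T := hs0.trans_le hsT
    have hder := (ha1 s hs0 (by linarith)).2.2
    rw [← hgdef, ← hθ] at hder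
    rw [← hθ] at hzw hfw hT
    refine ⟨T, hsT, w, hw, hzw, hder.trans ?_⟩
    have h5 : N * ‖f z‖ ^ ρ * a s ≤ X * (‖f z - f w‖ / T) := by
      calc N * ‖f z‖ ^ ρ * a s = N * (‖f z‖ ^ ρ * a s) := by ring
        _ ≤ N * (144 * Real.pi / η * (‖f z‖ / T)) := by gcongr
        _ ≤ N * (144 * Real.pi / η * (2 * ‖f z - f w‖ / T)) := by gcongr
        _ = _ := by rw [hX]; ring
    linarith
  have hTpow : ∀ {s T : ℝ}, 0 < s → s ≤ T → ∀ {w z : ℂ} {C : ℝ}, 0 ≤ C → ‖z - w‖ ≤ 2 * T →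
      ‖f z - f w‖ ≤ C * ‖z - w‖ ^ α → ‖f z - f w‖ / T ≤ 2 * C * s ^ (α - 1) := by
    intro s T hs hsT w z C hC hzw hfzw
    have hT0 : 0 < T := hs.trans_le hsT
    rw [div_le_iff₀ hT0]
    have h3 : ‖z - w‖ ^ α ≤ 2 * T ^ α := by
      calc ‖z - w‖ ^ α ≤ (2 * T) ^ α := by gcongr
        _ = 2 ^ α * T ^ α := Real.mul_rpow (by norm_num) hT0.le
        _ ≤ 2 ^ (1 : ℝ) * T ^ α := by
            gcongr
            · norm_num
            · linarith
        _ = _ := by rw [Real.rpow_one]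
    have h4 : T ^ α = T ^ (α - 1) * T := by
      rw [Real.rpow_sub_one hT0.ne']; field_simp
    have h5 : T ^ (α - 1) ≤ s ^ (α - 1) :=
      Real.rpow_le_rpow_of_nonpos hs hsT (by linarith)
    calc ‖f z - f w‖ ≤ C * (2 * T ^ α) := hfzw.trans (by gcongr)
      _ = 2 * C * T ^ (α - 1) * T := by rw [h4]; ring
      _ ≤ _ := by gcongr
  have hspow : ∀ z ∈ uDisc, 0 < 1 - ‖z‖ ∧ 1 ≤ (1 - ‖z‖) ^ (α - 1) := by
    intro z hz
    rw [uDisc, mem_ball_zero_iff] at hz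
    refine ⟨by linarith, Real.one_le_rpow_of_pos_of_le_one_of_nonpos (by linarith)
      (by linarith [norm_nonneg z]) (by linarith)⟩
  refine ⟨hdiff, hg1, ?_, ?_⟩
  · intro z hz
    obtain ⟨hs0, hs1⟩ := hspow z hz
    have hK : 0 ≤ ρ + N + X * (2 * (2 / α + 1)) := by positivity
    rcases le_or_gt (1 - ‖z‖) (1 / 2) with hzs | hzs
    · obtain ⟨T, hsT, w, hw, hzw, hd⟩ := key z hz hzs
      have h3 := norm_sub_le_of_deriv_growth_closed hf.1 hα0 (by linarith) (ε := 1) (B := 0)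
        (by norm_num) le_rfl (fun z hz => by rw [add_zero]; exact h2 z hz)
        (ball_subset_closedBall hz) hw
      have h4 := hTpow hs0 hsT (C := 2 / α + 1) (by positivity) hzw (by linarith)
      calc ‖deriv g z‖ ≤ _ := hd
        _ ≤ (ρ + N) * (1 * (1 - ‖z‖) ^ (α - 1)) +
            X * (2 * (2 / α + 1) * (1 - ‖z‖) ^ (α - 1)) := by
            gcongr; exact h2 z hz
        _ = (ρ + N + X * (2 * (2 / α + 1))) * (1 - ‖z‖) ^ (α - 1) := by ring
        _ ≤ _ := mul_le_mul_of_nonneg_right (by linarith) (by positivity)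
    · calc ‖deriv g z‖ ≤ 4 := norm_deriv_le_of_norm_le_half hdiff hg1 (by linarith)
        _ = 4 * 1 := by ring
        _ ≤ _ := by gcongr; linarith
  · intro ε hε
    have hρN : 0 < ρ + N := by positivity
    obtain ⟨B, hB0, hB⟩ := deriv_growth_of_memLip hfA.2 hα0 (ε := ε / (2 * (ρ + N))) (by positivity)
    obtain ⟨δ, hδ0, hδ⟩ := hfA.2.2 (ε / (4 * (X + 1))) (by positivity)
    refine ⟨(ρ + N) * B + X * (4 / δ) + 4, by positivity, fun z hz => ?_⟩
    obtain ⟨hs0, hs1⟩ := hspow z hz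
    rcases le_or_gt (1 - ‖z‖) (1 / 2) with hzs | hzs
    · obtain ⟨T, hsT, w, hw, hzw, hd⟩ := key z hz hzs
      have hT0 : 0 < T := hs0.trans_le hsT
      have h3 : X * (‖f z - f w‖ / T) ≤ ε / 2 * (1 - ‖z‖) ^ (α - 1) + X * (4 / δ) := by
        rcases lt_or_ge (2 * T) δ with hTδ | hTδ
        · have h4 := hTpow hs0 hsT (C := ε / (4 * (X + 1))) (by positivity) hzw
            (hδ z (ball_subset_closedBall hz) w hw (hzw.trans_lt hTδ))
          calc X * (‖f z - f w‖ / T) ≤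
              (X + 1) * (2 * (ε / (4 * (X + 1))) * (1 - ‖z‖) ^ (α - 1)) := by
                gcongr; linarith
            _ = ε / 2 * (1 - ‖z‖) ^ (α - 1) := by field_simp; norm_num
            _ ≤ _ := le_add_of_nonneg_right (by positivity)
        · have h4 : ‖f z - f w‖ ≤ 2 := by
            have := norm_sub_le (f z) (f w)
            linarith [h1 z (ball_subset_closedBall hz), h1 w hw]
          have h5 : ‖f z - f w‖ / T ≤ 4 / δ := by
            rw [div_le_div_iff₀ hT0 hδ0]
            nlinarith
          have h6 : 0 ≤ ε / 2 * (1 - ‖z‖) ^ (α - 1) := by positivity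
          calc _ ≤ X * (4 / δ) := by gcongr
            _ ≤ _ := by linarith
      have h7 : (ρ + N) * ‖deriv f z‖ ≤ ε / 2 * (1 - ‖z‖) ^ (α - 1) + (ρ + N) * B := by
        calc _ ≤ (ρ + N) * (ε / (2 * (ρ + N)) * (1 - ‖z‖) ^ (α - 1) + B) := by
              gcongr; exact hB z hz
          _ = _ := by field_simp
      linarith
    · have h3 := norm_deriv_le_of_norm_le_half hdiff hg1 (z := z) (by linarith)
      have h4 : 0 ≤ ε * (1 - ‖z‖) ^ (α - 1) := by positivity
      have h5 : 0 ≤ (ρ + N) * B + X * (4 / δ) := by positivity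
      linarith

lemma lintegral_ofReal_eq_intervalIntegral {u : ℝ → ℝ} {x y : ℝ} (hxy : x ≤ y)
    (hu : IntervalIntegrable u volume x y) (h0 : ∀ s ∈ Ioc x y, 0 ≤ u s) :
    ∫⁻ s in Ioc x y, ENNReal.ofReal (u s) = ENNReal.ofReal (∫ s in x..y, u s) := by
  rw [intervalIntegral.integral_of_le hxy, ofReal_integral_eq_lintegral_ofReal]
  · exact (intervalIntegrable_iff_integrableOn_Ioc_of_le hxy).1 hu
  · exact (ae_restrict_iff' measurableSet_Ioc).2 (Filter.Eventually.of_forall h0)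

lemma lintegral_rpow_sub_one_le {ε b : ℝ} (hε : 0 < ε) (hb0 : 0 ≤ b) (hb1 : b ≤ 1) :
    ∫⁻ s in Ioc 0 b, ENNReal.ofReal (s ^ (ε - 1)) ≤ ENNReal.ofReal (1 / ε) := by
  rw [lintegral_ofReal_eq_intervalIntegral hb0
    (intervalIntegral.intervalIntegrable_rpow' (by linarith))
    (fun s hs => Real.rpow_nonneg hs.1.le _), integral_rpow (Or.inl (by linarith))]
  apply ENNReal.ofReal_le_ofReal
  rw [sub_add_cancel, Real.zero_rpow hε.ne', sub_zero]
  gcongr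
  exact Real.rpow_le_one hb0 hb1 hε.le

lemma lintegral_rpow_sub_two_le {ε d b : ℝ} (hε : ε ≤ 1 / 2) (hd : 0 < d) (hdb : d ≤ b) :
    ∫⁻ s in Ioc d b, ENNReal.ofReal (s ^ (ε - 2)) ≤ ENNReal.ofReal (2 * d ^ (ε - 1)) := by
  have h0 : (0 : ℝ) ∉ uIcc d b := by
    rw [uIcc_of_le hdb]; exact fun h => absurd h.1 (not_le.2 hd)
  rw [lintegral_ofReal_eq_intervalIntegral hdb
    (intervalIntegral.intervalIntegrable_rpow (Or.inr h0))
    (fun s hs => Real.rpow_nonneg (hd.trans hs.1).le _),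
    integral_rpow (Or.inr ⟨by linarith, h0⟩)]
  apply ENNReal.ofReal_le_ofReal
  have e : ε - 2 + 1 = ε - 1 := by ring
  rw [e, ← neg_div_neg_eq, div_le_iff₀ (by linarith)]
  have h1 : 0 ≤ b ^ (ε - 1) := Real.rpow_nonneg (hd.le.trans hdb) _
  have h2 : 0 ≤ d ^ (ε - 1) := Real.rpow_nonneg hd.le _
  nlinarith

lemma lintegral_exp_neg_le {k b : ℝ} (hk : 0 < k) (hb : 0 ≤ b) :
    ∫⁻ s in Ioc 0 b, ENNReal.ofReal (Real.exp (-(k * s))) ≤ ENNReal.ofReal (1 / k) := by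
  rw [lintegral_ofReal_eq_intervalIntegral hb
    (Continuous.intervalIntegrable (by fun_prop) _ _) (fun s _ => (Real.exp_pos _).le)]
  apply ENNReal.ofReal_le_ofReal
  have h : ∀ s ∈ uIcc 0 b, HasDerivAt (fun s => -(Real.exp (-(k * s)) / k))
      (Real.exp (-(k * s))) s := by
    intro s _
    have h1 := ((((hasDerivAt_id s).const_mul k).neg.exp).div_const k).neg
    simp only [id_eq, mul_one] at h1
    refine h1.congr_deriv ?_
    simp only [Pi.neg_apply]
    rw [mul_neg, neg_div, neg_neg, mul_div_cancel_right₀ _ hk.ne']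
  rw [intervalIntegral.integral_eq_sub_of_hasDerivAt h
    (Continuous.intervalIntegrable (by fun_prop) _ _)]
  have : 0 ≤ Real.exp (-(k * b)) / k := by positivity
  simp only [mul_zero, neg_zero, Real.exp_zero]
  linarith

lemma sq_le_of_sub_sq_le {x y e : ℝ} (h : (x - y) ^ 2 ≤ e) : x ^ 2 ≤ 2 * y ^ 2 + 2 * e := by
  nlinarith [sq_nonneg (x - 2 * y)]

/-- Energy bound along the part of a radius at depth at least `d`. -/
lemma radial_energy_far {α η K : ℝ} (hα0 : 0 < α) (hα1 : α ≤ 1 / 2) (hη0 : 0 < η)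
    (hη1 : η ≤ 1) (hK : 0 ≤ K) {F a : ℝ → ℝ} {d e κ ρ : ℝ} (hρ : 1 + η ≤ ρ) (hd0 : 0 ≤ d)
    (hd1 : d ≤ 1 / 2) (he : 0 ≤ e) (hκ0 : 0 ≤ κ) (hκ1 : κ ≤ 1)
    (hF : ∀ s, 0 < s → s ≤ 1 / 2 → 0 < F s ∧ F s ≤ 1)
    (ha : ∀ s, 0 < s → s ≤ 1 / 2 → 0 ≤ a s ∧ F s ≤ Real.exp (-(s / (2 * Real.pi) * a s)))
    (hFs : ∀ s ∈ Icc (0 : ℝ) (1 / 2), ∀ t ∈ Icc (0 : ℝ) (1 / 2), (F s - F t) ^ 2 ≤ |s - t| * e)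
    (hFα : ∀ s, 0 < s → s ≤ 1 / 2 → d ≤ s → F s ≤ K * s ^ α)
    (hF0 : d = 0 → F 0 = 0) :
    ∫⁻ s in Ioc d (1 / 2), ENNReal.ofReal ((F s ^ ρ * a s) ^ 2) ≤
      ENNReal.ofReal ((4 * Real.pi / η) ^ 2 * K ^ η * (4 / (α * η) + 4) *
        (e + F (κ * d) ^ 2 * d ^ (α * η / 2 - 1))) := by
  have hpi := Real.pi_pos
  set ε := α * η / 2 with hε
  have hε0 : 0 < ε := by positivity
  have hε1 : ε ≤ 1 / 2 := by rw [hε]; nlinarith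
  set H := F (κ * d) with hH
  set K1 := (4 * Real.pi / η) ^ 2 * K ^ η with hK1
  have hK10 : 0 ≤ K1 := by positivity
  have hκd : κ * d ≤ d := by nlinarith
  have hκd0 : 0 ≤ κ * d := by positivity
  have hpt : ∀ s ∈ Ioc d (1 / 2), ENNReal.ofReal ((F s ^ ρ * a s) ^ 2) ≤
      ENNReal.ofReal (2 * K1 * H ^ 2) * ENNReal.ofReal (s ^ (ε - 2)) +
        ENNReal.ofReal (2 * K1 * e) * ENNReal.ofReal (s ^ (ε - 1)) := by
    intro s hs
    have hs0 : 0 < s := hd0.trans_lt hs.1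
    obtain ⟨hF0, hF1⟩ := hF s hs0 hs.2
    obtain ⟨ha0, hFe⟩ := ha s hs0 hs.2
    have h1 := exp_neg_rpow_mul_le hF0.le (k := s / (2 * Real.pi)) (by positivity)
      (half_pos hη0) ha0 hFe
    have h1' : F s ^ (η / 2) * a s ≤ 4 * Real.pi / η / s := by
      refine h1.trans_eq ?_
      field_simp
      norm_num
    have h2 : F s ^ ρ * a s ≤ F s * (F s ^ (η / 2) * (4 * Real.pi / η / s)) := by
      calc F s ^ ρ * a s ≤ F s * F s ^ η * a s := by
            gcongr; exact rpow_le_mul_rpow hF0 hF1 hρ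
        _ = F s * (F s ^ (η / 2) * (F s ^ (η / 2) * a s)) := by
            rw [← mul_assoc (F s ^ (η / 2)), ← Real.rpow_add hF0, add_halves, mul_assoc]
        _ ≤ _ := by gcongr
    have h3 : F s ^ η ≤ K ^ η * s ^ ε := by
      calc F s ^ η ≤ (K * s ^ α) ^ η := by
            gcongr; exact hFα s hs0 hs.2 hs.1.le
        _ = K ^ η * s ^ (α * η) := by
            rw [Real.mul_rpow hK (by positivity), ← Real.rpow_mul hs0.le]
        _ ≤ K ^ η * s ^ ε := by
            gcongr 1
            exact Real.rpow_le_rpow_of_exponent_ge hs0 (by linarith [hs.2]) (by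
              have : 0 < α * η := by positivity
              rw [hε]; linarith)
    have h4 : F s ^ 2 ≤ 2 * H ^ 2 + 2 * (s * e) := by
      refine (sq_le_of_sub_sq_le (hFs s ⟨hs0.le, hs.2⟩ (κ * d)
        ⟨hκd0, by linarith⟩)).trans ?_
      gcongr
      rw [abs_of_nonneg (by linarith [hs.1])]
      linarith
    have e1 : s ^ (ε - 1) = s * s ^ (ε - 2) := by
      rw [show ε - 2 = ε - 1 - 1 by ring, Real.rpow_sub_one hs0.ne' (ε - 1)]
      field_simp
    have e2 : s ^ (ε - 2) = s ^ ε / s ^ 2 := by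
      rw [Real.rpow_sub hs0]; norm_num
    rw [← ENNReal.ofReal_mul (by positivity), ← ENNReal.ofReal_mul (by positivity),
      ← ENNReal.ofReal_add (by positivity) (by positivity)]
    apply ENNReal.ofReal_le_ofReal
    calc (F s ^ ρ * a s) ^ 2 ≤ (F s * (F s ^ (η / 2) * (4 * Real.pi / η / s))) ^ 2 := by gcongr
      _ = F s ^ 2 * F s ^ η * ((4 * Real.pi / η) ^ 2 / s ^ 2) := by
          have : F s ^ η = F s ^ (η / 2) * F s ^ (η / 2) := by
            rw [← Real.rpow_add hF0, add_halves]
          rw [this]; ring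
      _ ≤ (2 * H ^ 2 + 2 * (s * e)) * (K ^ η * s ^ ε) * ((4 * Real.pi / η) ^ 2 / s ^ 2) := by
          gcongr
      _ = _ := by rw [e1, e2, hK1]; ring
  refine (setLIntegral_mono' measurableSet_Ioc hpt).trans ?_
  rw [lintegral_add_right _ (by fun_prop), lintegral_const_mul _ (by fun_prop),
    lintegral_const_mul _ (by fun_prop)]
  have b2 : ∫⁻ s in Ioc d (1 / 2), ENNReal.ofReal (s ^ (ε - 1)) ≤ ENNReal.ofReal (1 / ε) :=
    (lintegral_mono_set (Ioc_subset_Ioc_left hd0)).trans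
      (lintegral_rpow_sub_one_le hε0 (by norm_num) (by norm_num))
  have b1 : ENNReal.ofReal (2 * K1 * H ^ 2) * ∫⁻ s in Ioc d (1 / 2), ENNReal.ofReal (s ^ (ε - 2)) ≤
      ENNReal.ofReal (2 * K1 * H ^ 2) * ENNReal.ofReal (2 * d ^ (ε - 1)) := by
    rcases hd0.eq_or_lt with h | h
    · have : H = 0 := by rw [hH, ← h, mul_zero]; exact hF0 h.symm
      simp [this]
    · gcongr
      exact lintegral_rpow_sub_two_le hε1 h hd1
  refine (add_le_add b1 (mul_le_mul_right b2 _)).trans ?_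
  have hdε : 0 ≤ d ^ (ε - 1) := Real.rpow_nonneg hd0 _
  rw [← ENNReal.ofReal_mul (by positivity), ← ENNReal.ofReal_mul (by positivity),
    ← ENNReal.ofReal_add (by positivity) (by positivity)]
  apply ENNReal.ofReal_le_ofReal
  have e3 : 4 / (α * η) = 2 * (1 / ε) := by rw [hε]; field_simp; norm_num
  rw [e3]
  have t1 : 0 ≤ K1 * (2 * (1 / ε)) * (H ^ 2 * d ^ (ε - 1)) := by positivity
  have t2 : 0 ≤ K1 * e := by positivity
  nlinarith

/-- Energy bound along the part of a radius at depth at most `d`. -/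
lemma radial_energy_near {α η K : ℝ} (hα0 : 0 < α) (hη0 : 0 < η)
    (hη1 : η ≤ 1) (hK : 0 ≤ K) {F a : ℝ → ℝ} {A d e κ ρ : ℝ} (hρ : 1 + η ≤ ρ) (hd0 : 0 < d)
    (hd1 : d ≤ 1 / 2) (he : 0 ≤ e) (hκ0 : 0 ≤ κ) (hκ1 : κ ≤ 1) (hA : 0 ≤ A)
    (hF : ∀ s, 0 < s → s ≤ 1 / 2 → 0 < F s ∧ F s ≤ 1) (hF00 : F 0 ≤ 1)
    (ha0 : ∀ s, 0 < s → s ≤ 1 / 2 → 0 ≤ a s)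
    (ha : ∀ s, 0 < s → s ≤ d → a s ≤ 4 * A ∧ F s ≤ Real.exp (-(s / (18 * Real.pi) * A)))
    (hFs : ∀ s ∈ Icc (0 : ℝ) (1 / 2), ∀ t ∈ Icc (0 : ℝ) (1 / 2), (F s - F t) ^ 2 ≤ |s - t| * e)
    (hFc : ContinuousOn F (Icc 0 d))
    (hFα : ∀ s, 0 ≤ s → s ≤ d → F s ≤ K * d ^ α) :
    ∫⁻ s in Ioc 0 d, ENNReal.ofReal ((F s ^ ρ * a s) ^ 2) ≤
      ENNReal.ofReal (16 * (18 * Real.pi) ^ 2 / η * (8 / η + 8 * K ^ (η / 2) / η) *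
        (e + F (κ * d) ^ 2 * d ^ (α * η / 2 - 1))) := by
  have hpi := Real.pi_pos
  set ε := α * η / 2 with hε
  have hε0 : 0 < ε := by positivity
  set c := 18 * Real.pi with hc
  have hc0 : 0 < c := by positivity
  set H := F (κ * d) with hH
  have hκd : κ * d ≤ d := by nlinarith
  have hκd0 : 0 ≤ κ * d := by positivity
  have hdε : 0 ≤ d ^ (ε - 1) := Real.rpow_nonneg hd0.le _
  rcases hA.eq_or_lt with hA0 | hA0
  · have : ∀ s ∈ Ioc 0 d, ENNReal.ofReal ((F s ^ ρ * a s) ^ 2) ≤ 0 := by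
      intro s hs
      have h1 := (ha s hs.1 hs.2).1
      have h2 := ha0 s hs.1 (hs.2.trans hd1)
      have h3 : a s = 0 := by rw [← hA0] at h1; linarith
      simp [h3]
    refine (setLIntegral_mono' measurableSet_Ioc this).trans ?_
    simp
  obtain ⟨s0, hs0, hmax⟩ := isCompact_Icc.exists_isMaxOn (nonempty_Icc.2 hd0.le) hFc
  set M := F s0 with hM
  have hM' : ∀ s ∈ Icc 0 d, F s ≤ M := fun s hs => hmax hs
  have hM0 : 0 < M := (hF d hd0 hd1).1.trans_le (hM' d ⟨hd0.le, le_rfl⟩)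
  have hM1 : M ≤ 1 := by
    rcases hs0.1.eq_or_lt with h | h
    · rw [hM, ← h]; exact hF00
    · exact (hF s0 h (hs0.2.trans hd1)).2
  have hMe : M ≤ Real.exp (-(s0 / c * A)) := by
    rcases hs0.1.eq_or_lt with h | h
    · rw [← h]; simpa using hM1
    · exact (ha s0 h hs0.2).2
  have hlog := rpow_mul_log_two_div_le hM0 hη0 hη1
  have hlog0 : 0 < Real.log (2 / M) := Real.log_pos (by rw [lt_div_iff₀ hM0]; linarith)
  have hAM : A * M ^ 2 * M ^ η ≤
      c * (8 / η + 8 * K ^ (η / 2) / η) * (e + H ^ 2 * d ^ (ε - 1)) := by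
    rcases le_or_gt (Real.log (2 / M) * c / A) d with h | h
    · set ℓ := Real.log (2 / M) * c / A with hℓ
      have hℓ0 : 0 < ℓ := by positivity
      have e1 : ℓ / c * A = Real.log (2 / M) := by rw [hℓ]; field_simp
      have h4 := (ha ℓ hℓ0 h).2
      rw [e1, Real.exp_neg, Real.exp_log (by positivity), inv_div] at h4
      have h5 : s0 ≤ ℓ := by
        have h6 := Real.log_le_log hM0 hMe
        rw [Real.log_exp] at h6
        have h7 : Real.log (2 / M) = Real.log 2 - Real.log M := Real.log_div two_ne_zero hM0.ne'
        have hlog2 : 0 < Real.log 2 := Real.log_pos (by norm_num)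
        rw [hℓ, le_div_iff₀ hA0]
        calc s0 * A = s0 / c * A * c := by field_simp
          _ ≤ _ := by gcongr; linarith
      have h6 := hFs s0 ⟨hs0.1, hs0.2.trans hd1⟩ ℓ ⟨hℓ0.le, h.trans hd1⟩
      have h7 : M ^ 2 ≤ 4 * ℓ * e := by
        have h8 : (M / 2) ^ 2 ≤ (M - F ℓ) ^ 2 := by
          apply pow_le_pow_left₀ (by positivity); linarith
        have h9 : |s0 - ℓ| * e ≤ ℓ * e := by
          gcongr
          rw [abs_le]; constructor <;> linarith [hs0.1]
        rw [← hM] at h6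
        nlinarith
      have h8 : A = Real.log (2 / M) * c / ℓ := by
        rw [hℓ]; field_simp
      have h9 : 0 ≤ 8 * K ^ (η / 2) / η := by positivity
      have h10 : 0 ≤ H ^ 2 * d ^ (ε - 1) := by positivity
      calc A * M ^ 2 * M ^ η = c / ℓ * M ^ 2 * (M ^ η * Real.log (2 / M)) := by
            rw [h8]; ring
        _ ≤ c / ℓ * (4 * ℓ * e) * (2 / η) := by gcongr
        _ = c * (8 / η) * e := by field_simp; ring
        _ ≤ _ := by gcongr <;> linarith
    · have h1 : A ≤ Real.log (2 / M) * c / d := by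
        rw [lt_div_iff₀ hA0] at h
        rw [le_div_iff₀ hd0]; linarith
      have h2 := rpow_mul_log_two_div_le hM0 (half_pos hη0) (by linarith)
      have h3 : M ^ (η / 2) ≤ K ^ (η / 2) * d ^ ε := by
        calc M ^ (η / 2) ≤ (K * d ^ α) ^ (η / 2) := by
              gcongr; exact hFα s0 hs0.1 hs0.2
          _ = _ := by
              rw [Real.mul_rpow hK (by positivity), ← Real.rpow_mul hd0.le, hε, mul_div_assoc]
      have h4 : M ^ 2 ≤ 2 * H ^ 2 + 2 * (d * e) := by
        refine (sq_le_of_sub_sq_le (hFs s0 ⟨hs0.1, hs0.2.trans hd1⟩ (κ * d)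
          ⟨hκd0, by linarith⟩)).trans ?_
        gcongr
        rw [abs_le]; constructor <;> linarith [hs0.1, hs0.2]
      have e1 : d ^ (ε - 1) = d ^ ε / d := Real.rpow_sub_one hd0.ne' _
      have h5 : d ^ ε ≤ 1 := Real.rpow_le_one hd0.le (by linarith) hε0.le
      have h6 : M ^ η = M ^ (η / 2) * M ^ (η / 2) := by rw [← Real.rpow_add hM0, add_halves]
      have h7 : 2 / (η / 2) = 4 / η := by field_simp; norm_num
      rw [h7] at h2
      have h8 : 0 ≤ 8 / η := by positivity
      calc A * M ^ 2 * M ^ η ≤ Real.log (2 / M) * c / d * M ^ 2 * M ^ η := by gcongr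
        _ = c / d * M ^ 2 * (M ^ (η / 2) * Real.log (2 / M)) * M ^ (η / 2) := by
            rw [h6]; ring
        _ ≤ c / d * (2 * H ^ 2 + 2 * (d * e)) * (4 / η) * (K ^ (η / 2) * d ^ ε) := by gcongr
        _ = c * (8 * K ^ (η / 2) / η) * (d ^ ε * e + H ^ 2 * d ^ (ε - 1)) := by
            rw [e1]; field_simp; ring
        _ ≤ c * (8 * K ^ (η / 2) / η) * (1 * e + H ^ 2 * d ^ (ε - 1)) := by gcongr
        _ ≤ _ := by
            rw [one_mul]
            gcongr
            linarith
  have hpt : ∀ s ∈ Ioc 0 d, ENNReal.ofReal ((F s ^ ρ * a s) ^ 2) ≤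
      ENNReal.ofReal (16 * A ^ 2 * (M ^ 2 * M ^ η)) *
        ENNReal.ofReal (Real.exp (-(η / c * A * s))) := by
    intro s hs
    have hs1 := hs.2.trans hd1
    obtain ⟨h1, h2⟩ := ha s hs.1 hs.2
    obtain ⟨h3, h4⟩ := hF s hs.1 hs1
    have h5 := hM' s ⟨hs.1.le, hs.2⟩
    have h6 := ha0 s hs.1 hs1
    rw [← ENNReal.ofReal_mul (by positivity)]
    apply ENNReal.ofReal_le_ofReal
    have h7 : F s ^ η ≤ Real.exp (-(η / c * A * s)) := by
      calc F s ^ η ≤ Real.exp (-(s / c * A)) ^ η := by gcongr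
        _ = _ := by rw [← Real.exp_mul]; ring_nf
    calc (F s ^ ρ * a s) ^ 2 ≤ (F s * F s ^ η * (4 * A)) ^ 2 := by
          gcongr; exact rpow_le_mul_rpow h3 h4 hρ
      _ = 16 * A ^ 2 * (F s ^ 2 * F s ^ η) * F s ^ η := by ring
      _ ≤ _ := by gcongr
  refine (setLIntegral_mono' measurableSet_Ioc hpt).trans ?_
  rw [lintegral_const_mul _ (by fun_prop)]
  refine (mul_le_mul_right (lintegral_exp_neg_le (k := η / c * A) (by positivity) hd0.le) _).trans ?_
  rw [← ENNReal.ofReal_mul (by positivity)]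
  apply ENNReal.ofReal_le_ofReal
  calc 16 * A ^ 2 * (M ^ 2 * M ^ η) * (1 / (η / c * A)) =
        16 * c / η * (A * M ^ 2 * M ^ η) := by field_simp
    _ ≤ 16 * c / η * (c * (8 / η + 8 * K ^ (η / 2) / η) * (e + H ^ 2 * d ^ (ε - 1))) := by
        gcongr
    _ = _ := by ring

/-- The part of the Dirichlet energy of `f` on the outer half of the radius at angle `θ`. -/
noncomputable def radialEnergy (f : ℂ → ℂ) (θ : ℝ) : ℝ≥0∞ :=
  ∫⁻ s in Ioc 0 (1 / 2 : ℝ), ‖deriv f (radialPt θ s)‖ₑ ^ 2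

/-- Energy density of `f` along the curve at distance `κ * gap f θ` from the circle. -/
noncomputable def gapEnergy (f : ℂ → ℂ) (κ θ : ℝ) : ℝ≥0∞ :=
  ‖deriv f (radialPt θ (κ * gap f θ))‖ₑ ^ 2 * ENNReal.ofReal (gap f θ)

/-- A truncated Riesz kernel. -/
noncomputable def rieszKernel (ε x : ℝ) : ℝ≥0∞ :=
  (Icc (-(1 / 2) : ℝ) (1 / 2)).indicator (fun x => ENNReal.ofReal (|x| ^ (ε - 1))) x

lemma continuous_radialPt : Continuous (fun q : ℝ × ℝ => radialPt q.1 q.2) := by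
  unfold radialPt
  fun_prop

lemma hasDerivAt_radialPt_line (p σ κ t : ℝ) :
    HasDerivAt (fun t => radialPt (p + σ * t) (κ * t))
      ((((1 - κ * t : ℝ) : ℂ) * ((σ : ℂ) * Complex.I) - (κ : ℂ)) *
        Complex.exp (((p + σ * t : ℝ) : ℂ) * Complex.I)) t := by
  have h1 : HasDerivAt (fun t : ℝ => ((1 - κ * t : ℝ) : ℂ)) (-(κ : ℂ)) t := by
    have : HasDerivAt (fun t : ℝ => 1 - κ * t) (-κ) t := by
      simpa using ((hasDerivAt_id t).const_mul κ).const_sub 1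
    simpa using this.ofReal_comp
  have h2 : HasDerivAt (fun t : ℝ => ((p + σ * t : ℝ) : ℂ) * Complex.I) ((σ : ℂ) * Complex.I) t := by
    have : HasDerivAt (fun t : ℝ => p + σ * t) σ t := by
      simpa using ((hasDerivAt_id t).const_mul σ).const_add p
    exact this.ofReal_comp.mul_const _
  refine (h1.mul h2.cexp).congr_deriv ?_
  ring

lemma enorm_sub_le_lintegral_path {f : ℂ → ℂ} (hf : DifferentiableOn ℂ f uDisc) {γ γ' : ℝ → ℂ}
    {s t L : ℝ} (hst : s ≤ t)
    (hγ : ∀ r ∈ Icc s t, HasDerivAt γ (γ' r) r ∧ γ r ∈ uDisc ∧ ‖γ' r‖ ≤ L)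
    (hγ' : Continuous γ') :
    ‖f (γ t) - f (γ s)‖ₑ ≤ ENNReal.ofReal L * ∫⁻ r in Ioo s t, ‖deriv f (γ r)‖ₑ := by
  have hder : ∀ r ∈ uIcc s t, HasDerivAt (fun r => f (γ r)) (γ' r * deriv f (γ r)) r := by
    intro r hr
    rw [uIcc_of_le hst] at hr
    obtain ⟨h1, h2, -⟩ := hγ r hr
    have h3 := ((hf.differentiableAt (isOpen_ball.mem_nhds h2)).hasDerivAt).scomp r h1
    exact h3
  have hcont : ContinuousOn (fun r => γ' r * deriv f (γ r)) (uIcc s t) := by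
    refine hγ'.continuousOn.mul ?_
    have hd : ContinuousOn (deriv f) uDisc := (hf.deriv isOpen_ball).continuousOn
    refine hd.comp (fun r hr => ?_) (fun r hr => ?_)
    · rw [uIcc_of_le hst] at hr
      exact (hγ r hr).1.continuousAt.continuousWithinAt
    · rw [uIcc_of_le hst] at hr
      exact (hγ r hr).2.1
  rw [← intervalIntegral.integral_eq_sub_of_hasDerivAt hder hcont.intervalIntegrable,
    intervalIntegral.integral_of_le hst, integral_Ioc_eq_integral_Ioo,
    ← lintegral_const_mul' _ _ ENNReal.ofReal_ne_top]
  refine (enorm_integral_le_lintegral_enorm _).trans (setLIntegral_mono' measurableSet_Ioo ?_)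
  intro r hr
  rw [enorm_mul]
  gcongr
  rw [← ofReal_norm]
  exact ENNReal.ofReal_le_ofReal (hγ r (Ioo_subset_Icc_self hr)).2.2

lemma lintegral_mul_sq_le {β : Type*} [MeasurableSpace β] {μ : Measure β} {u v : β → ℝ≥0∞}
    (hu : AEMeasurable u μ) (hv : AEMeasurable v μ) :
    (∫⁻ x, u x * v x ∂μ) ^ 2 ≤ (∫⁻ x, u x ^ 2 ∂μ) * ∫⁻ x, v x ^ 2 ∂μ := by
  have h := ENNReal.lintegral_mul_le_Lp_mul_Lq μ Real.HolderConjugate.two_two hu hv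
  simp only [Pi.mul_apply, ENNReal.rpow_two] at h
  calc _ ≤ ((∫⁻ x, u x ^ 2 ∂μ) ^ (1 / 2 : ℝ) * (∫⁻ x, v x ^ 2 ∂μ) ^ (1 / 2 : ℝ)) ^ 2 := by gcongr
    _ = _ := by
      rw [mul_pow, ← ENNReal.rpow_two, ← ENNReal.rpow_two, ← ENNReal.rpow_mul, ← ENNReal.rpow_mul]
      norm_num

lemma ENNReal.add_sq_le_four_mul (a b : ℝ≥0∞) : (a + b) ^ 2 ≤ 4 * a ^ 2 + 4 * b ^ 2 := by
  rcases le_total a b with h | h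
  · calc (a + b) ^ 2 ≤ (b + b) ^ 2 := by gcongr
      _ = 4 * b ^ 2 := by ring
      _ ≤ _ := le_add_self
  · calc (a + b) ^ 2 ≤ (a + a) ^ 2 := by gcongr
      _ = 4 * a ^ 2 := by ring
      _ ≤ _ := le_self_add

lemma measurable_enorm_deriv_comp (f : ℂ → ℂ) {β : Type*} [MeasurableSpace β] {γ : β → ℂ}
    (hγ : Measurable γ) : Measurable (fun x => ‖deriv f (γ x)‖ₑ) :=
  ((measurable_deriv f).comp hγ).enorm

lemma enorm_radial_sub_sq_le_of_pos {f : ℂ → ℂ} (hf : DifferentiableOn ℂ f uDisc) (θ : ℝ) {s t : ℝ}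
    (hs : 0 < s) (hst : s ≤ t) (ht : t ≤ 1 / 2) :
    ‖f (radialPt θ t) - f (radialPt θ s)‖ₑ ^ 2 ≤ ENNReal.ofReal (t - s) * radialEnergy f θ := by
  have h1 := enorm_sub_le_lintegral_path hf (γ := fun t => radialPt (θ + 0 * t) (1 * t)) (L := 1)
    hst (fun r hr => ⟨hasDerivAt_radialPt_line θ 0 1 r,
      radialPt_mem_uDisc _ (by linarith [hr.1]) (by linarith [hr.2]), by
        rw [norm_mul, norm_circle]; simp⟩) (by fun_prop)
  simp only [zero_mul, add_zero, one_mul, ENNReal.ofReal_one] at h1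
  have h2 := lintegral_mul_sq_le (μ := volume.restrict (Ioo s t)) (u := fun _ => 1)
    (v := fun r => ‖deriv f (radialPt θ r)‖ₑ) aemeasurable_const
    (measurable_enorm_deriv_comp f (by unfold radialPt; fun_prop)).aemeasurable
  simp only [one_mul, one_pow, lintegral_const, Measure.restrict_apply_univ, Real.volume_Ioo] at h2
  calc _ ≤ (∫⁻ r in Ioo s t, ‖deriv f (radialPt θ r)‖ₑ) ^ 2 := by gcongr
    _ ≤ _ := h2
    _ ≤ _ := by
      gcongr
      exact lintegral_mono_set fun r hr => ⟨by linarith [hr.1], by linarith [hr.2]⟩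

lemma continuousOn_radial {f : ℂ → ℂ} (hf : ContinuousOn f (closedBall 0 1)) (θ : ℝ) :
    ContinuousOn (fun s => f (radialPt θ s)) (Icc 0 1) := by
  refine hf.comp (Continuous.continuousOn (by unfold radialPt; fun_prop)) ?_
  exact fun s hs => radialPt_mem_closedBall θ hs.1 hs.2

lemma enorm_radial_sub_sq_le {f : ℂ → ℂ} (hf : IsDiscReg f) (θ : ℝ) {s t : ℝ}
    (hs : s ∈ Icc (0 : ℝ) (1 / 2)) (ht : t ∈ Icc (0 : ℝ) (1 / 2)) :
    ‖f (radialPt θ t) - f (radialPt θ s)‖ₑ ^ 2 ≤ ENNReal.ofReal |t - s| * radialEnergy f θ := by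
  wlog hst : s ≤ t generalizing s t
  · have := this ht hs (le_of_not_ge hst)
    rwa [enorm_sub_rev, abs_sub_comm]
  rw [abs_of_nonneg (by linarith)]
  rcases hs.1.eq_or_lt with h0 | h0
  · rcases ht.1.eq_or_lt with h1 | h1
    · rw [← h0, ← h1]; simp
    · have hc : Tendsto (fun r => ‖f (radialPt θ t) - f (radialPt θ r)‖ₑ ^ 2) (nhdsWithin s (Ioo s t))
          (nhds (‖f (radialPt θ t) - f (radialPt θ s)‖ₑ ^ 2)) := by
        have h2 : ContinuousWithinAt (fun s => f (radialPt θ s)) (Ioo s t) s :=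
          (continuousOn_radial hf.2 θ s ⟨hs.1, by linarith [hs.2]⟩).mono fun r hr =>
            ⟨by linarith [hr.1, hs.1], by linarith [hr.2, ht.2]⟩
        have h3 := (tendsto_const_nhds.sub h2.tendsto).enorm (a := f (radialPt θ t) - f (radialPt θ s))
        exact ((ENNReal.continuous_pow 2).tendsto _).comp h3
      have hne : (nhdsWithin s (Ioo s t)).NeBot := by
        rw [← mem_closure_iff_nhdsWithin_neBot, closure_Ioo (by linarith)]
        exact ⟨le_rfl, hst⟩
      refine le_of_tendsto hc ?_
      filter_upwards [self_mem_nhdsWithin] with r hr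
      refine (enorm_radial_sub_sq_le_of_pos hf.1 θ (by linarith [hr.1]) hr.2.le ht.2).trans ?_
      gcongr
      exact hr.1.le
  · exact enorm_radial_sub_sq_le_of_pos hf.1 θ h0 hst ht.2

lemma lintegral_sq_le_log_mul {u : ℝ → ℝ≥0∞} (hu : Measurable u) {τ d : ℝ} (hτ : 0 < τ)
    (hτd : τ ≤ d) : (∫⁻ t in Ioo τ d, u t) ^ 2 ≤
      ENNReal.ofReal (Real.log (d / τ)) * ∫⁻ t in Ioo τ d, u t ^ 2 * ENNReal.ofReal t := by
  have h := lintegral_mul_sq_le (μ := volume.restrict (Ioo τ d))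
    (u := fun t => ENNReal.ofReal (Real.sqrt t)⁻¹) (v := fun t => u t * ENNReal.ofReal (Real.sqrt t))
    (by fun_prop) (by fun_prop)
  have e1 : ∫⁻ t in Ioo τ d, ENNReal.ofReal (Real.sqrt t)⁻¹ * (u t * ENNReal.ofReal (Real.sqrt t)) =
      ∫⁻ t in Ioo τ d, u t := by
    refine setLIntegral_congr_fun measurableSet_Ioo fun t ht => ?_
    have ht0 : 0 < t := hτ.trans ht.1
    rw [mul_left_comm, ← ENNReal.ofReal_mul (by positivity),
      inv_mul_cancel₀ (Real.sqrt_ne_zero'.2 ht0), ENNReal.ofReal_one, mul_one]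
  have e2 : ∫⁻ t in Ioo τ d, (u t * ENNReal.ofReal (Real.sqrt t)) ^ 2 =
      ∫⁻ t in Ioo τ d, u t ^ 2 * ENNReal.ofReal t := by
    refine setLIntegral_congr_fun measurableSet_Ioo fun t ht => ?_
    have ht0 : 0 < t := hτ.trans ht.1
    rw [mul_pow, ← ENNReal.ofReal_pow (by positivity), Real.sq_sqrt ht0.le]
  have e3 : ∫⁻ t in Ioo τ d, ENNReal.ofReal (Real.sqrt t)⁻¹ ^ 2 =
      ENNReal.ofReal (Real.log (d / τ)) := by
    have h0 : (0 : ℝ) ∉ uIcc τ d := by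
      rw [uIcc_of_le hτd]; exact fun h => absurd h.1 (not_le.2 hτ)
    rw [← integral_inv h0, ← lintegral_ofReal_eq_intervalIntegral hτd
      (intervalIntegral.intervalIntegrable_inv (fun t ht h => h0 (h ▸ ht)) continuousOn_id)
      (fun s hs => inv_nonneg.2 (hτ.trans hs.1).le), setLIntegral_congr Ioo_ae_eq_Ioc.symm]
    refine setLIntegral_congr_fun measurableSet_Ioo fun t ht => ?_
    have ht0 : 0 < t := hτ.trans ht.1
    rw [← ENNReal.ofReal_pow (by positivity), inv_pow, Real.sq_sqrt ht0.le]
  rwa [e1, e2, e3] at h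

lemma lintegral_affine_sign (u : ℝ → ℝ≥0∞) (p : ℝ) {σ : ℝ} (hσ : σ = 1 ∨ σ = -1) :
    ∫⁻ t, u (p + σ * t) = ∫⁻ t, u t := by
  rcases hσ with rfl | rfl
  · simp only [one_mul]
    exact lintegral_add_left_eq_self u p
  · simp only [neg_one_mul, ← sub_eq_add_neg]
    exact lintegral_sub_left_eq_self u p

/-- The value of `f` at distance `κ * gap f θ` from the circle is controlled by the gap energy at
neighbouring angles. -/
lemma gap_value_bound {f : ℂ → ℂ} (hf : IsDiscReg f) {α ε L : ℝ} (hα0 : 0 < α) (hα1 : α ≤ 1 / 2)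
    (hε0 : 0 < ε) (hε1 : ε ≤ 1) (hL : 0 ≤ L)
    (hfL : ∀ z ∈ closedBall (0 : ℂ) 1, ∀ w ∈ closedBall (0 : ℂ) 1, ‖f z - f w‖ ≤ L * ‖z - w‖ ^ α)
    (hne : (zeroAngles f).Nonempty) {θ κ : ℝ} (hd1 : gap f θ ≤ 1 / 2) (hκ0 : 1 / 2 ≤ κ)
    (hκ1 : κ ≤ 1) :
    ‖f (radialPt θ (κ * gap f θ))‖ₑ ^ 2 * ENNReal.ofReal (gap f θ ^ (ε - 1)) ≤
      ENNReal.ofReal (16 * L ^ 2) + ENNReal.ofReal (32 / (α * ε)) *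
        ∫⁻ t, rieszKernel (ε / 2) (θ - t) * gapEnergy f κ t := by
  obtain ⟨p, hp, hgp⟩ := exists_gap_eq hf.2 hne θ
  have hfp : f (Complex.exp ((p : ℂ) * Complex.I)) = 0 := hp
  rcases (gap_nonneg f θ).eq_or_lt with hd0 | hd0
  · have hθ : θ = p := by
      rw [← hd0] at hgp
      exact sub_eq_zero.1 (abs_eq_zero.1 hgp.symm)
    rw [← hd0, mul_zero, radialPt_zero, hθ, hfp]
    simp
  set d := gap f θ with hd
  obtain ⟨σ, hσ, hθ⟩ : ∃ σ : ℝ, (σ = 1 ∨ σ = -1) ∧ θ = p + σ * d := by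
    rcases le_total p θ with h | h
    · exact ⟨1, Or.inl rfl, by rw [hgp, abs_of_nonneg (by linarith)]; ring⟩
    · exact ⟨-1, Or.inr rfl, by rw [hgp, abs_of_nonpos (by linarith)]; ring⟩
  have hσ1 : |σ| = 1 := by rcases hσ with rfl | rfl <;> simp
  have hgap : ∀ t, 0 ≤ t → t ≤ d → gap f (p + σ * t) = t := by
    intro t h0 h1
    apply le_antisymm
    · have := gap_le f hp (p + σ * t)
      rwa [add_sub_cancel_left, abs_mul, hσ1, one_mul, abs_of_nonneg h0] at this
    · have := gap_le_add f θ (p + σ * t)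
      have e : θ - (p + σ * t) = σ * (d - t) := by rw [hθ]; ring
      rw [e, abs_mul, hσ1, one_mul, abs_of_nonneg (by linarith), ← hd] at this
      linarith
  set τ := d ^ (1 / α) with hτ
  have hτ0 : 0 < τ := by positivity
  have hα2 : 1 ≤ 1 / α := by rw [le_div_iff₀ hα0]; linarith
  have hτd : τ ≤ d := by
    calc τ ≤ d ^ (1 : ℝ) := Real.rpow_le_rpow_of_exponent_ge hd0 (by linarith) hα2
      _ = d := Real.rpow_one d
  have hτα : τ ^ α = d := by
    rw [hτ, ← Real.rpow_mul hd0.le, one_div_mul_cancel hα0.ne', Real.rpow_one]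
  have hpath := enorm_sub_le_lintegral_path hf.1 (γ := fun t => radialPt (p + σ * t) (κ * t))
    (L := 2) hτd (fun r hr => ⟨hasDerivAt_radialPt_line p σ κ r, ?_, ?_⟩) (by fun_prop)
  rotate_left
  · have : 0 < r := hτ0.trans_le hr.1
    exact radialPt_mem_uDisc _ (by positivity) (by nlinarith [hr.2])
  · have hr0 : 0 < r := hτ0.trans_le hr.1
    rw [norm_mul, norm_circle, mul_one]
    refine (norm_sub_le _ _).trans ?_
    rw [norm_mul, norm_mul, Complex.norm_I, Complex.norm_real, Complex.norm_real,
      Complex.norm_real, Real.norm_eq_abs σ, hσ1, Real.norm_of_nonneg (by nlinarith [hr.2]),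
      Real.norm_of_nonneg (by linarith)]
    nlinarith
  simp only [← hθ] at hpath
  have hinit : ‖f (radialPt (p + σ * τ) (κ * τ))‖ ≤ 2 * L * d := by
    have h1 := hfL _ (radialPt_mem_closedBall (p + σ * τ) (s := κ * τ) (by positivity)
      (by nlinarith)) _ (circle_mem_closedBall p)
    rw [hfp, sub_zero] at h1
    refine h1.trans ?_
    have h2 : ‖radialPt (p + σ * τ) (κ * τ) - Complex.exp ((p : ℂ) * Complex.I)‖ ≤ 2 * τ := by
      refine (norm_sub_le_norm_sub_add_norm_sub _ (radialPt (p + σ * τ) 0) _).trans ?_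
      have h3 := norm_circle_sub_circle_le (p + σ * τ) p
      rw [add_sub_cancel_left, abs_mul, hσ1, one_mul, abs_of_pos hτ0] at h3
      rw [radialPt_sub_same, sub_zero, abs_of_pos (by positivity), radialPt_zero]
      nlinarith
    calc _ ≤ L * (2 * τ) ^ α := by gcongr
      _ = L * (2 ^ α * d) := by rw [Real.mul_rpow (by norm_num) hτ0.le, hτα]
      _ ≤ L * (2 ^ (1 : ℝ) * d) := by
          gcongr
          · norm_num
          · linarith
      _ = _ := by rw [Real.rpow_one]; ring
  have hlog : Real.log (d / τ) ≤ 1 / α * (2 / ε * d ^ (-(ε / 2))) := by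
    have h1 : Real.log (d / τ) = (1 / α - 1) * Real.log (1 / d) := by
      rw [Real.log_div hd0.ne' hτ0.ne', hτ, Real.log_rpow hd0, one_div d, Real.log_inv]; ring
    have h2 : Real.log (1 / d) ≤ (1 / d) ^ (ε / 2) / (ε / 2) :=
      Real.log_le_rpow_div (by positivity) (by positivity)
    have h3 : (1 / d) ^ (ε / 2) / (ε / 2) = 2 / ε * d ^ (-(ε / 2)) := by
      rw [one_div, Real.inv_rpow hd0.le, Real.rpow_neg hd0.le]; field_simp
    have h4 : 0 ≤ Real.log (1 / d) := Real.log_nonneg (by rw [le_div_iff₀ hd0]; linarith)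
    rw [h1, ← h3]
    calc _ ≤ 1 / α * Real.log (1 / d) := by gcongr; linarith
      _ ≤ _ := by gcongr
  set W := ∫⁻ t, rieszKernel (ε / 2) (θ - t) * gapEnergy f κ t with hW
  have hmeas : Measurable fun t => ‖deriv f (radialPt (p + σ * t) (κ * t))‖ₑ :=
    measurable_enorm_deriv_comp f (by unfold radialPt; fun_prop)
  have hCS := lintegral_sq_le_log_mul hmeas hτ0 hτd
  have hWb : ENNReal.ofReal (d ^ (ε / 2 - 1)) *
      ∫⁻ t in Ioo τ d, ‖deriv f (radialPt (p + σ * t) (κ * t))‖ₑ ^ 2 * ENNReal.ofReal t ≤ W := by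
    rw [← lintegral_const_mul' _ _ ENNReal.ofReal_ne_top, hW, ← lintegral_affine_sign _ p hσ]
    refine (setLIntegral_mono' measurableSet_Ioo fun t ht => ?_).trans (setLIntegral_le_lintegral _ _)
    have ht0 : 0 < t := hτ0.trans ht.1
    have e : θ - (p + σ * t) = σ * (d - t) := by rw [hθ]; ring
    have e' : |σ * (d - t)| = d - t := by
      rw [abs_mul, hσ1, one_mul, abs_of_pos (by linarith [ht.2])]
    rw [gapEnergy, hgap t ht0.le ht.2.le, e, rieszKernel, indicator_of_mem, e']
    · gcongr 1
      apply ENNReal.ofReal_le_ofReal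
      exact Real.rpow_le_rpow_of_nonpos (by linarith [ht.2]) (by linarith) (by linarith)
    · rw [mem_Icc, ← abs_le, e']; linarith
  have hH : ‖f (radialPt θ (κ * d))‖ₑ ≤ ENNReal.ofReal (2 * L * d) +
      ENNReal.ofReal 2 * ∫⁻ t in Ioo τ d, ‖deriv f (radialPt (p + σ * t) (κ * t))‖ₑ := by
    calc _ = ‖f (radialPt (p + σ * τ) (κ * τ)) +
          (f (radialPt θ (κ * d)) - f (radialPt (p + σ * τ) (κ * τ)))‖ₑ := by
            rw [add_sub_cancel]
      _ ≤ _ := (enorm_add_le _ _).trans (add_le_add (by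
            rw [← ofReal_norm]; exact ENNReal.ofReal_le_ofReal hinit) hpath)
  have hdpow : d ^ 2 * d ^ (ε - 1) ≤ 1 := by
    calc d ^ 2 * d ^ (ε - 1) = d ^ (ε + 1) := by
          rw [← Real.rpow_two, ← Real.rpow_add hd0]; ring_nf
      _ ≤ 1 := Real.rpow_le_one hd0.le (by linarith) (by linarith)
  calc _ ≤ (4 * ENNReal.ofReal (2 * L * d) ^ 2 + 4 * (ENNReal.ofReal 2 *
        ∫⁻ t in Ioo τ d, ‖deriv f (radialPt (p + σ * t) (κ * t))‖ₑ) ^ 2) *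
        ENNReal.ofReal (d ^ (ε - 1)) := by
        gcongr
        exact (pow_le_pow_left' hH 2).trans (ENNReal.add_sq_le_four_mul _ _)
    _ ≤ (ENNReal.ofReal (16 * L ^ 2 * d ^ 2) + ENNReal.ofReal 16 * (ENNReal.ofReal (1 / α * (2 / ε * d ^ (-(ε / 2)))) *
        ∫⁻ t in Ioo τ d, ‖deriv f (radialPt (p + σ * t) (κ * t))‖ₑ ^ 2 * ENNReal.ofReal t)) *
        ENNReal.ofReal (d ^ (ε - 1)) := by
        gcongr ?_ * _
        refine add_le_add (le_of_eq ?_) ?_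
        · rw [← ENNReal.ofReal_pow (by positivity), ← ENNReal.ofReal_ofNat 4,
            ← ENNReal.ofReal_mul (by norm_num)]
          congr 1; ring
        · rw [mul_pow, ← mul_assoc, ← ENNReal.ofReal_pow (by positivity), ← ENNReal.ofReal_ofNat 4,
            ← ENNReal.ofReal_mul (by norm_num)]
          norm_num1
          gcongr
          refine hCS.trans ?_
          gcongr
    _ = ENNReal.ofReal (16 * L ^ 2 * d ^ 2) * ENNReal.ofReal (d ^ (ε - 1)) +
        (ENNReal.ofReal 16 * ENNReal.ofReal (1 / α * (2 / ε * d ^ (-(ε / 2)))) *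
          ENNReal.ofReal (d ^ (ε - 1))) *
        ∫⁻ t in Ioo τ d, ‖deriv f (radialPt (p + σ * t) (κ * t))‖ₑ ^ 2 * ENNReal.ofReal t := by
        ring
    _ = ENNReal.ofReal (16 * L ^ 2 * (d ^ 2 * d ^ (ε - 1))) +
        ENNReal.ofReal (32 / (α * ε)) * (ENNReal.ofReal (d ^ (ε / 2 - 1)) *
        ∫⁻ t in Ioo τ d, ‖deriv f (radialPt (p + σ * t) (κ * t))‖ₑ ^ 2 * ENNReal.ofReal t) := by
        rw [← mul_assoc (ENNReal.ofReal (32 / (α * ε)))]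
        congr 2
        · rw [← ENNReal.ofReal_mul (by positivity)]; congr 1; ring
        · rw [← ENNReal.ofReal_mul (by positivity), ← ENNReal.ofReal_mul (by positivity),
            ← ENNReal.ofReal_mul (by positivity)]
          congr 1
          have : d ^ (ε / 2 - 1) = d ^ (-(ε / 2)) * d ^ (ε - 1) := by
            rw [← Real.rpow_add hd0]; ring_nf
          rw [this]; field_simp; ring
    _ ≤ _ := by
        refine add_le_add (ENNReal.ofReal_le_ofReal ?_) (mul_le_mul_right hWb _)
        exact mul_le_of_le_one_right (by positivity) hdpow

lemma norm_radial_le {f : ℂ → ℂ} (hf : ContinuousOn f (closedBall 0 1)) {α L : ℝ} (hα0 : 0 < α)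
    (hα1 : α ≤ 1 / 2) (hL : 0 ≤ L)
    (hfL : ∀ z ∈ closedBall (0 : ℂ) 1, ∀ w ∈ closedBall (0 : ℂ) 1, ‖f z - f w‖ ≤ L * ‖z - w‖ ^ α)
    (hne : (zeroAngles f).Nonempty) (θ : ℝ) {s r : ℝ} (hs0 : 0 ≤ s) (hs1 : s ≤ 1) (hsr : s ≤ r)
    (hr : gap f θ ≤ r) : ‖f (radialPt θ s)‖ ≤ 2 * L * r ^ α := by
  obtain ⟨p, hp, hgp⟩ := exists_gap_eq hf hne θ
  have hfp : f (Complex.exp ((p : ℂ) * Complex.I)) = 0 := hp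
  have h1 := hfL _ (radialPt_mem_closedBall θ hs0 hs1) _ (circle_mem_closedBall p)
  rw [hfp, sub_zero] at h1
  have hr0 : 0 ≤ r := hs0.trans hsr
  have h2 : ‖radialPt θ s - Complex.exp ((p : ℂ) * Complex.I)‖ ≤ 2 * r := by
    refine (norm_sub_le_norm_sub_add_norm_sub _ (radialPt θ 0) _).trans ?_
    have h3 := norm_circle_sub_circle_le θ p
    rw [← hgp] at h3
    rw [radialPt_sub_same, sub_zero, abs_of_nonneg hs0, radialPt_zero]
    linarith
  calc _ ≤ L * (2 * r) ^ α := h1.trans (by gcongr)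
    _ = L * (2 ^ α * r ^ α) := by rw [Real.mul_rpow (by norm_num) hr0]
    _ ≤ L * (2 ^ (1 : ℝ) * r ^ α) := by
        gcongr
        · norm_num
        · linarith
    _ = _ := by rw [Real.rpow_one]; ring

lemma radial_product_energy_le {f : ℂ → ℂ} (hf : IsDiscReg f) {α η ρ L : ℝ} (hα0 : 0 < α)
    (hα1 : α ≤ 1 / 2) (hη0 : 0 < η) (hη1 : η ≤ 1) (hρ : 1 + η ≤ ρ) (hL : 0 < L)
    (h1 : ∀ z ∈ closedBall (0 : ℂ) 1, ‖f z‖ ≤ 1) (hnz : ∀ z ∈ uDisc, f z ≠ 0)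
    (hfL : ∀ z ∈ closedBall (0 : ℂ) 1, ∀ w ∈ closedBall (0 : ℂ) 1, ‖f z - f w‖ ≤ L * ‖z - w‖ ^ α)
    (hne : (zeroAngles f).Nonempty) {θ κ : ℝ} (hd1 : gap f θ ≤ 1 / 2) (hκ0 : 0 ≤ κ)
    (hκ1 : κ ≤ 1) {A : ℝ} {a : ℝ → ℝ} (hA : 0 ≤ A)
    (ha : ∀ s, 0 < s → s ≤ 1 → 0 ≤ a s ∧
      ‖f (radialPt θ s)‖ ≤ Real.exp (-(s / (2 * Real.pi) * a s)))
    (haA : ∀ s, 0 < s → s ≤ 1 → s ≤ gap f θ → a s ≤ 4 * A ∧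
      ‖f (radialPt θ s)‖ ≤ Real.exp (-(s / (18 * Real.pi) * A))) :
    ∫⁻ s in Ioc 0 (1 / 2 : ℝ), ENNReal.ofReal ((‖f (radialPt θ s)‖ ^ ρ * a s) ^ 2) ≤
      ENNReal.ofReal ((4 * Real.pi / η) ^ 2 * (2 * L) ^ η * (4 / (α * η) + 4) +
          16 * (18 * Real.pi) ^ 2 / η * (8 / η + 8 * (2 * L) ^ (η / 2) / η)) *
        (radialEnergy f θ + ‖f (radialPt θ (κ * gap f θ))‖ₑ ^ 2 *
          ENNReal.ofReal (gap f θ ^ (α * η / 2 - 1))) := by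
  have hpi := Real.pi_pos
  rcases eq_or_ne (radialEnergy f θ) ⊤ with htop | htop
  · rw [htop, top_add, ENNReal.mul_top (ENNReal.ofReal_pos.2 (by positivity)).ne']
    exact le_top
  set d := gap f θ with hd
  have hd0 : 0 ≤ d := gap_nonneg f θ
  set F : ℝ → ℝ := fun s => ‖f (radialPt θ s)‖
  set e := (radialEnergy f θ).toReal with he
  have he0 : 0 ≤ e := ENNReal.toReal_nonneg
  have hF : ∀ s, 0 < s → s ≤ 1 / 2 → 0 < F s ∧ F s ≤ 1 := fun s h0 h2 =>
    ⟨norm_pos_iff.2 (hnz _ (radialPt_mem_uDisc θ h0 (by linarith))),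
      h1 _ (radialPt_mem_closedBall θ h0.le (by linarith))⟩
  have hFs : ∀ s ∈ Icc (0 : ℝ) (1 / 2), ∀ t ∈ Icc (0 : ℝ) (1 / 2),
      (F s - F t) ^ 2 ≤ |s - t| * e := by
    intro s hs t ht
    have h := enorm_radial_sub_sq_le hf θ ht hs
    rw [← ENNReal.ofReal_toReal htop, ← ENNReal.ofReal_mul (abs_nonneg _), ← ofReal_norm,
      ← ENNReal.ofReal_pow (norm_nonneg _), ENNReal.ofReal_le_ofReal_iff (by positivity)] at h
    refine le_trans ?_ h
    rw [← sq_abs (F s - F t)]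
    gcongr
    exact abs_norm_sub_norm_le _ _
  have hbound : ∀ s r, 0 ≤ s → s ≤ 1 → s ≤ r → d ≤ r → F s ≤ 2 * L * r ^ α :=
    fun s r h0 h2 h3 h4 => norm_radial_le hf.2 hα0 hα1 hL.le hfL hne θ h0 h2 h3 h4
  have hX : ENNReal.ofReal (e + F (κ * d) ^ 2 * d ^ (α * η / 2 - 1)) =
      radialEnergy f θ + ‖f (radialPt θ (κ * d))‖ₑ ^ 2 * ENNReal.ofReal (d ^ (α * η / 2 - 1)) := by
    rw [ENNReal.ofReal_add he0 (by positivity), he, ENNReal.ofReal_toReal htop,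
      ENNReal.ofReal_mul (by positivity), ENNReal.ofReal_pow (norm_nonneg _), ofReal_norm]
  rw [← hX, ENNReal.ofReal_add (by positivity) (by positivity), add_mul,
    ← ENNReal.ofReal_mul (by positivity), ← ENNReal.ofReal_mul (by positivity), add_comm]
  have hfar := radial_energy_far hα0 hα1 hη0 hη1 (K := 2 * L) (by positivity) (F := F) (a := a)
    (d := d) (e := e) hρ hd0 hd1 he0 hκ0 hκ1 hF (fun s h0 h2 => ha s h0 (by linarith)) hFs
    (fun s h0 h2 h3 => hbound s s h0.le (by linarith) le_rfl h3)
    (fun h => le_antisymm (by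
      have := hbound 0 0 le_rfl zero_le_one le_rfl h.le
      rwa [Real.zero_rpow hα0.ne', mul_zero] at this) (norm_nonneg _))
  rcases hd0.eq_or_lt with h0 | h0
  · rw [← h0] at hfar ⊢
    exact hfar.trans le_add_self
  · have hnear := radial_energy_near hα0 hη0 hη1 (K := 2 * L) (by positivity) (F := F) (a := a)
      (A := A) (d := d) (e := e) hρ h0 hd1 he0 hκ0 hκ1 hA hF
      (h1 _ (radialPt_mem_closedBall θ le_rfl zero_le_one))
      (fun s h0 h2 => (ha s h0 (by linarith)).1) (fun s h0 h2 => haA s h0 (by linarith) h2) hFs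
      ((continuousOn_radial hf.2 θ).norm.mono (Icc_subset_Icc_right (by linarith)))
      (fun s h0 h2 => hbound s d h0 (by linarith) h2 le_rfl)
    rw [← Ioc_union_Ioc_eq_Ioc hd0 hd1]
    exact (lintegral_union_le _ _ _).trans (add_le_add hnear hfar)

lemma lintegral_rieszKernel_le {ε : ℝ} (hε : 0 < ε) :
    ∫⁻ x, rieszKernel ε x ≤ ENNReal.ofReal (2 / ε) := by
  have h0 := lintegral_rpow_sub_one_le hε (b := 1 / 2) (by norm_num) (by norm_num)
  have h1 : ∫⁻ x in Ioc 0 (1 / 2 : ℝ), ENNReal.ofReal (|x| ^ (ε - 1)) ≤ ENNReal.ofReal (1 / ε) := by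
    refine le_trans (le_of_eq ?_) h0
    exact setLIntegral_congr_fun measurableSet_Ioc fun x hx => by rw [abs_of_pos hx.1]
  have h2 : ∫⁻ x in Icc (-(1 / 2) : ℝ) 0, ENNReal.ofReal (|x| ^ (ε - 1)) ≤
      ENNReal.ofReal (1 / ε) := by
    refine le_trans (le_of_eq ?_) h1
    rw [← lintegral_indicator measurableSet_Icc, ← lintegral_sub_left_eq_self _ (0 : ℝ),
      setLIntegral_congr Ioc_ae_eq_Icc, ← lintegral_indicator measurableSet_Icc]
    refine lintegral_congr fun x => ?_
    simp only [zero_sub, indicator, mem_Icc, abs_neg, neg_le_neg_iff, Left.neg_nonpos_iff]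
    congr 1
    exact propext and_comm
  simp only [rieszKernel]
  rw [lintegral_indicator measurableSet_Icc, ← Icc_union_Ioc_eq_Icc (b := (0 : ℝ)) (by norm_num)
    (by norm_num)]
  refine (lintegral_union_le _ _ _).trans ((add_le_add h2 h1).trans (le_of_eq ?_))
  rw [← ENNReal.ofReal_add (by positivity) (by positivity)]
  congr 1; ring

lemma measurable_rieszKernel (ε : ℝ) : Measurable (rieszKernel ε) := by
  unfold rieszKernel
  exact Measurable.indicator (by fun_prop) measurableSet_Icc

lemma lintegral_convolution_rieszKernel_le {u : ℝ → ℝ≥0∞} (hu : Measurable u) {ε a b : ℝ}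
    (hε : 0 < ε) : ∫⁻ θ in Ioo a b, ∫⁻ t, rieszKernel ε (θ - t) * u t ≤
      ENNReal.ofReal (2 / ε) * ∫⁻ t in Ioo (a - 1) (b + 1), u t := by
  have hm := measurable_rieszKernel ε
  rw [lintegral_lintegral_swap (by fun_prop), ← lintegral_const_mul' _ _ ENNReal.ofReal_ne_top,
    ← lintegral_indicator measurableSet_Ioo]
  refine lintegral_mono fun t => ?_
  by_cases ht : t ∈ Ioo (a - 1) (b + 1)
  · rw [indicator_of_mem ht, lintegral_mul_const _ (by fun_prop)]
    gcongr
    refine (setLIntegral_le_lintegral _ _).trans ?_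
    rw [lintegral_sub_right_eq_self (rieszKernel ε) t]
    exact lintegral_rieszKernel_le hε
  · rw [indicator_of_notMem ht, nonpos_iff_eq_zero]
    refine setLIntegral_eq_zero measurableSet_Ioo fun θ hθ => ?_
    have : rieszKernel ε (θ - t) = 0 := by
      refine indicator_of_notMem (fun h => ht ?_) _
      exact ⟨by linarith [h.1, h.2, hθ.1], by linarith [h.1, hθ.2]⟩
    simp [this]

lemma measurable_gapEnergy (f : ℂ → ℂ) : Measurable (fun q : ℝ × ℝ => gapEnergy f q.1 q.2) := by
  have hg := continuous_gap f
  refine ((measurable_enorm_deriv_comp f ?_).pow_const 2).mul (by fun_prop)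
  exact (continuous_radialPt.comp (f := fun q : ℝ × ℝ => (q.2, q.1 * gap f q.2))
    (by fun_prop)).measurable

lemma lintegral_gapEnergy_le (f : ℂ → ℂ) {t : ℝ} (hd1 : gap f t ≤ 1 / 2) :
    ∫⁻ κ in Icc (1 / 2 : ℝ) 1, gapEnergy f κ t ≤ radialEnergy f t := by
  rcases (gap_nonneg f t).eq_or_lt with h0 | h0
  · simp [gapEnergy, ← h0]
  have h := lintegral_image_eq_lintegral_abs_deriv_mul (s := Icc (1 / 2 : ℝ) 1)
    (f := fun κ => κ * gap f t) (f' := fun _ => gap f t) measurableSet_Icc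
    (fun x _ => ((hasDerivAt_id x).mul_const (gap f t)).hasDerivWithinAt.congr_deriv (by simp))
    (fun x _ y _ hxy => mul_right_cancel₀ h0.ne' hxy)
    (fun s => ‖deriv f (radialPt t s)‖ₑ ^ 2)
  simp only [abs_of_pos h0] at h
  simp only [gapEnergy, mul_comm (_ ^ 2 : ℝ≥0∞)]
  rw [← h]
  refine lintegral_mono_set ?_
  rintro _ ⟨κ, hκ, rfl⟩
  have := hκ.1
  have := hκ.2
  exact ⟨by positivity, by nlinarith⟩

lemma radialEnergy_add_int_mul (f : ℂ → ℂ) (θ : ℝ) (k : ℤ) :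
    radialEnergy f (θ + k * (2 * Real.pi)) = radialEnergy f θ := by
  simp only [radialEnergy, radialPt, circle_add_int_mul]

lemma measurable_radialEnergy (f : ℂ → ℂ) : Measurable (radialEnergy f) := by
  unfold radialEnergy
  exact Measurable.lintegral_prod_right'
    (f := fun q : ℝ × ℝ => ‖deriv f (radialPt q.1 q.2)‖ₑ ^ 2)
    ((measurable_enorm_deriv_comp f continuous_radialPt.measurable).pow_const 2)

lemma lintegral_radialEnergy_enlarge (f : ℂ → ℂ) :
    ∫⁻ t in Ioo (-Real.pi - 1) (Real.pi + 1), radialEnergy f t ≤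
      3 * ∫⁻ t in Ioo (-Real.pi) Real.pi, radialEnergy f t := by
  have hpi := Real.pi_gt_three
  have hshift : ∀ k : ℤ, ∫⁻ t in Ioo (-Real.pi + k * (2 * Real.pi)) (Real.pi + k * (2 * Real.pi)),
      radialEnergy f t = ∫⁻ t in Ioo (-Real.pi) Real.pi, radialEnergy f t := by
    intro k
    rw [← lintegral_indicator measurableSet_Ioo, ← lintegral_indicator measurableSet_Ioo,
      ← lintegral_add_right_eq_self _ ((k : ℝ) * (2 * Real.pi))]
    refine lintegral_congr fun t => ?_
    simp only [indicator, mem_Ioo, add_lt_add_iff_right, radialEnergy_add_int_mul]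
  have hsub : Ioo (-Real.pi - 1) (Real.pi + 1) ⊆
      (Ioc (-Real.pi + (-1 : ℤ) * (2 * Real.pi)) (Real.pi + (-1 : ℤ) * (2 * Real.pi)) ∪
        Ioc (-Real.pi) Real.pi) ∪
        Ioc (-Real.pi + (1 : ℤ) * (2 * Real.pi)) (Real.pi + (1 : ℤ) * (2 * Real.pi)) := by
    intro t ht
    push_cast
    rcases le_or_gt t (-Real.pi) with h | h
    · exact Or.inl (Or.inl ⟨by linarith [ht.1], by linarith⟩)
    · rcases le_or_gt t Real.pi with h' | h'
      · exact Or.inl (Or.inr ⟨h, h'⟩)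
      · exact Or.inr ⟨by linarith, by linarith [ht.2]⟩
  refine (lintegral_mono_set hsub).trans ?_
  refine (lintegral_union_le _ _ _).trans ((add_le_add (lintegral_union_le _ _ _) le_rfl).trans ?_)
  rw [← setLIntegral_congr Ioo_ae_eq_Ioc, ← setLIntegral_congr Ioo_ae_eq_Ioc,
    ← setLIntegral_congr Ioo_ae_eq_Ioc, hshift, hshift]
  exact le_of_eq (by ring)

/-- Integration over an outer annulus in terms of the angle and the distance to the circle. -/
lemma lintegral_annulus_eq {u : ℂ → ℝ≥0∞} (hu : Measurable u) :
    ∫⁻ z in {z : ℂ | 1 / 2 ≤ ‖z‖ ∧ ‖z‖ < 1}, u z =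
      ∫⁻ θ in Ioo (-Real.pi) Real.pi, ∫⁻ s in Ioc 0 (1 / 2 : ℝ),
        ENNReal.ofReal (1 - s) * u (radialPt θ s) := by
  have hms : MeasurableSet {z : ℂ | 1 / 2 ≤ ‖z‖ ∧ ‖z‖ < 1} :=
    (measurableSet_le measurable_const measurable_norm).inter
      (measurableSet_lt measurable_norm measurable_const)
  have hpt : ∀ p : ℝ × ℝ, Complex.polarCoord.symm p = radialPt p.2 (1 - p.1) := by
    intro p
    rw [Complex.polarCoord_symm_apply, radialPt, Complex.exp_mul_I, sub_sub_cancel,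
      Complex.ofReal_cos, Complex.ofReal_sin]
  have hmr : Measurable (fun q : ℝ × ℝ => radialPt q.1 q.2) := continuous_radialPt.measurable
  rw [← lintegral_indicator hms, ← Complex.lintegral_comp_polarCoord_symm]
  have htarget : polarCoord.target = Ioi (0 : ℝ) ×ˢ Ioo (-Real.pi) Real.pi := rfl
  have hmint : Measurable (fun p : ℝ × ℝ => ENNReal.ofReal p.1 •
      ({z : ℂ | 1 / 2 ≤ ‖z‖ ∧ ‖z‖ < 1}).indicator u (Complex.polarCoord.symm p)) := by
    simp only [hpt, smul_eq_mul]
    refine (by fun_prop : Measurable fun p : ℝ × ℝ => ENNReal.ofReal p.1).mul ?_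
    exact (hu.indicator hms).comp (hmr.comp (f := fun p : ℝ × ℝ => (p.2, 1 - p.1)) (by fun_prop))
  rw [htarget, Measure.volume_eq_prod, ← Measure.prod_restrict,
    lintegral_prod_symm' _ hmint]
  refine lintegral_congr fun θ => ?_
  simp only [hpt, smul_eq_mul]
  rw [← lintegral_indicator measurableSet_Ioi, ← lintegral_indicator measurableSet_Ioc,
    ← lintegral_sub_left_eq_self _ (1 : ℝ)]
  refine lintegral_congr fun s => ?_
  simp only [indicator, mem_Ioi, mem_Ioc, sub_sub_cancel, mem_ofPred_eq]
  by_cases h1 : 0 < 1 - s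
  · rw [if_pos h1, norm_radialPt θ (by linarith)]
    by_cases h2 : 0 < s ∧ s ≤ 1 / 2
    · rw [if_pos h2, if_pos ⟨by linarith [h2.2], by linarith [h2.1]⟩]
    · rw [if_neg h2, if_neg (fun h => h2 ⟨by linarith [h.2], by linarith [h.1]⟩), mul_zero]
  · rw [if_neg h1, if_neg (fun h => h1 (by linarith [h.2]))]

lemma lintegral_radialEnergy_le (f : ℂ → ℂ) :
    ∫⁻ θ in Ioo (-Real.pi) Real.pi, radialEnergy f θ ≤ 2 * ∫⁻ z in uDisc, ‖deriv f z‖ₑ ^ 2 := by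
  have h := lintegral_annulus_eq ((measurable_deriv f).enorm.pow_const 2)
  have h2 : ∫⁻ z in {z : ℂ | 1 / 2 ≤ ‖z‖ ∧ ‖z‖ < 1}, ‖deriv f z‖ₑ ^ 2 ≤
      ∫⁻ z in uDisc, ‖deriv f z‖ₑ ^ 2 :=
    lintegral_mono_set fun z hz => mem_ball_zero_iff.2 hz.2
  refine le_trans ?_ (mul_le_mul_right h2 _)
  rw [h, ← lintegral_const_mul' _ _ (by norm_num)]
  refine lintegral_mono fun θ => ?_
  rw [radialEnergy, ← lintegral_const_mul' _ _ (by norm_num)]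
  refine setLIntegral_mono' measurableSet_Ioc fun s hs => ?_
  rw [← mul_assoc]
  refine le_mul_of_one_le_left' ?_
  rw [← ENNReal.ofReal_ofNat 2, ← ENNReal.ofReal_mul (by norm_num), ← ENNReal.ofReal_one]
  exact ENNReal.ofReal_le_ofReal (by linarith [hs.2])

/-- The total weighted gap energy is controlled by the Dirichlet integral, after averaging in the
aperture of the approach curve. -/
lemma exists_lintegral_gapEnergy_le (f : ℂ → ℂ) (hgap : ∀ θ, gap f θ ≤ 1 / 2) :
    ∃ κ ∈ Icc (1 / 2 : ℝ) 1, ∫⁻ t in Ioo (-Real.pi - 1) (Real.pi + 1), gapEnergy f κ t ≤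
      12 * ∫⁻ z in uDisc, ‖deriv f z‖ₑ ^ 2 := by
  have hm := measurable_gapEnergy f
  by_contra! hcon
  have h1 : ∫⁻ κ in Icc (1 / 2 : ℝ) 1, ∫⁻ t in Ioo (-Real.pi - 1) (Real.pi + 1), gapEnergy f κ t ≤
      6 * ∫⁻ z in uDisc, ‖deriv f z‖ₑ ^ 2 := by
    rw [lintegral_lintegral_swap hm.aemeasurable]
    refine (lintegral_mono fun t => lintegral_gapEnergy_le f (hgap t)).trans ?_
    refine (lintegral_radialEnergy_enlarge f).trans ?_
    refine (mul_le_mul_right (lintegral_radialEnergy_le f) _).trans (le_of_eq ?_)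
    ring
  have hvol : volume (Icc (1 / 2 : ℝ) 1) = ENNReal.ofReal (1 / 2) := by
    rw [Real.volume_Icc]; norm_num
  have hD : ∫⁻ z in uDisc, ‖deriv f z‖ₑ ^ 2 ≠ ⊤ := by
    intro h
    have := hcon 1 (by norm_num)
    rw [h, ENNReal.mul_top (by norm_num)] at this
    exact absurd this (not_lt.2 le_top)
  have h2 : ∫⁻ _κ in Icc (1 / 2 : ℝ) 1, (12 * ∫⁻ z in uDisc, ‖deriv f z‖ₑ ^ 2) <
      ∫⁻ κ in Icc (1 / 2 : ℝ) 1, ∫⁻ t in Ioo (-Real.pi - 1) (Real.pi + 1), gapEnergy f κ t := by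
    refine setLIntegral_strict_mono measurableSet_Icc (by rw [hvol]; norm_num)
      (Measurable.lintegral_prod_right' hm) ?_ (Eventually.of_forall hcon)
    rw [setLIntegral_const, hvol]
    exact ENNReal.mul_ne_top (ENNReal.mul_ne_top (by norm_num) hD) ENNReal.ofReal_ne_top
  rw [setLIntegral_const, hvol] at h2
  refine absurd (h2.trans_le h1) (not_lt.2 (le_of_eq ?_))
  rw [mul_right_comm, ← ENNReal.ofReal_ofNat 12, ← ENNReal.ofReal_mul (by norm_num)]
  norm_num

lemma ofReal_two_mul_sq_add (x y z : ℝ) (hx : 0 ≤ x) (h : x ≤ y + z) :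
    ENNReal.ofReal (x ^ 2) ≤ ENNReal.ofReal (2 * y ^ 2) + ENNReal.ofReal (2 * z ^ 2) := by
  rw [← ENNReal.ofReal_add (by positivity) (by positivity)]
  apply ENNReal.ofReal_le_ofReal
  calc x ^ 2 ≤ (y + z) ^ 2 := by gcongr
    _ ≤ _ := by nlinarith [sq_nonneg (y - z)]

/-- The Dirichlet integral of `f^ρ f_Γ^N` is bounded uniformly in `f` and `Γ`. -/
lemma exists_product_dirichlet_bound {α η ρ : ℝ} (hα0 : 0 < α) (hα1 : α ≤ 1 / 2) (hη0 : 0 < η)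
    (hη1 : η ≤ 1) (hρ : 1 + η ≤ ρ) (N : ℕ) : ∃ Q : ℝ, 0 ≤ Q ∧ ∀ (f : ℂ → ℂ), MemA α f →
      IsOuter f → ANorm α f ≤ 1 → (∀ θ, ∃ p ∈ zeroAngles f, |p - θ| ≤ 1 / 2) →
      ∀ Γ : Set ℂ, IsArcUnion f Γ →
        ∫⁻ z in uDisc, ‖deriv (fun z => outerPow f ρ z * (outerPart f Γ z) ^ N) z‖ₑ ^ 2 ≤
          ENNReal.ofReal Q := by
  have hpi := Real.pi_pos
  set L := 2 / α + 1 with hL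
  have hL0 : 0 < L := by positivity
  set ε := α * η / 2 with hε
  have hε0 : 0 < ε := by positivity
  have hε1 : ε ≤ 1 := by nlinarith
  have hρ0 : 0 ≤ ρ := by linarith
  obtain ⟨C, hC0, hC⟩ : ∃ C, 0 ≤ C ∧ C = (4 * Real.pi / η) ^ 2 * (2 * L) ^ η * (4 / (α * η) + 4) +
      16 * (18 * Real.pi) ^ 2 / η * (8 / η + 8 * (2 * L) ^ (η / 2) / η) :=
    ⟨_, by positivity, rfl⟩
  obtain ⟨c₁, hc₁0, hc₁⟩ : ∃ c, 0 ≤ c ∧ c = 2 * (ρ + N) ^ 2 := ⟨_, by positivity, rfl⟩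
  obtain ⟨c₂, hc₂0, hc₂⟩ : ∃ c, 0 ≤ c ∧ c = 2 * (N : ℝ) ^ 2 * C := ⟨_, by positivity, rfl⟩
  refine ⟨16 * Real.pi + ((c₁ + c₂) * (2 * Real.pi) + c₂ * (16 * L ^ 2) * (2 * Real.pi) +
    c₂ * (32 / (α * ε)) * (2 / (ε / 2) * (12 * Real.pi))), by positivity, ?_⟩
  intro f hfA hf hn hgap Γ hΓ
  obtain ⟨g, hg⟩ : ∃ g, g = fun z => outerPow f ρ z * (outerPart f Γ z) ^ N := ⟨_, rfl⟩
  obtain ⟨hb1, hb2, hb3⟩ := bounds_of_ANorm_le_one hα0 (by linarith) hfA hn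
  obtain ⟨hgd, hg1, -, -⟩ := product_deriv_growth hα0 hα1 hη0 hη1 hρ hfA hf hn hgap hΓ hg
  rw [← hg]
  have hne : (zeroAngles f).Nonempty := let ⟨p, hp, _⟩ := hgap 0; ⟨p, hp⟩
  have hgap2 : ∀ θ, gap f θ ≤ 1 / 2 := fun θ => by
    obtain ⟨p, hp, h⟩ := hgap θ
    rw [abs_sub_comm] at h
    exact (gap_le f hp θ).trans h
  have hfL : ∀ z ∈ closedBall (0 : ℂ) 1, ∀ w ∈ closedBall (0 : ℂ) 1,
      ‖f z - f w‖ ≤ L * ‖z - w‖ ^ α := by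
    intro z hz w hw
    have := norm_sub_le_of_deriv_growth_closed hf.1 hα0 (by linarith) zero_le_one le_rfl
      (fun z hz => by rw [add_zero]; exact hb2 z hz) hz hw
    simpa [hL] using this
  obtain ⟨κ, ⟨hκ0, hκ1⟩, hκ⟩ := exists_lintegral_gapEnergy_le f hgap2
  set V : ℝ → ℝ≥0∞ := fun θ => ∫⁻ t, rieszKernel (ε / 2) (θ - t) * gapEnergy f κ t with hV
  have hray : ∀ θ, ∫⁻ s in Ioc 0 (1 / 2 : ℝ), ENNReal.ofReal (1 - s) *
      ‖deriv g (radialPt θ s)‖ₑ ^ 2 ≤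
        (ENNReal.ofReal (c₁ + c₂) * radialEnergy f θ + ENNReal.ofReal (c₂ * (16 * L ^ 2))) +
          ENNReal.ofReal (c₂ * (32 / (α * ε))) * V θ := by
    intro θ
    obtain ⟨A, a, hA, ha, haA⟩ := radial_estimates hf hb1 hne hΓ (by linarith : 1 ≤ ρ) N θ
    have h1 := radial_product_energy_le hf.1 hα0 hα1 hη0 hη1 hρ hL0 hb1
      (fun z hz => hf.ne_zero hz) hfL hne (hgap2 θ) (by linarith) hκ1 hA
      (fun s h0 h1 => ⟨(ha s h0 h1).1, (ha s h0 h1).2.1⟩) haA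
    have h2 := gap_value_bound hf.1 hα0 hα1 hε0 hε1 hL0.le hfL hne (hgap2 θ) hκ0 hκ1
    rw [← hC, ← hε] at h1
    have h3 : ∫⁻ s in Ioc 0 (1 / 2 : ℝ), ENNReal.ofReal (1 - s) * ‖deriv g (radialPt θ s)‖ₑ ^ 2 ≤
        ENNReal.ofReal c₁ * radialEnergy f θ + ENNReal.ofReal (2 * (N : ℝ) ^ 2) *
          ∫⁻ s in Ioc 0 (1 / 2 : ℝ), ENNReal.ofReal ((‖f (radialPt θ s)‖ ^ ρ * a s) ^ 2) := by
      rw [radialEnergy, ← lintegral_const_mul' _ _ ENNReal.ofReal_ne_top,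
        ← lintegral_const_mul' _ _ ENNReal.ofReal_ne_top, ← lintegral_add_left]
      · refine setLIntegral_mono' measurableSet_Ioc fun s hs => ?_
        have h4 := (ha s hs.1 (by linarith [hs.2])).2.2
        rw [← hg] at h4
        have h5 := ofReal_two_mul_sq_add _ _ _ (norm_nonneg _) h4
        refine (mul_le_of_le_one_left' (ENNReal.ofReal_le_one.2 (by linarith [hs.1]))).trans ?_
        rw [← ofReal_norm, ← ENNReal.ofReal_pow (norm_nonneg _)]
        refine h5.trans (le_of_eq ?_)
        rw [← ofReal_norm, ← ENNReal.ofReal_pow (norm_nonneg _), ← ENNReal.ofReal_mul hc₁0,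
          ← ENNReal.ofReal_mul (by positivity), hc₁]
        congr 2 <;> ring
      · exact ((measurable_enorm_deriv_comp f (by unfold radialPt; fun_prop)).pow_const 2).const_mul _
    refine h3.trans ?_
    calc _ ≤ ENNReal.ofReal c₁ * radialEnergy f θ + ENNReal.ofReal (2 * (N : ℝ) ^ 2) *
          (ENNReal.ofReal C * (radialEnergy f θ + (ENNReal.ofReal (16 * L ^ 2) +
            ENNReal.ofReal (32 / (α * ε)) * V θ))) := by
          refine add_le_add le_rfl (mul_le_mul_right (h1.trans ?_) _)
          exact mul_le_mul_right (add_le_add le_rfl h2) _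
      _ = _ := by
          have e : ENNReal.ofReal c₂ = ENNReal.ofReal (2 * (N : ℝ) ^ 2) * ENNReal.ofReal C := by
            rw [hc₂, ENNReal.ofReal_mul (by positivity)]
          rw [ENNReal.ofReal_add hc₁0 hc₂0, ENNReal.ofReal_mul hc₂0, ENNReal.ofReal_mul hc₂0, e]
          ring
  have hD := hb3
  have hannulus : ∫⁻ z in {z : ℂ | 1 / 2 ≤ ‖z‖ ∧ ‖z‖ < 1}, ‖deriv g z‖ₑ ^ 2 ≤
      ENNReal.ofReal ((c₁ + c₂) * (2 * Real.pi) + c₂ * (16 * L ^ 2) * (2 * Real.pi) +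
        c₂ * (32 / (α * ε)) * (2 / (ε / 2) * (12 * Real.pi))) := by
    rw [lintegral_annulus_eq ((measurable_deriv g).enorm.pow_const 2)]
    refine (lintegral_mono hray).trans ?_
    have hm := measurable_radialEnergy f
    rw [lintegral_add_left (by fun_prop), lintegral_add_left (by fun_prop),
      lintegral_const_mul' _ _ ENNReal.ofReal_ne_top, lintegral_const_mul' _ _ ENNReal.ofReal_ne_top,
      setLIntegral_const, Real.volume_Ioo, sub_neg_eq_add,
      ENNReal.ofReal_add (p := _ + _) (q := _ * (2 / (ε / 2) * _)) (by positivity) (by positivity),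
      ENNReal.ofReal_add (p := (c₁ + c₂) * _) (by positivity) (by positivity),
      ENNReal.ofReal_mul (p := c₁ + c₂) (by positivity),
      ENNReal.ofReal_mul (p := c₂ * (16 * L ^ 2)) (by positivity),
      ENNReal.ofReal_mul (p := c₂ * (32 / (α * ε))) (by positivity)]
    have hE : ∫⁻ θ in Ioo (-Real.pi) Real.pi, radialEnergy f θ ≤ ENNReal.ofReal (2 * Real.pi) := by
      refine (lintegral_radialEnergy_le f).trans ((mul_le_mul_right hD _).trans (le_of_eq ?_))
      rw [ENNReal.ofReal_mul (by norm_num), ENNReal.ofReal_ofNat]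
    have hVi : ∫⁻ θ in Ioo (-Real.pi) Real.pi, V θ ≤
        ENNReal.ofReal (2 / (ε / 2) * (12 * Real.pi)) := by
      have hu : Measurable (gapEnergy f κ) := (measurable_gapEnergy f).of_uncurry_left
      refine (lintegral_convolution_rieszKernel_le hu (by positivity)).trans ?_
      rw [ENNReal.ofReal_mul (by positivity)]
      refine mul_le_mul_right (hκ.trans ((mul_le_mul_right hD _).trans (le_of_eq ?_))) _
      rw [ENNReal.ofReal_mul (by norm_num), ENNReal.ofReal_ofNat]
    refine add_le_add (add_le_add (mul_le_mul_right hE _) (le_of_eq ?_)) (mul_le_mul_right hVi _)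
    rw [two_mul]
  have hcore : ∫⁻ z in closedBall (0 : ℂ) (1 / 2), ‖deriv g z‖ₑ ^ 2 ≤
      ENNReal.ofReal (16 * Real.pi) := by
    calc _ ≤ ∫⁻ _z in closedBall (0 : ℂ) (1 / 2), ENNReal.ofReal 16 := by
          refine setLIntegral_mono' measurableSet_closedBall fun z hz => ?_
          rw [← ofReal_norm, ← ENNReal.ofReal_pow (norm_nonneg _)]
          apply ENNReal.ofReal_le_ofReal
          have := norm_deriv_le_of_norm_le_half hgd hg1 (mem_closedBall_zero_iff.1 hz)
          nlinarith [norm_nonneg (deriv g z)]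
      _ ≤ ENNReal.ofReal 16 * volume (ball (0 : ℂ) 1) := by
          rw [setLIntegral_const]
          exact mul_le_mul_right (measure_mono (closedBall_subset_ball (by norm_num))) _
      _ = _ := by
          rw [Complex.volume_ball, ENNReal.ofReal_one, one_pow, one_mul,
            ENNReal.ofReal_mul (by norm_num)]
          congr 1
          exact (ENNReal.ofReal_coe_nnreal (p := NNReal.pi)).symm
  have hsub : uDisc ⊆ closedBall (0 : ℂ) (1 / 2) ∪ {z : ℂ | 1 / 2 ≤ ‖z‖ ∧ ‖z‖ < 1} := by
    intro z hz
    rcases le_total ‖z‖ (1 / 2) with h | h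
    · exact Or.inl (mem_closedBall_zero_iff.2 h)
    · exact Or.inr ⟨h, mem_ball_zero_iff.1 hz⟩
  rw [ENNReal.ofReal_add (by positivity) (by positivity)]
  exact (lintegral_mono_set hsub).trans
    ((lintegral_union_le _ _ _).trans (add_le_add hcore hannulus))

/-- For `f` outer in `𝒜_α` with `‖f‖ ≤ 1`, `N ≥ 1`, `ρ > 1`:
`f^ρ f_Γ^N ∈ 𝒜_α` with `sup_Γ ‖f^ρ f_Γ^N‖_{𝒜_α} ≤ C_{N,ρ}` uniformly in `Γ`. -/
theorem outer_part_power_bounded (α ρ : ℝ) (N : ℕ) (hα0 : 0 < α) (hα1 : α ≤ 1/2)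
    (hρ : 1 < ρ) (hN : 1 ≤ N) :
    ∃ C : ℝ, 0 < C ∧ ∀ f : ℂ → ℂ, MemA α f → IsOuter f → ANorm α f ≤ 1 →
      (∀ γ, IsCompArc f γ → volume (angSet γ) < ENNReal.ofReal (1/2)) →
      ∀ Γ : Set ℂ, IsArcUnion f Γ →
        ∃ g : ℂ → ℂ, MemA α g ∧
          (∀ z ∈ uDisc, g z = outerPow f ρ z * (outerPart f Γ z) ^ N) ∧
          ANorm α g ≤ C := by
  set η := min (ρ - 1) 1 with hη
  have hη0 : 0 < η := lt_min (by linarith) one_pos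
  have hη1 : η ≤ 1 := min_le_right _ _
  have hηρ : 1 + η ≤ ρ := by linarith [min_le_left (ρ - 1) 1]
  obtain ⟨Q, hQ0, hQ⟩ := exists_product_dirichlet_bound hα0 hα1 hη0 hη1 hηρ N
  have hpi := Real.pi_pos
  refine ⟨1 + (ρ + N + N * (288 * Real.pi / η) * (2 * (2 / α + 1)) + 4) + Real.sqrt Q,
    by positivity, fun f hfA hf hn harc Γ hΓ => ?_⟩
  have hgap := exists_zeroAngle_near harc
  obtain ⟨hd, h1, h2, h3⟩ := product_deriv_growth (N := N) hα0 hα1 hη0 hη1 hηρ hfA hf hn hgap hΓ rfl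
  obtain ⟨g, hg, hlip⟩ := exists_memLip_extension hd hα0 hα1 h3
  have hder : ∀ z ∈ uDisc, deriv g z =
      deriv (fun z => outerPow f ρ z * (outerPart f Γ z) ^ N) z := fun z hz =>
    ((EventuallyEq.deriv_eq (eventually_of_mem (isOpen_ball.mem_nhds hz) hg)))
  obtain ⟨hdir, hnorm⟩ := memDir_and_ANorm_le hlip.1.1 hQ0 (fun z hz => (hg z hz).symm ▸ h1 z hz)
    (fun z hz => (hder z hz).symm ▸ h2 z hz) (by
      refine le_trans (le_of_eq ?_) (hQ f hfA hf hn hgap Γ hΓ)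
      exact setLIntegral_congr_fun measurableSet_ball fun z hz => by rw [hder z hz])
  exact ⟨g, ⟨hdir, hlip⟩, hg, hnorm⟩
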